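/- arXiv:2001.04098 — 2 statements merged into one kernel-verified Lean document; each statement's English description precedes it below -/
import Mathlib

section
/- There exists a universal constant c₄ > 0 such that the following holds. Let Ω ⊆ ℝ³ be open, T ∈ (0,∞), let (u,d,p) have the standard regularity on Ω_T and satisfy the weak pressure equation −∫_{Ω_T} pΔψ dz = ∫_{Ω_T}(u⊗u+∇d⊙∇d):∇²ψ dz for all ψ∈C_c^∞(Ω_T). Then for every z₀ ∈ ℝ³×ℝ and ρ > 0 with Q*_ρ(z₀) ⊆ Ω_T and every γ ∈ (0,1/2]: F(γρ) ≤ c₄ ( γ^{1/12} ( A(ρ) + D(ρ)^{4/3} + C(ρ)^{2/3} ) + γ^{−10} A(ρ) ( B(ρ)^{1/2} + B(ρ)² ) ). -/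
open MeasureTheory Set Filter
open scoped ENNReal NNReal

noncomputable section

abbrev E3 : Type := EuclideanSpace ℝ (Fin 3)

/-- Space-time `ℝ³ × ℝ`. -/
abbrev SpT : Type := E3 × ℝ

/-- Spatial partial derivative `∂_j` of a function on space-time. -/
def sderiv (j : Fin 3) (ψ : SpT → ℝ) (z : SpT) : ℝ :=
  fderiv ℝ ψ z ((EuclideanSpace.single j 1 : E3), (0 : ℝ))

/-- Time derivative `∂_t` of a function on space-time. -/
def tderiv (ψ : SpT → ℝ) (z : SpT) : ℝ :=
  fderiv ℝ ψ z ((0 : E3), (1 : ℝ))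

/-- Spatial Laplacian of a function on space-time. -/
def sLap (ψ : SpT → ℝ) (z : SpT) : ℝ := ∑ j, sderiv j (sderiv j ψ) z

/-- `ψ ∈ C_c^∞(U)`. -/
def IsTestOn (U : Set SpT) (ψ : SpT → ℝ) : Prop :=
  ContDiff ℝ (⊤ : ℕ∞) ψ ∧ HasCompactSupport ψ ∧ tsupport ψ ⊆ U

/-- `g` is the weak spatial gradient of `f` on `U`. -/
def WeakSGrad (U : Set SpT) (f : SpT → ℝ) (g : Fin 3 → SpT → ℝ) : Prop :=
  ∀ (j : Fin 3) (ψ : SpT → ℝ), IsTestOn U ψ →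
    ∫ z in U, f z * sderiv j ψ z = - ∫ z in U, g j z * ψ z

/-- Squared Frobenius norm of a `3×3` array, e.g. `|∇v|² = Σ_{i,j} (∂_j v_i)²`. -/
def nsq2 (M : Fin 3 → Fin 3 → ℝ) : ℝ := ∑ i, ∑ j, (M i j) ^ 2

/-- Squared norm of a `3×3×3` array, e.g. `|∇²d|² = Σ_{i,j,k} (∂_j ∂_k d_i)²`. -/
def nsq3 (A : Fin 3 → Fin 3 → Fin 3 → ℝ) : ℝ := ∑ i, ∑ j, ∑ k, (A i j k) ^ 2

/-- Open Euclidean ball in `ℝ³`. -/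
def ball3 (x : E3) (r : ℝ) : Set E3 := Metric.ball x r

/-- Parabolic cylinder `Q_r(z₀) = B_r(x₀) × (t₀ - r², t₀)`. -/
def Qcyl (z : SpT) (r : ℝ) : Set SpT := ball3 z.1 r ×ˢ Ioo (z.2 - r ^ 2) z.2

/-- Centered parabolic cylinder `Q*_r(z₀) = B_r(x₀) × (t₀ - (7/8)r², t₀ + (1/8)r²)`. -/
def Qstar (z : SpT) (r : ℝ) : Set SpT :=
  ball3 z.1 r ×ˢ Ioo (z.2 - 7 / 8 * r ^ 2) (z.2 + 1 / 8 * r ^ 2)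

/-- The time interval `I*_r(t₀) = (t₀ - (7/8)r², t₀ + (1/8)r²)`. -/
def Istar (t₀ r : ℝ) : Set ℝ := Ioo (t₀ - 7 / 8 * r ^ 2) (t₀ + 1 / 8 * r ^ 2)

/-- `u` is weakly divergence free on `U`. -/
def DivFreeOn (U : Set SpT) (u : SpT → E3) : Prop :=
  ∀ ψ : SpT → ℝ, IsTestOn U ψ → ∫ z in U, ∑ j, u z j * sderiv j ψ z = 0

/-- The weak pressure equation `-Δp = ∇·(∇ᵀ·(u⊗u + ∇d⊙∇d))` on `U`. -/
def PressureEqOn (U : Set SpT) (u : SpT → E3) (p : SpT → ℝ)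
    (Dd : SpT → Fin 3 → Fin 3 → ℝ) : Prop :=
  ∀ ψ : SpT → ℝ, IsTestOn U ψ →
    -∫ z in U, p z * sLap ψ z =
      ∫ z in U, ∑ i, ∑ j, (u z i * u z j + ∑ k, Dd z k i * Dd z k j) *
        sderiv i (sderiv j ψ) z

/-- Standard regularity of `(u,d,p)` on `Ω_T`, with weak spatial gradients `Du`, `Dd`, `D2d`
(`Du z i j = ∂_j u_i`, `Dd z i j = ∂_j d_i`, `D2d z i j k = ∂_j ∂_k d_i`). -/
structure StdReg (Ω : Set E3) (T : ℝ) (u d : SpT → E3) (p : SpT → ℝ)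
    (Du Dd : SpT → Fin 3 → Fin 3 → ℝ) (D2d : SpT → Fin 3 → Fin 3 → Fin 3 → ℝ) : Prop where
  meas_u : Measurable u
  meas_d : Measurable d
  meas_p : Measurable p
  meas_Du : Measurable Du
  meas_Dd : Measurable Dd
  meas_D2d : Measurable D2d
  grad_u : ∀ i : Fin 3, WeakSGrad (Ω ×ˢ Ioo 0 T) (fun z => u z i) (fun j z => Du z i j)
  grad_d : ∀ i : Fin 3, WeakSGrad (Ω ×ˢ Ioo 0 T) (fun z => d z i) (fun j z => Dd z i j)
  grad_Dd : ∀ i k : Fin 3,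
    WeakSGrad (Ω ×ˢ Ioo 0 T) (fun z => Dd z i k) (fun j z => D2d z i j k)
  linf_u : ∃ M : ℝ, ∀ᵐ t ∂(volume.restrict (Ioo 0 T)), ∫ x in Ω, ‖u (x, t)‖ ^ 2 ≤ M
  linf_d : ∃ M : ℝ, ∀ᵐ t ∂(volume.restrict (Ioo 0 T)), ∫ x in Ω, ‖d (x, t)‖ ^ 2 ≤ M
  linf_Dd : ∃ M : ℝ, ∀ᵐ t ∂(volume.restrict (Ioo 0 T)), ∫ x in Ω, nsq2 (Dd (x, t)) ≤ M
  l2_Du : IntegrableOn (fun z => nsq2 (Du z)) (Ω ×ˢ Ioo 0 T)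
  l2_D2d : IntegrableOn (fun z => nsq3 (D2d z)) (Ω ×ˢ Ioo 0 T)
  l32_p : IntegrableOn (fun z => |p z| ^ ((3 : ℝ) / 2)) (Ω ×ˢ Ioo 0 T)

/-- `A(r) = (1/r) esssup_{t ∈ I*_r} ∫_{B_r} (|u|² + |∇d|²) dx`. -/
def AQ (u : SpT → E3) (Dd : SpT → Fin 3 → Fin 3 → ℝ) (z₀ : SpT) (r : ℝ) : ℝ≥0∞ :=
  (ENNReal.ofReal r)⁻¹ *
    essSup (fun t => ∫⁻ x in ball3 z₀.1 r, ENNReal.ofReal (‖u (x, t)‖ ^ 2 + nsq2 (Dd (x, t))))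
      (volume.restrict (Istar z₀.2 r))

/-- `B(r) = (1/r) ∫∫_{Q*_r} (|∇u|² + |∇²d|²) dz`. -/
def BQ (Du : SpT → Fin 3 → Fin 3 → ℝ) (D2d : SpT → Fin 3 → Fin 3 → Fin 3 → ℝ)
    (z₀ : SpT) (r : ℝ) : ℝ≥0∞ :=
  (ENNReal.ofReal r)⁻¹ * ∫⁻ z in Qstar z₀ r, ENNReal.ofReal (nsq2 (Du z) + nsq3 (D2d z))

/-- `C(r) = (1/r²) ∫∫_{Q*_r} (|u|³ + |∇d|³) dz`. -/
def CQ (u : SpT → E3) (Dd : SpT → Fin 3 → Fin 3 → ℝ) (z₀ : SpT) (r : ℝ) : ℝ≥0∞ :=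
  (ENNReal.ofReal (r ^ 2))⁻¹ *
    ∫⁻ z in Qstar z₀ r, ENNReal.ofReal (‖u z‖ ^ 3 + Real.sqrt (nsq2 (Dd z)) ^ 3)

/-- `D(r) = (1/r²) ∫∫_{Q*_r} |p|^{3/2} dz`. -/
def DQ (p : SpT → ℝ) (z₀ : SpT) (r : ℝ) : ℝ≥0∞ :=
  (ENNReal.ofReal (r ^ 2))⁻¹ * ∫⁻ z in Qstar z₀ r, ENNReal.ofReal (|p z| ^ ((3 : ℝ) / 2))

/-- `F(r) = (1/r²) ∫∫_{Q*_r} |u||p| dz`. -/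
def FQ (u : SpT → E3) (p : SpT → ℝ) (z₀ : SpT) (r : ℝ) : ℝ≥0∞ :=
  (ENNReal.ofReal (r ^ 2))⁻¹ * ∫⁻ z in Qstar z₀ r, ENNReal.ofReal (‖u z‖ * |p z|)

section

open scoped Convolution Topology

instance instIsAddHaarMeasureSpT : (volume : Measure SpT).IsAddHaarMeasure :=
  inferInstanceAs (((volume : Measure E3).prod (volume : Measure ℝ)).IsAddHaarMeasure)

theorem continuous_integral_translate_mul {f k : SpT → ℝ} (hf : MemLp f 2 volume)
    (hk : MemLp k 2 volume) : Continuous fun y : SpT => ∫ z, f (z + y) * k z := by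
  have hmp : ∀ y : SpT, MeasurePreserving (fun z : SpT => z + y) volume volume :=
    fun y => measurePreserving_add_right volume y
  let g : C(SpT, C(SpT, SpT)) :=
    (ContinuousMap.mk (fun a : SpT × SpT => a.2 + a.1) (by fun_prop)).curry
  have hc : Continuous fun y : SpT =>
      Lp.compMeasurePreserving (g y) (hmp y) (hf.toLp f) :=
    Continuous.compMeasurePreservingLp (p := 2) continuous_const g.continuous hmp (by simp)
  have h2 : Continuous fun y : SpT =>
      inner ℝ (Lp.compMeasurePreserving (g y) (hmp y) (hf.toLp f)) (hk.toLp k) :=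
    hc.inner continuous_const
  convert h2 using 2 with y
  rw [L2.inner_def]
  apply integral_congr_ae
  have h3 := Lp.coeFn_compMeasurePreserving (hf.toLp f) (hmp y)
  have h4 := (hmp y).quasiMeasurePreserving.ae_eq_comp hf.coeFn_toLp
  filter_upwards [h3, h4, hk.coeFn_toLp] with z h3 h4 h5
  have h6 : (Lp.compMeasurePreserving (g y) (hmp y) (hf.toLp f)) z = f (z + y) := by
    rw [← Function.comp_apply (f := f) (g := fun z => z + y), ← h4]; exact h3
  rw [h6, h5]
  simp [mul_comm]

theorem tendsto_integral_convolution_mul {ι : Type*} {l : Filter ι} {φ : ι → ContDiffBump (0 : SpT)}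
    (hφ : Tendsto (fun i => (φ i).rOut) l (𝓝 0)) {f k : SpT → ℝ} (hf : MemLp f 2 volume)
    (hk : MemLp k 2 volume) :
    Tendsto (fun i => ∫ z, ((φ i).normed volume ⋆[ContinuousLinearMap.lsmul ℝ ℝ, volume] f) z * k z)
      l (𝓝 (∫ z, f z * k z)) := by
  have hc := continuous_integral_translate_mul hf hk
  have h1 := ContDiffBump.convolution_tendsto_right_of_continuous (μ := volume) hφ hc 0
  simp only [add_zero] at h1
  refine h1.congr fun i => ?_
  set η := (φ i).normed (volume : Measure SpT) with hη
  have hηi : Integrable η volume := (φ i).integrable_normed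
  have hf2 : Integrable (fun z => f z ^ 2) volume := hf.integrable_sq
  have hk2 : Integrable (fun z => k z ^ 2) volume := hk.integrable_sq
  have hswap : Integrable (Function.uncurry fun z y : SpT => η y * f (z - y) * k z)
      (volume.prod volume) := by
    have i1 := hηi.convolution_integrand (ContinuousLinearMap.lsmul ℝ ℝ) hf2
    have i2 : Integrable (fun p : SpT × SpT => k p.1 ^ 2 * η p.2) (volume.prod volume) :=
      hk2.mul_prod hηi
    refine (i1.add i2).mono' ?_ ?_
    · have hm : AEStronglyMeasurable (fun p : SpT × SpT => f (p.1 - p.2)) (volume.prod volume) :=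
        hf.1.comp_quasiMeasurePreserving (quasiMeasurePreserving_sub volume volume)
      have hη' : AEStronglyMeasurable (fun p : SpT × SpT => η p.2) (volume.prod volume) :=
        hηi.1.comp_snd
      have hk' : AEStronglyMeasurable (fun p : SpT × SpT => k p.1) (volume.prod volume) :=
        hk.1.comp_fst
      exact (hη'.mul hm).mul hk'
    · refine Eventually.of_forall fun p => ?_
      have hn : 0 ≤ η p.2 := (φ i).nonneg_normed _
      simp only [Function.uncurry, Real.norm_eq_abs, Pi.add_apply, ContinuousLinearMap.lsmul_apply,
        smul_eq_mul]
      rw [abs_mul, abs_mul, abs_of_nonneg hn]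
      have : |f (p.1 - p.2)| * |k p.1| ≤ f (p.1 - p.2) ^ 2 + k p.1 ^ 2 := by
        nlinarith [sq_abs (f (p.1 - p.2)), sq_abs (k p.1), sq_nonneg (|f (p.1 - p.2)| - |k p.1|),
          sq_nonneg (|f (p.1 - p.2)|), sq_nonneg (|k p.1|)]
      nlinarith
  calc (η ⋆[ContinuousLinearMap.lsmul ℝ ℝ, volume] fun y : SpT => ∫ z, f (z + y) * k z) 0
      = ∫ y, ∫ z, η y * f (z - y) * k z := by
        simp only [convolution_def, ContinuousLinearMap.lsmul_apply, smul_eq_mul, zero_sub]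
        congr 1 with y
        rw [← integral_const_mul]
        congr 1 with z
        rw [← sub_eq_add_neg]; ring
    _ = ∫ z, ∫ y, η y * f (z - y) * k z := (integral_integral_swap hswap).symm
    _ = _ := by
        congr 1 with z
        rw [integral_mul_const]
        simp only [convolution_def, ContinuousLinearMap.lsmul_apply, smul_eq_mul]

theorem IsTestOn.differentiable {U : Set SpT} {ψ : SpT → ℝ} (h : IsTestOn U ψ) :
    Differentiable ℝ ψ := h.1.differentiable (by simp)

theorem sderiv_mul {f g : SpT → ℝ} {z : SpT} (j : Fin 3) (hf : DifferentiableAt ℝ f z)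
    (hg : DifferentiableAt ℝ g z) :
    sderiv j (fun w => f w * g w) z = sderiv j f z * g z + f z * sderiv j g z := by
  simp only [sderiv]
  rw [fderiv_fun_mul hf hg]
  simp; ring

theorem contDiff_sderiv {ψ : SpT → ℝ} (h : ContDiff ℝ (⊤ : ℕ∞) ψ) (j : Fin 3) :
    ContDiff ℝ (⊤ : ℕ∞) (sderiv j ψ) := by
  have := h.fderiv_right (m := (⊤ : ℕ∞)) (by simp)
  exact this.clm_apply contDiff_const

theorem tsupport_sderiv_subset (ψ : SpT → ℝ) (j : Fin 3) : tsupport (sderiv j ψ) ⊆ tsupport ψ := by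
  refine closure_minimal (fun z hz => ?_) (isClosed_tsupport ψ)
  by_contra hn
  apply hz
  have : fderiv ℝ ψ z = 0 := by
    by_contra h0
    exact hn (support_fderiv_subset ℝ h0)
  simp [sderiv, this]

theorem IsTestOn.sderiv {U : Set SpT} {ψ : SpT → ℝ} (h : IsTestOn U ψ) (j : Fin 3) :
    IsTestOn U (sderiv j ψ) :=
  ⟨contDiff_sderiv h.1 j, h.2.1.mono' (subset_closure.trans (tsupport_sderiv_subset ψ j)),
    (tsupport_sderiv_subset ψ j).trans h.2.2⟩

theorem IsTestOn.mono {U V : Set SpT} {ψ : SpT → ℝ} (h : IsTestOn U ψ) (hUV : U ⊆ V) :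
    IsTestOn V ψ := ⟨h.1, h.2.1, h.2.2.trans hUV⟩

theorem IsTestOn.eq_zero {U : Set SpT} {ψ : SpT → ℝ} (h : IsTestOn U ψ) {z : SpT} (hz : z ∉ U) :
    ψ z = 0 := image_eq_zero_of_notMem_tsupport fun hn => hz (h.2.2 hn)

theorem IsTestOn.exists_bound {U : Set SpT} {ψ : SpT → ℝ} (h : IsTestOn U ψ) :
    ∃ C, ∀ z, ‖ψ z‖ ≤ C := h.1.continuous.bounded_above_of_compact_support h.2.1

theorem memLp_mul_test {U : Set SpT} {f ψ : SpT → ℝ} (hf : MemLp f 2 volume) (h : IsTestOn U ψ) :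
    MemLp (fun z => f z * ψ z) 2 volume := by
  obtain ⟨C, hC⟩ := h.exists_bound
  refine (hf.const_mul C).mono (hf.1.mul h.1.continuous.aestronglyMeasurable) ?_
  refine Eventually.of_forall fun z => ?_
  rw [norm_mul, norm_mul, mul_comm]
  gcongr
  exact (hC z).trans (le_abs_self C)

theorem sderiv_convolution_eq {Q : Set SpT} {F F' : SpT → ℝ} {j : Fin 3}
    (hF : MemLp F 2 volume)
    (hw : ∀ ψ, IsTestOn Q ψ → ∫ z, F z * sderiv j ψ z = -∫ z, F' z * ψ z)
    (φ : ContDiffBump (0 : SpT)) {z : SpT} (hz : Metric.closedBall z φ.rOut ⊆ Q) :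
    sderiv j (φ.normed volume ⋆[ContinuousLinearMap.lsmul ℝ ℝ, volume] F) z =
      (φ.normed volume ⋆[ContinuousLinearMap.lsmul ℝ ℝ, volume] F') z := by
  set η := φ.normed (volume : Measure SpT) with hη
  have hηs : HasCompactSupport η := φ.hasCompactSupport_normed
  have hηd : ContDiff ℝ (⊤ : ℕ∞) η := φ.contDiff_normed
  have hFl : LocallyIntegrable F volume := hF.locallyIntegrable (by norm_num)
  have hd := hηs.hasFDerivAt_convolution_left (ContinuousLinearMap.lsmul ℝ ℝ)
    (hηd.of_le (by simp)) hFl z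
  have htest : IsTestOn Q fun w => η (z - w) := by
    have hsub : Function.support (fun w => η (z - w)) ⊆ Metric.closedBall z φ.rOut := by
      intro w hw
      have : z - w ∈ Function.support η := hw
      rw [hη, φ.support_normed_eq, Metric.mem_ball, dist_zero_right] at this
      rw [Metric.mem_closedBall, dist_comm, dist_eq_norm]; exact this.le
    refine ⟨hηd.comp (contDiff_const.sub contDiff_id), ?_, ?_⟩
    · exact HasCompactSupport.of_support_subset_isCompact (isCompact_closedBall z φ.rOut) hsub
    · exact (closure_minimal hsub Metric.isClosed_closedBall).trans hz
  have hsd : ∀ w, sderiv j (fun w => η (z - w)) w = - sderiv j η (z - w) := by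
    intro w
    have h1 : HasFDerivAt (fun w => η (z - w)) ((fderiv ℝ η (z - w)).comp
        (-(ContinuousLinearMap.id ℝ SpT))) w :=
      HasFDerivAt.comp (f := fun w => z - w) w ((hηd.differentiable (by simp)) _).hasFDerivAt
        ((hasFDerivAt_id w).const_sub z)
    simp only [sderiv]
    rw [h1.fderiv]; simp only [ContinuousLinearMap.comp_apply, neg_apply, ContinuousLinearMap.id_apply, map_neg]
  have e1 : sderiv j (η ⋆[ContinuousLinearMap.lsmul ℝ ℝ, volume] F) z =
      ∫ w, sderiv j η w * F (z - w) := by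
    simp only [sderiv]
    rw [hd.fderiv, convolution_def, ContinuousLinearMap.integral_apply]
    · simp [ContinuousLinearMap.precompL_apply]
    · exact (HasCompactSupport.convolutionExists_left _ (hηs.fderiv ℝ)
        (hηd.continuous_fderiv (by simp)) hFl z)
  have e2 := hw _ htest
  simp only [hsd] at e2
  rw [e1]
  rw [convolution_def]
  simp only [mul_neg, integral_neg, neg_inj] at e2
  rw [← integral_sub_left_eq_self (fun w => F w * sderiv j η (z - w)) volume z,
    ← integral_sub_left_eq_self (fun w => F' w * η (z - w)) volume z] at e2
  simp only [sub_sub_cancel] at e2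
  simp only [ContinuousLinearMap.lsmul_apply, smul_eq_mul, mul_comm (sderiv j η _),
    mul_comm (η _)]
  exact e2

theorem weak_product_rule {Q : Set SpT} (hQ : IsOpen Q) {F F' G G' : SpT → ℝ} {j : Fin 3}
    (hF : MemLp F 2 volume) (hF' : MemLp F' 2 volume) (hG : MemLp G 2 volume)
    (hG' : MemLp G' 2 volume)
    (hwF : ∀ ψ, IsTestOn Q ψ → ∫ z, F z * sderiv j ψ z = -∫ z, F' z * ψ z)
    (hwG : ∀ ψ, IsTestOn Q ψ → ∫ z, G z * sderiv j ψ z = -∫ z, G' z * ψ z)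
    {ψ : SpT → ℝ} (hψ : IsTestOn Q ψ) :
    ∫ z, F z * G z * sderiv j ψ z = -∫ z, (F' z * G z + F z * G' z) * ψ z := by
  obtain ⟨δ, hδ, hsub⟩ := hψ.2.1.isCompact.exists_cthickening_subset_open hQ hψ.2.2
  let φ : ℕ → ContDiffBump (0 : SpT) := fun n =>
    { rIn := δ / (n + 2) / 2, rOut := δ / (n + 2), rIn_pos := by positivity,
      rIn_lt_rOut := by
        have : 0 < δ / (n + 2) := by positivity
        linarith }
  have hr : Tendsto (fun n => (φ n).rOut) atTop (𝓝 0) := by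
    have : Tendsto (fun n : ℕ => δ / ((n : ℝ) + 2)) atTop (𝓝 0) :=
      Tendsto.div_atTop tendsto_const_nhds
        (tendsto_atTop_add_const_right _ _ tendsto_natCast_atTop_atTop)
    exact this
  have hrδ : ∀ n, (φ n).rOut ≤ δ := by
    intro n
    refine div_le_self hδ.le ?_
    have : (0 : ℝ) ≤ n := n.cast_nonneg
    linarith
  have hk1 := memLp_mul_test hG hψ
  have hk2 := memLp_mul_test hG (hψ.sderiv j)
  have hk3 := memLp_mul_test hG' hψ
  have t1 := tendsto_integral_convolution_mul hr hF' hk1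
  have t2 := tendsto_integral_convolution_mul hr hF hk2
  have t3 := tendsto_integral_convolution_mul hr hF hk3
  have hFl : LocallyIntegrable F volume := hF.locallyIntegrable (by norm_num)
  have hF'l : LocallyIntegrable F' volume := hF'.locallyIntegrable (by norm_num)
  have key : ∀ n,
      (∫ z, ((φ n).normed volume ⋆[ContinuousLinearMap.lsmul ℝ ℝ, volume] F') z * (G z * ψ z)) +
      (∫ z, ((φ n).normed volume ⋆[ContinuousLinearMap.lsmul ℝ ℝ, volume] F) z *
        (G z * sderiv j ψ z)) +
      (∫ z, ((φ n).normed volume ⋆[ContinuousLinearMap.lsmul ℝ ℝ, volume] F) z * (G' z * ψ z))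
        = 0 := by
    intro n
    set f := (φ n).normed volume ⋆[ContinuousLinearMap.lsmul ℝ ℝ, volume] F with hf
    set f' := (φ n).normed volume ⋆[ContinuousLinearMap.lsmul ℝ ℝ, volume] F' with hf'
    have hfd : ContDiff ℝ (⊤ : ℕ∞) f := (φ n).hasCompactSupport_normed.contDiff_convolution_left
      (ContinuousLinearMap.lsmul ℝ ℝ) (φ n).contDiff_normed hFl
    have hfd' : ContDiff ℝ (⊤ : ℕ∞) f' := (φ n).hasCompactSupport_normed.contDiff_convolution_left
      (ContinuousLinearMap.lsmul ℝ ℝ) (φ n).contDiff_normed hF'l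
    have mk : ∀ {g χ : SpT → ℝ}, ContDiff ℝ (⊤ : ℕ∞) g → IsTestOn Q χ →
        IsTestOn Q fun z => g z * χ z := fun {g χ} hg hχ =>
      ⟨hg.mul hχ.1, hχ.2.1.mul_left, (closure_mono (Function.support_mul_subset_right g χ)).trans
        hχ.2.2⟩
    have ii : ∀ {χ : SpT → ℝ} {g k : SpT → ℝ}, ContDiff ℝ (⊤ : ℕ∞) g → IsTestOn Q χ →
        MemLp k 2 volume → Integrable (fun z => g z * (k z * χ z)) volume := by
      intro χ g k hg hχ hk
      have h1 := mk hg hχ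
      have h2 : LocallyIntegrable k volume := hk.locallyIntegrable (by norm_num)
      have h3 := h2.integrable_smul_left_of_hasCompactSupport h1.1.continuous h1.2.1
      refine h3.congr (Eventually.of_forall fun z => ?_)
      simp only [smul_eq_mul]; ring
    rw [← integral_add (ii hfd' hψ hG) (ii hfd (hψ.sderiv j) hG), ← integral_add _ (ii hfd hψ hG')]
    swap
    · exact (ii hfd' hψ hG).add (ii hfd (hψ.sderiv j) hG)
    have h0 := hwG _ (mk hfd hψ)
    have hs : ∀ z, sderiv j (fun w => f w * ψ w) z = f' z * ψ z + f z * sderiv j ψ z := by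
      intro z
      rw [sderiv_mul j ((hfd.differentiable (by simp)) z) (hψ.differentiable z)]
      by_cases hz : z ∈ tsupport ψ
      · rw [sderiv_convolution_eq hF hwF]
        refine Subset.trans ?_ hsub
        exact (Metric.closedBall_subset_closedBall (hrδ n)).trans
          (Metric.closedBall_subset_cthickening hz δ)
      · rw [image_eq_zero_of_notMem_tsupport hz]; simp
    simp only [hs] at h0
    rw [eq_neg_iff_add_eq_zero, ← integral_add] at h0
    · rw [← h0]
      congr 1 with z
      ring
    · refine ((ii hfd' hψ hG).add (ii hfd (hψ.sderiv j) hG)).congr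
        (Eventually.of_forall fun z => ?_)
      simp only [Pi.add_apply]; ring
    · refine (ii hfd hψ hG').congr (Eventually.of_forall fun z => ?_)
      ring
  have hlim := tendsto_nhds_unique (((t1.add t2).add t3).congr key) tendsto_const_nhds
  have i1 := hF'.integrable_mul hk1
  have i2 := hF.integrable_mul hk2
  have i3 := hF.integrable_mul hk3
  simp only [Pi.mul_def] at i1 i2 i3
  rw [eq_neg_iff_add_eq_zero, ← integral_add, ← hlim, ← integral_add i1 i2, ← integral_add _ i3]
  · congr 1 with z
    ring
  · exact i1.add i2
  · refine i2.congr (Eventually.of_forall fun z => ?_)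
    ring
  · refine (i1.add i3).congr (Eventually.of_forall fun z => ?_)
    simp only [Pi.add_apply]; ring

theorem weak_product_rule_on {W Q : Set SpT} (hQ : IsOpen Q) (hQW : Q ⊆ W)
    {f f' g g' : SpT → ℝ} {j : Fin 3}
    (hf : MemLp f 2 (volume.restrict Q)) (hf' : MemLp f' 2 (volume.restrict Q))
    (hg : MemLp g 2 (volume.restrict Q)) (hg' : MemLp g' 2 (volume.restrict Q))
    (hwf : ∀ ψ, IsTestOn W ψ → ∫ z in W, f z * sderiv j ψ z = -∫ z in W, f' z * ψ z)
    (hwg : ∀ ψ, IsTestOn W ψ → ∫ z in W, g z * sderiv j ψ z = -∫ z in W, g' z * ψ z)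
    {ψ : SpT → ℝ} (hψ : IsTestOn Q ψ) :
    ∫ z in Q, f z * g z * sderiv j ψ z = -∫ z in Q, (f' z * g z + f z * g' z) * ψ z := by
  have hm := hQ.measurableSet
  have aux : ∀ {χ a : SpT → ℝ}, IsTestOn Q χ →
      ∫ z, Q.indicator a z * χ z = ∫ z in W, a z * χ z := by
    intro χ a hχ
    rw [setIntegral_eq_integral_of_forall_compl_eq_zero]
    · congr 1 with z
      by_cases hz : z ∈ Q
      · rw [indicator_of_mem hz]
      · rw [hχ.eq_zero hz]; simp
    · intro z hz
      rw [hχ.eq_zero (fun h => hz (hQW h)), mul_zero]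
  have hw : ∀ {a a' : SpT → ℝ}, (∀ ψ, IsTestOn W ψ → ∫ z in W, a z * sderiv j ψ z =
      -∫ z in W, a' z * ψ z) → ∀ ψ, IsTestOn Q ψ →
      ∫ z, Q.indicator a z * sderiv j ψ z = -∫ z, Q.indicator a' z * ψ z := by
    intro a a' h χ hχ
    rw [aux (hχ.sderiv j), aux hχ]
    exact h χ (hχ.mono hQW)
  have := weak_product_rule hQ ((memLp_indicator_iff_restrict hm).2 hf)
    ((memLp_indicator_iff_restrict hm).2 hf') ((memLp_indicator_iff_restrict hm).2 hg)
    ((memLp_indicator_iff_restrict hm).2 hg') (hw hwf) (hw hwg) hψ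
  rw [← integral_indicator hm, ← integral_indicator hm]
  calc _ = ∫ z, Q.indicator f z * Q.indicator g z * sderiv j ψ z := by
        congr 1 with z
        by_cases hz : z ∈ Q <;> simp [hz]
    _ = _ := by
        rw [this]
        congr 2 with z
        by_cases hz : z ∈ Q <;> simp [hz]

theorem memLp_two_of_abs_le {Q : Set SpT} {f U : SpT → ℝ} (hf : Measurable f)
    (hfU : ∀ z, |f z| ≤ U z) (hU : ∫⁻ z in Q, ENNReal.ofReal (U z ^ 2) < ∞) :
    MemLp f 2 (volume.restrict Q) := by
  rw [memLp_two_iff_integrable_sq hf.aestronglyMeasurable]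
  refine ⟨(hf.pow_const 2).aestronglyMeasurable, ?_⟩
  refine lt_of_le_of_lt (lintegral_mono fun z => ?_) hU
  rw [Real.enorm_eq_ofReal_abs]
  refine ENNReal.ofReal_le_ofReal ?_
  rw [abs_of_nonneg (sq_nonneg _)]
  change f z ^ 2 ≤ U z ^ 2
  rw [← sq_abs (f z)]
  exact pow_le_pow_left₀ (abs_nonneg _) (hfU z) 2

/-- The joint size `(|u|² + |∇d|²)^{1/2}`. -/
def sizeU (u : SpT → E3) (Dd : SpT → Fin 3 → Fin 3 → ℝ) (z : SpT) : ℝ :=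
  Real.sqrt (‖u z‖ ^ 2 + nsq2 (Dd z))

/-- The joint size `(|∇u|² + |∇²d|²)^{1/2}`. -/
def sizeV (Du : SpT → Fin 3 → Fin 3 → ℝ) (D2d : SpT → Fin 3 → Fin 3 → Fin 3 → ℝ) (z : SpT) : ℝ :=
  Real.sqrt (nsq2 (Du z) + nsq3 (D2d z))

theorem nsq2_nonneg (M : Fin 3 → Fin 3 → ℝ) : 0 ≤ nsq2 M :=
  Finset.sum_nonneg fun _ _ => Finset.sum_nonneg fun _ _ => sq_nonneg _

theorem nsq3_nonneg (M : Fin 3 → Fin 3 → Fin 3 → ℝ) : 0 ≤ nsq3 M :=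
  Finset.sum_nonneg fun _ _ => Finset.sum_nonneg fun _ _ => Finset.sum_nonneg fun _ _ => sq_nonneg _

theorem sq_le_nsq2 (M : Fin 3 → Fin 3 → ℝ) (i j : Fin 3) : M i j ^ 2 ≤ nsq2 M :=
  (Finset.single_le_sum (f := fun j => M i j ^ 2) (fun _ _ => sq_nonneg _)
    (Finset.mem_univ j)).trans
  (Finset.single_le_sum (f := fun i => ∑ j, M i j ^ 2)
    (fun _ _ => Finset.sum_nonneg fun _ _ => sq_nonneg _) (Finset.mem_univ i))

theorem sq_le_nsq3 (M : Fin 3 → Fin 3 → Fin 3 → ℝ) (i j k : Fin 3) : M i j k ^ 2 ≤ nsq3 M :=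
  (sq_le_nsq2 (M i) j k).trans
  (Finset.single_le_sum (f := fun i => nsq2 (M i))
    (fun _ _ => nsq2_nonneg _) (Finset.mem_univ i))

theorem sizeU_sq (u : SpT → E3) (Dd : SpT → Fin 3 → Fin 3 → ℝ) (z : SpT) :
    sizeU u Dd z ^ 2 = ‖u z‖ ^ 2 + nsq2 (Dd z) :=
  Real.sq_sqrt (add_nonneg (sq_nonneg _) (nsq2_nonneg _))

theorem sizeV_sq (Du : SpT → Fin 3 → Fin 3 → ℝ) (D2d : SpT → Fin 3 → Fin 3 → Fin 3 → ℝ) (z : SpT) :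
    sizeV Du D2d z ^ 2 = nsq2 (Du z) + nsq3 (D2d z) :=
  Real.sq_sqrt (add_nonneg (nsq2_nonneg _) (nsq3_nonneg _))

theorem norm_le_sizeU (u : SpT → E3) (Dd : SpT → Fin 3 → Fin 3 → ℝ) (z : SpT) :
    ‖u z‖ ≤ sizeU u Dd z :=
  Real.le_sqrt_of_sq_le (by linarith [nsq2_nonneg (Dd z)])

theorem pressure_estimate {W Q : Set SpT} (hQ : IsOpen Q) (hQW : Q ⊆ W)
    {u : SpT → E3} {p : SpT → ℝ} {Du Dd : SpT → Fin 3 → Fin 3 → ℝ}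
    {D2d : SpT → Fin 3 → Fin 3 → Fin 3 → ℝ}
    (mu : Measurable u) (mDu : Measurable Du) (mDd : Measurable Dd) (mD2d : Measurable D2d)
    (hu : ∀ i : Fin 3, WeakSGrad W (fun z => u z i) (fun j z => Du z i j))
    (hd : ∀ i k : Fin 3, WeakSGrad W (fun z => Dd z i k) (fun j z => D2d z i j k))
    (hU : ∫⁻ z in Q, ENNReal.ofReal (sizeU u Dd z ^ 2) < ∞)
    (hV : ∫⁻ z in Q, ENNReal.ofReal (sizeV Du D2d z ^ 2) < ∞)
    (hp : PressureEqOn W u p Dd) {ψ : SpT → ℝ} (hψ : IsTestOn Q ψ) :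
    ‖∫ z in Q, p z * sLap ψ z‖ₑ ≤
      ∫⁻ z in Q, ENNReal.ofReal (24 * (sizeU u Dd z * sizeV Du D2d z * ∑ j, |sderiv j ψ z|)) := by
  set U := sizeU u Dd with hUdef
  set V := sizeV Du D2d with hVdef
  have bu : ∀ z i, |u z i| ≤ U z := fun z i =>
    (PiLp.norm_apply_le (u z) i).trans (norm_le_sizeU u Dd z)
  have bDd : ∀ z i j, |Dd z i j| ≤ U z := fun z i j => by
    refine Real.abs_le_sqrt ?_
    linarith [sq_le_nsq2 (Dd z) i j, sq_nonneg ‖u z‖]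
  have bDu : ∀ z i j, |Du z i j| ≤ V z := fun z i j => by
    refine Real.abs_le_sqrt ?_
    linarith [sq_le_nsq2 (Du z) i j, nsq3_nonneg (D2d z)]
  have bD2d : ∀ z i j k, |D2d z i j k| ≤ V z := fun z i j k => by
    refine Real.abs_le_sqrt ?_
    linarith [sq_le_nsq3 (D2d z) i j k, nsq2_nonneg (Du z)]
  have mui : ∀ i, Measurable fun z => u z i := fun i => by fun_prop
  have mDui : ∀ i j, Measurable fun z => Du z i j := fun i j => by fun_prop
  have mDdi : ∀ i j, Measurable fun z => Dd z i j := fun i j => by fun_prop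
  have mD2di : ∀ i j k, Measurable fun z => D2d z i j k := fun i j k => by fun_prop
  have Lu := fun i => memLp_two_of_abs_le (mui i) (fun z => bu z i) hU
  have LDd := fun i j => memLp_two_of_abs_le (mDdi i j) (fun z => bDd z i j) hU
  have LDu := fun i j => memLp_two_of_abs_le (mDui i j) (fun z => bDu z i j) hV
  have LD2d := fun i j k => memLp_two_of_abs_le (mD2di i j k) (fun z => bD2d z i j k) hV
  have imul : ∀ {a b χ : SpT → ℝ}, MemLp a 2 (volume.restrict Q) → MemLp b 2 (volume.restrict Q) →
      IsTestOn Q χ → Integrable (fun z => a z * b z * χ z) (volume.restrict Q) := by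
    intro a b χ ha hb hχ
    obtain ⟨C, hC⟩ := hχ.exists_bound
    exact (ha.integrable_mul hb).mul_bdd (c := C) hχ.1.continuous.aestronglyMeasurable
      (Eventually.of_forall hC)
  have e0 := hp ψ (hψ.mono hQW)
  have aux : ∀ {h : SpT → ℝ}, (∀ z, z ∉ Q → h z = 0) → ∫ z in W, h z = ∫ z in Q, h z := by
    intro h hh
    rw [setIntegral_eq_integral_of_forall_compl_eq_zero fun z hz => hh z fun h => hz (hQW h),
      setIntegral_eq_integral_of_forall_compl_eq_zero fun z hz => hh z hz]
  rw [aux, aux] at e0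
  rotate_left
  · intro z hz
    refine Finset.sum_eq_zero fun i _ => Finset.sum_eq_zero fun j _ => ?_
    rw [((hψ.sderiv j).sderiv i).eq_zero hz, mul_zero]
  · intro z hz
    rw [sLap, Finset.sum_eq_zero fun j _ => ((hψ.sderiv j).sderiv j).eq_zero hz, mul_zero]
  let a : Fin 3 → Fin 3 → SpT → ℝ := fun i j z =>
    (Du z i i * u z j + u z i * Du z j i) +
      ∑ k, (D2d z k i i * Dd z k j + Dd z k i * D2d z k i j)
  have eij : ∀ i j : Fin 3, ∫ z in Q, (u z i * u z j + ∑ k, Dd z k i * Dd z k j) *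
      sderiv i (sderiv j ψ) z = -∫ z in Q, a i j z * sderiv j ψ z := by
    intro i j
    have h1 := weak_product_rule_on hQ hQW (Lu i) (LDu i i) (Lu j) (LDu j i)
      (hu i i) (hu j i) (hψ.sderiv j)
    have h2 := fun k => weak_product_rule_on hQ hQW (LDd k i) (LD2d k i i) (LDd k j) (LD2d k i j)
      (hd k i i) (hd k j i) (hψ.sderiv j)
    have hψj := hψ.sderiv j
    have hψij := hψj.sderiv i
    calc _ = ∫ z in Q, (u z i * u z j * sderiv i (sderiv j ψ) z +
            ∑ k, Dd z k i * Dd z k j * sderiv i (sderiv j ψ) z) := by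
          congr 1 with z
          rw [add_mul, Finset.sum_mul]
      _ = _ := by
          rw [integral_add (imul (Lu i) (Lu j) hψij)
            (integrable_finsetSum _ fun k _ => imul (LDd k i) (LDd k j) hψij),
            integral_finsetSum _ fun k _ => imul (LDd k i) (LDd k j) hψij, h1]
          simp only [h2]
          rw [Finset.sum_neg_distrib, ← neg_add, ← integral_finsetSum, ← integral_add]
          · congr 2 with z
            simp only [a, add_mul, Finset.sum_mul]
          · refine ((imul (LDu i i) (Lu j) hψj).add (imul (Lu i) (LDu j i) hψj)).congr
              (Eventually.of_forall fun z => ?_)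
            simp only [Pi.add_apply, add_mul]
          · refine integrable_finsetSum _ fun k _ => ?_
            refine ((imul (LD2d k i i) (LDd k j) hψj).add (imul (LDd k i) (LD2d k i j) hψj)).congr
              (Eventually.of_forall fun z => ?_)
            simp only [Pi.add_apply, add_mul]
          · intro k _
            refine ((imul (LD2d k i i) (LDd k j) hψj).add (imul (LDd k i) (LD2d k i j) hψj)).congr
              (Eventually.of_forall fun z => ?_)
            simp only [Pi.add_apply, add_mul]
  have ia : ∀ i j, Integrable (fun z => a i j z * sderiv j ψ z) (volume.restrict Q) := by
    intro i j
    have hψj := hψ.sderiv j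
    refine (((imul (LDu i i) (Lu j) hψj).add (imul (Lu i) (LDu j i) hψj)).add
      (integrable_finsetSum Finset.univ fun k _ =>
        (imul (LD2d k i i) (LDd k j) hψj).add (imul (LDd k i) (LD2d k i j) hψj))).congr
      (Eventually.of_forall fun z => ?_)
    simp only [Pi.add_apply, add_mul, Finset.sum_mul, a]
  have iG : ∀ i j, Integrable (fun z => (u z i * u z j + ∑ k, Dd z k i * Dd z k j) *
      sderiv i (sderiv j ψ) z) (volume.restrict Q) := by
    intro i j
    have hψij := (hψ.sderiv j).sderiv i
    refine ((imul (Lu i) (Lu j) hψij).add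
      (integrable_finsetSum Finset.univ fun k _ => imul (LDd k i) (LDd k j) hψij)).congr
      (Eventually.of_forall fun z => ?_)
    simp only [Pi.add_apply, add_mul, Finset.sum_mul]
  have e1 : ∫ z in Q, p z * sLap ψ z = ∫ z in Q, ∑ i, ∑ j, a i j z * sderiv j ψ z := by
    rw [← neg_inj, e0, integral_finsetSum _ fun i _ => integrable_finsetSum _ fun j _ => iG i j,
      integral_finsetSum _ fun i _ => integrable_finsetSum _ fun j _ => ia i j,
      ← Finset.sum_neg_distrib]
    refine Finset.sum_congr rfl fun i _ => ?_
    rw [integral_finsetSum _ fun j _ => iG i j, integral_finsetSum _ fun j _ => ia i j,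
      ← Finset.sum_neg_distrib]
    exact Finset.sum_congr rfl fun j _ => eij i j
  rw [e1]
  refine (enorm_integral_le_lintegral_enorm _).trans (lintegral_mono fun z => ?_)
  rw [Real.enorm_eq_ofReal_abs]
  refine ENNReal.ofReal_le_ofReal ?_
  have mulb : ∀ {x y : ℝ}, |x| ≤ U z → |y| ≤ V z → |x * y| ≤ U z * V z := by
    intro x y hx hy
    rw [abs_mul]
    exact mul_le_mul hx hy (abs_nonneg _) ((abs_nonneg _).trans hx)
  have mulb' : ∀ {x y : ℝ}, |x| ≤ V z → |y| ≤ U z → |x * y| ≤ U z * V z := by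
    intro x y hx hy
    rw [mul_comm]; exact mulb hy hx
  have ha : ∀ i j, |a i j z| ≤ 8 * (U z * V z) := by
    intro i j
    have h1 := mulb' (bDu z i i) (bu z j)
    have h2 := mulb (bu z i) (bDu z j i)
    have h3 : ∀ k, |D2d z k i i * Dd z k j + Dd z k i * D2d z k i j| ≤ 2 * (U z * V z) := fun k =>
      (abs_add_le _ _).trans (by
        linarith [mulb' (bD2d z k i i) (bDd z k j), mulb (bDd z k i) (bD2d z k i j)])
    have h4 : |∑ k, (D2d z k i i * Dd z k j + Dd z k i * D2d z k i j)| ≤ 6 * (U z * V z) := by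
      refine (Finset.abs_sum_le_sum_abs _ _).trans ?_
      refine (Finset.sum_le_sum fun k _ => h3 k).trans ?_
      simp; linarith
    refine (abs_add_le _ _).trans ?_
    linarith [abs_add_le (Du z i i * u z j) (u z i * Du z j i)]
  calc |∑ i, ∑ j, a i j z * sderiv j ψ z| ≤ ∑ i : Fin 3, ∑ j, 8 * (U z * V z) * |sderiv j ψ z| := by
        refine (Finset.abs_sum_le_sum_abs _ _).trans (Finset.sum_le_sum fun i _ => ?_)
        refine (Finset.abs_sum_le_sum_abs _ _).trans (Finset.sum_le_sum fun j _ => ?_)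
        rw [abs_mul]
        exact mul_le_mul_of_nonneg_right (ha i j) (abs_nonneg _)
    _ = _ := by
        simp only [← Finset.mul_sum]
        simp; ring

theorem sderiv_comp_fst {f : E3 → ℝ} (hf : Differentiable ℝ f) (j : Fin 3) (z : SpT) :
    sderiv j (fun w => f w.1) z = fderiv ℝ f z.1 (EuclideanSpace.single j 1) := by
  have h : HasFDerivAt (fun w : SpT => f w.1)
      ((fderiv ℝ f z.1).comp (ContinuousLinearMap.fst ℝ E3 ℝ)) z :=
    HasFDerivAt.comp (f := Prod.fst) z (hf z.1).hasFDerivAt hasFDerivAt_fst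
  simp only [sderiv]
  rw [h.fderiv]
  simp

theorem sderiv_comp_snd {f : ℝ → ℝ} (hf : Differentiable ℝ f) (j : Fin 3) (z : SpT) :
    sderiv j (fun w => f w.2) z = 0 := by
  have h : HasFDerivAt (fun w : SpT => f w.2)
      ((fderiv ℝ f z.2).comp (ContinuousLinearMap.snd ℝ E3 ℝ)) z :=
    HasFDerivAt.comp (f := Prod.snd) z (hf z.2).hasFDerivAt hasFDerivAt_snd
  simp only [sderiv]
  rw [h.fderiv]
  simp

/-- The regularised squared distance `|x - y|² + e`. -/
def regDist (e : ℝ) (x : E3) (z : SpT) : ℝ := ‖x - z.1‖ ^ 2 + e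

theorem regDist_pos {e : ℝ} (he : 0 < e) (x : E3) (z : SpT) : 0 < regDist e x z := by
  unfold regDist; positivity

theorem contDiff_regDist (e : ℝ) (x : E3) : ContDiff ℝ (⊤ : ℕ∞) (regDist e x) := by
  unfold regDist
  exact ((contDiff_const.sub contDiff_fst).norm_sq ℝ).add contDiff_const

theorem contDiff_regDist_rpow {e : ℝ} (he : 0 < e) (x : E3) (a : ℝ) :
    ContDiff ℝ (⊤ : ℕ∞) fun z => regDist e x z ^ a :=
  (contDiff_regDist e x).rpow_const_of_ne fun z => (regDist_pos he x z).ne'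

theorem sderiv_regDist (e : ℝ) (x : E3) (j : Fin 3) (z : SpT) :
    sderiv j (regDist e x) z = -2 * (x - z.1) j := by
  have h : HasFDerivAt (fun z : SpT => x - z.1) (-(ContinuousLinearMap.fst ℝ E3 ℝ)) z :=
    hasFDerivAt_fst.const_sub x
  have h2 := (h.norm_sq).add_const e
  unfold sderiv
  rw [show regDist e x = fun z : SpT => ‖x - z.1‖ ^ 2 + e from rfl, h2.fderiv]
  simp [EuclideanSpace.inner_single_right]
  ring

theorem sderiv_regDist_rpow {e : ℝ} (he : 0 < e) (x : E3) (a : ℝ) (j : Fin 3) (z : SpT) :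
    sderiv j (fun z => regDist e x z ^ a) z =
      a * regDist e x z ^ (a - 1) * (-2 * (x - z.1) j) := by
  have h := ((contDiff_regDist e x).differentiable (by simp) z).hasFDerivAt.rpow_const
    (p := a) (Or.inl (regDist_pos he x z).ne')
  rw [← sderiv_regDist e x j z]
  simp only [sderiv]
  rw [h.fderiv]
  simp

theorem sderiv_newton {e : ℝ} (he : 0 < e) (x : E3) (j : Fin 3) :
    sderiv j (fun z => regDist e x z ^ (-1 / 2 : ℝ)) =
      fun z => (x - z.1) j * regDist e x z ^ (-3 / 2 : ℝ) := by
  ext z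
  rw [sderiv_regDist_rpow he]
  norm_num
  ring

theorem sderiv_coord (x : E3) (j : Fin 3) (z : SpT) :
    sderiv j (fun z : SpT => (x - z.1) j) z = -1 := by
  have h : HasFDerivAt (fun z : SpT => (x - z.1) j)
      ((EuclideanSpace.proj j : E3 →L[ℝ] ℝ).comp (-(ContinuousLinearMap.fst ℝ E3 ℝ))) z :=
    (EuclideanSpace.proj j : E3 →L[ℝ] ℝ).hasFDerivAt.comp z (hasFDerivAt_fst.const_sub x)
  simp only [sderiv]
  rw [h.fderiv]
  simp

theorem sLap_newton {e : ℝ} (he : 0 < e) (x : E3) (z : SpT) :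
    sLap (fun z => regDist e x z ^ (-1 / 2 : ℝ)) z = -(3 * e * regDist e x z ^ (-5 / 2 : ℝ)) := by
  have hr := regDist_pos he x z
  have h1 : ∀ j : Fin 3, sderiv j (sderiv j (fun z => regDist e x z ^ (-1 / 2 : ℝ))) z =
      -regDist e x z ^ (-3 / 2 : ℝ) + 3 * ((x - z.1) j) ^ 2 * regDist e x z ^ (-5 / 2 : ℝ) := by
    intro j
    rw [sderiv_newton he, sderiv_mul j, sderiv_coord, sderiv_regDist_rpow he]
    · norm_num; ring
    · have : DifferentiableAt ℝ (fun z : SpT => (EuclideanSpace.proj j : E3 →L[ℝ] ℝ) (x - z.1)) z := by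
        fun_prop
      exact this
    · exact (contDiff_regDist_rpow he x _).differentiable (by simp) z
  simp only [sLap, h1]
  have hn : ‖x - z.1‖ ^ 2 = ∑ j, ((x - z.1) j) ^ 2 := by
    rw [EuclideanSpace.norm_sq_eq]; simp
  have h3 : regDist e x z ^ (-3 / 2 : ℝ) = regDist e x z ^ (-5 / 2 : ℝ) * regDist e x z := by
    rw [← Real.rpow_add_one hr.ne']; norm_num
  rw [Finset.sum_add_distrib, ← Finset.sum_mul, ← Finset.mul_sum, ← hn, h3]
  simp only [Finset.sum_const, Finset.card_univ, Fintype.card_fin, nsmul_eq_mul]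
  unfold regDist
  push_cast
  ring

theorem rpow_neg_half_mul_le {r ρ : ℝ} (hr : 0 < r) (hρ : 0 ≤ ρ) (h : ρ ^ 2 ≤ r) :
    r ^ (-1 / 2 : ℝ) * ρ ≤ 1 ∧ r ^ (-3 / 2 : ℝ) * ρ ^ 3 ≤ 1 := by
  have hs : 0 < Real.sqrt r := Real.sqrt_pos.2 hr
  have hle : ρ ≤ Real.sqrt r := Real.le_sqrt_of_sq_le h
  have e1 : r ^ (-1 / 2 : ℝ) = (Real.sqrt r)⁻¹ := by
    rw [Real.sqrt_eq_rpow, ← Real.rpow_neg hr.le]; norm_num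
  have e2 : r ^ (-3 / 2 : ℝ) = ((Real.sqrt r) ^ 3)⁻¹ := by
    rw [Real.sqrt_eq_rpow, ← Real.rpow_natCast, ← Real.rpow_mul hr.le, ← Real.rpow_neg hr.le]
    norm_num
  rw [e1, e2, inv_mul_le_iff₀ hs, inv_mul_le_iff₀ (by positivity), mul_one, mul_one]
  exact ⟨hle, pow_le_pow_left₀ hρ hle 3⟩

theorem sderiv_mul_fun {f g : SpT → ℝ} (j : Fin 3) (hf : ContDiff ℝ (⊤ : ℕ∞) f)
    (hg : ContDiff ℝ (⊤ : ℕ∞) g) :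
    sderiv j (fun w => f w * g w) = fun z => sderiv j f z * g z + f z * sderiv j g z :=
  funext fun z => sderiv_mul j (hf.differentiable (by simp) z) (hg.differentiable (by simp) z)

theorem sderiv_add_fun {f g : SpT → ℝ} (j : Fin 3) (hf : ContDiff ℝ (⊤ : ℕ∞) f)
    (hg : ContDiff ℝ (⊤ : ℕ∞) g) :
    sderiv j (fun w => f w + g w) = fun z => sderiv j f z + sderiv j g z := by
  funext z
  simp only [sderiv]
  rw [fderiv_fun_add (hf.differentiable (by simp) z) (hg.differentiable (by simp) z)]
  simp

theorem sderiv_localized {a : ℝ → ℝ} {f g : SpT → ℝ} (ha : ContDiff ℝ (⊤ : ℕ∞) a)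
    (hf : ContDiff ℝ (⊤ : ℕ∞) f) (hg : ContDiff ℝ (⊤ : ℕ∞) g) (j : Fin 3) :
    sderiv j (fun z => a z.2 * (f z * g z)) =
      fun z => a z.2 * (sderiv j f z * g z + f z * sderiv j g z) := by
  rw [sderiv_mul_fun j (f := fun z => a z.2) (g := fun z => f z * g z)
    (ha.comp contDiff_snd) (hf.mul hg), sderiv_mul_fun j hf hg]
  funext z
  rw [sderiv_comp_snd (ha.differentiable (by simp))]
  simp

theorem sLap_localized {a : ℝ → ℝ} {f g : SpT → ℝ} (ha : ContDiff ℝ (⊤ : ℕ∞) a)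
    (hf : ContDiff ℝ (⊤ : ℕ∞) f) (hg : ContDiff ℝ (⊤ : ℕ∞) g) (z : SpT) :
    sLap (fun z => a z.2 * (f z * g z)) z =
      a z.2 * (∑ j, (sderiv j (sderiv j f) z * g z + 2 * (sderiv j f z * sderiv j g z))
        + f z * sLap g z) := by
  simp only [sLap]
  rw [Finset.mul_sum, ← Finset.sum_add_distrib, Finset.mul_sum]
  refine Finset.sum_congr rfl fun j _ => ?_
  have hfj := contDiff_sderiv hf j
  have hgj := contDiff_sderiv hg j
  rw [sderiv_localized ha hf hg, sderiv_mul_fun j (f := fun z => a z.2)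
    (g := fun z => sderiv j f z * g z + f z * sderiv j g z) (ha.comp contDiff_snd)
    ((hfj.mul hg).add (hf.mul hgj)), sderiv_add_fun j (f := fun z => sderiv j f z * g z)
    (g := fun z => f z * sderiv j g z) (hfj.mul hg) (hf.mul hgj), sderiv_mul_fun j hfj hg,
    sderiv_mul_fun j hf hgj]
  beta_reduce
  rw [sderiv_comp_snd (ha.differentiable (by simp))]
  ring

/-- A smooth cutoff on `ℝ³` equal to one on `B_{3/4}` and supported in the closed `B_{7/8}`. -/
def cutoff : ContDiffBump (0 : E3) where
  rIn := 3 / 4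
  rOut := 7 / 8
  rIn_pos := by norm_num
  rIn_lt_rOut := by norm_num

/-- The cutoff viewed as a function on space-time. -/
def stCutoff (z : SpT) : ℝ := cutoff z.1

theorem contDiff_stCutoff : ContDiff ℝ (⊤ : ℕ∞) stCutoff :=
  (cutoff.contDiff (n := (⊤ : ℕ∞))).comp contDiff_fst

theorem stCutoff_eq_one {z : SpT} (hz : ‖z.1‖ < 3 / 4) : stCutoff z = 1 :=
  cutoff.one_of_mem_closedBall (by simpa [cutoff] using hz.le)

theorem stCutoff_eq_zero {z : SpT} (hz : 7 / 8 ≤ ‖z.1‖) : stCutoff z = 0 :=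
  cutoff.zero_of_le_dist (by simpa [cutoff] using hz)

theorem stCutoff_mem (z : SpT) : 0 ≤ stCutoff z ∧ stCutoff z ≤ 1 :=
  ⟨cutoff.nonneg, cutoff.le_one⟩

theorem sderiv_eq_zero_of_eventually_const {f : SpT → ℝ} {c : ℝ} {z : SpT} (j : Fin 3)
    (h : f =ᶠ[𝓝 z] fun _ => c) : sderiv j f z = 0 := by
  simp only [sderiv]
  rw [h.fderiv_eq]
  simp

theorem sderiv_stCutoff_eq_zero {z : SpT} (hz : ‖z.1‖ < 3 / 4) (j : Fin 3) :
    sderiv j stCutoff z = 0 := by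
  refine sderiv_eq_zero_of_eventually_const (c := 1) j ?_
  have : {w : SpT | ‖w.1‖ < 3 / 4} ∈ 𝓝 z :=
    (isOpen_lt (by fun_prop) continuous_const).mem_nhds hz
  filter_upwards [this] with w hw using stCutoff_eq_one hw

theorem sderiv_sderiv_stCutoff_eq_zero {z : SpT} (hz : ‖z.1‖ < 3 / 4) (i j : Fin 3) :
    sderiv i (sderiv j stCutoff) z = 0 := by
  refine sderiv_eq_zero_of_eventually_const (c := 0) i ?_
  have : {w : SpT | ‖w.1‖ < 3 / 4} ∈ 𝓝 z :=
    (isOpen_lt (by fun_prop) continuous_const).mem_nhds hz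
  filter_upwards [this] with w hw using sderiv_stCutoff_eq_zero hw j

theorem sderiv_stCutoff_eq_zero' {z : SpT} (hz : 7 / 8 < ‖z.1‖) (j : Fin 3) :
    sderiv j stCutoff z = 0 := by
  refine sderiv_eq_zero_of_eventually_const (c := 0) j ?_
  have : {w : SpT | 7 / 8 < ‖w.1‖} ∈ 𝓝 z :=
    (isOpen_lt continuous_const (by fun_prop)).mem_nhds hz
  filter_upwards [this] with w hw using stCutoff_eq_zero (le_of_lt hw)

theorem exists_bound_sderiv_comp_fst {f : E3 → ℝ} (hf : ContDiff ℝ (⊤ : ℕ∞) f)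
    (hc : HasCompactSupport f) (j : Fin 3) :
    ContDiff ℝ (⊤ : ℕ∞) (fun y => fderiv ℝ f y (EuclideanSpace.single j 1)) ∧
    HasCompactSupport (fun y => fderiv ℝ f y (EuclideanSpace.single j 1)) ∧
    (∃ C, ∀ z, |sderiv j (fun w => f w.1) z| ≤ C) := by
  have h1 : ContDiff ℝ (⊤ : ℕ∞) (fun y => fderiv ℝ f y (EuclideanSpace.single j 1)) :=
    (hf.fderiv_right (m := (⊤ : ℕ∞)) (by simp)).clm_apply contDiff_const
  have h2 : HasCompactSupport (fun y => fderiv ℝ f y (EuclideanSpace.single j 1)) :=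
    hc.fderiv_apply ℝ _
  refine ⟨h1, h2, ?_⟩
  obtain ⟨C, hC⟩ := h1.continuous.bounded_above_of_compact_support h2
  refine ⟨C, fun z => ?_⟩
  rw [sderiv_comp_fst (hf.differentiable (by simp))]
  exact hC _

theorem exists_bound_stCutoff : ∃ K : ℝ, 0 < K ∧ (∀ j z, |sderiv j stCutoff z| ≤ K) ∧
    ∀ j z, |sderiv j (sderiv j stCutoff) z| ≤ K := by
  have hc : ContDiff ℝ (⊤ : ℕ∞) (cutoff : E3 → ℝ) := cutoff.contDiff
  have hs : HasCompactSupport (cutoff : E3 → ℝ) := cutoff.hasCompactSupport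
  have h1 := fun j => (exists_bound_sderiv_comp_fst hc hs j).2.2
  choose C hC using h1
  have h2 := fun j => (exists_bound_sderiv_comp_fst (exists_bound_sderiv_comp_fst hc hs j).1
    (exists_bound_sderiv_comp_fst hc hs j).2.1 j).2.2
  choose C' hC' using h2
  refine ⟨1 + ∑ j, |C j| + ∑ j, |C' j|, by positivity, fun j z => ?_, fun j z => ?_⟩
  · have := Finset.single_le_sum (f := fun j => |C j|) (fun _ _ => abs_nonneg _)
      (Finset.mem_univ j)
    have h3 : 0 ≤ ∑ j, |C' j| := by positivity
    have h4 := hC j z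
    have h5 : |sderiv j stCutoff z| ≤ C j := h4
    linarith [le_abs_self (C j)]
  · have := Finset.single_le_sum (f := fun j => |C' j|) (fun _ _ => abs_nonneg _)
      (Finset.mem_univ j)
    have h3 : 0 ≤ ∑ j, |C j| := by positivity
    have h4 := hC' j z
    have h6 : sderiv j stCutoff = fun w : SpT => fderiv ℝ cutoff w.1 (EuclideanSpace.single j 1) :=
      funext fun w => sderiv_comp_fst (hc.differentiable (by simp)) j w
    rw [h6]
    linarith [le_abs_self (C' j)]

/-- The localised regularised Newton potential, used as a test function. -/
def newtonTest (e : ℝ) (x : E3) (a : ℝ → ℝ) (z : SpT) : ℝ :=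
  a z.2 * (stCutoff z * regDist e x z ^ (-1 / 2 : ℝ))

theorem isTestOn_newtonTest {e : ℝ} (he : 0 < e) (x : E3) {a : ℝ → ℝ} {J : Set ℝ}
    (ha : ContDiff ℝ (⊤ : ℕ∞) a) (hc : HasCompactSupport a) (hJ : tsupport a ⊆ J) :
    IsTestOn (Metric.ball 0 1 ×ˢ J) (newtonTest e x a) := by
  have hsub : Function.support (newtonTest e x a) ⊆ Metric.closedBall 0 (7 / 8) ×ˢ tsupport a := by
    intro z hz
    refine ⟨?_, ?_⟩
    · rw [mem_closedBall_zero_iff]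
      by_contra h
      exact hz (by simp [newtonTest, stCutoff_eq_zero (le_of_lt (not_le.1 h))])
    · by_contra h
      exact hz (by simp [newtonTest, image_eq_zero_of_notMem_tsupport h])
  have hcl : IsCompact (Metric.closedBall (0 : E3) (7 / 8) ×ˢ tsupport a) :=
    (isCompact_closedBall _ _).prod hc.isCompact
  refine ⟨(ha.comp contDiff_snd).mul (contDiff_stCutoff.mul (contDiff_regDist_rpow he x _)),
    HasCompactSupport.of_support_subset_isCompact hcl hsub,
    (closure_minimal hsub hcl.isClosed).trans ?_⟩
  exact prod_mono (Metric.closedBall_subset_ball (by norm_num)) hJ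

theorem newtonTest_bounds : ∃ K : ℝ, 0 < K ∧ ∀ e : ℝ, 0 < e → ∀ x : E3, ‖x‖ < 1 / 2 →
    ∀ a : ℝ → ℝ, ContDiff ℝ (⊤ : ℕ∞) a → ∀ z : SpT,
    |sLap (newtonTest e x a) z + 3 * e * regDist e x z ^ (-5 / 2 : ℝ) * (a z.2 * stCutoff z)| ≤
      K * |a z.2| ∧
    (∑ j, |sderiv j (newtonTest e x a) z|) * ‖x - z.1‖ ^ 2 ≤ K * |a z.2| := by
  obtain ⟨K, hK, hK1, hK2⟩ := exists_bound_stCutoff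
  refine ⟨3 * (4 * K + 2 * (K * 16)) + 3 * (2 * K + 1), by positivity, fun e he x hx a ha z => ?_⟩
  have hr := regDist_pos he x z
  set ρ := ‖x - z.1‖ with hρ
  have hρ0 : 0 ≤ ρ := norm_nonneg _
  have hle : ρ ^ 2 ≤ regDist e x z := by unfold regDist; linarith
  obtain ⟨b1, b2⟩ := rpow_neg_half_mul_le hr hρ0 hle
  set n := regDist e x z ^ (-1 / 2 : ℝ) with hn
  set m := regDist e x z ^ (-3 / 2 : ℝ) with hm
  have hn0 : 0 ≤ n := Real.rpow_nonneg hr.le _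
  have hm0 : 0 ≤ m := Real.rpow_nonneg hr.le _
  have hf := contDiff_stCutoff
  have hg := contDiff_regDist_rpow he x (-1 / 2 : ℝ)
  have hco : ∀ j, |(x - z.1) j| ≤ ρ := fun j => PiLp.norm_apply_le (x - z.1) j
  have hnj : ∀ j, |sderiv j (fun z => regDist e x z ^ (-1 / 2 : ℝ)) z| ≤ ρ * m := by
    intro j
    rw [sderiv_newton he, abs_mul, abs_of_nonneg hm0]
    exact mul_le_mul_of_nonneg_right (hco j) hm0
  constructor
  · have e1 : sLap (newtonTest e x a) z = _ := sLap_localized ha hf hg z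
    rw [e1, sLap_newton he]
    have e2 : ∀ S : ℝ, a z.2 * (S + stCutoff z * -(3 * e * regDist e x z ^ (-5 / 2 : ℝ))) +
        3 * e * regDist e x z ^ (-5 / 2 : ℝ) * (a z.2 * stCutoff z) = a z.2 * S := by
      intro S; ring
    rw [e2, abs_mul, mul_comm]
    refine mul_le_mul_of_nonneg_right ?_ (abs_nonneg _)
    have h3 : ∀ j, |sderiv j (sderiv j stCutoff) z * n + 2 * (sderiv j stCutoff z *
        sderiv j (fun z => regDist e x z ^ (-1 / 2 : ℝ)) z)| ≤ 4 * K + 2 * (K * 16) := by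
      intro j
      rcases lt_or_ge ‖z.1‖ (3 / 4) with hz | hz
      · rw [sderiv_stCutoff_eq_zero hz, sderiv_sderiv_stCutoff_eq_zero hz]
        simp; positivity
      · have hρ1 : 1 / 4 ≤ ρ := by
          have := norm_sub_norm_le z.1 x
          rw [norm_sub_rev] at this
          linarith
        have hn4 : n ≤ 4 := by nlinarith
        have hm16 : ρ * m ≤ 16 := by
          have h0 : 0 ≤ ρ * m := by positivity
          have : (ρ * m) * ρ ^ 2 ≤ 1 := by linarith [b2]
          nlinarith [sq_nonneg (ρ - 1 / 4)]
        refine (abs_add_le _ _).trans ?_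
        rw [abs_mul, abs_mul, abs_mul, abs_of_nonneg hn0, abs_two]
        have t1 := mul_le_mul (hK2 j z) hn4 hn0 hK.le
        have t2 := mul_le_mul (hK1 j z) ((hnj j).trans hm16) (abs_nonneg _) hK.le
        linarith
    refine (Finset.abs_sum_le_sum_abs _ _).trans ((Finset.sum_le_sum fun j _ => h3 j).trans ?_)
    simp
    nlinarith
  · have h3 : ∀ j, |sderiv j (newtonTest e x a) z| * ρ ^ 2 ≤ (2 * K + 1) * |a z.2| := by
      intro j
      have e1 : sderiv j (newtonTest e x a) = _ := sderiv_localized ha hf hg j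
      rw [e1]
      simp only
      rcases lt_or_ge (7 / 8) ‖z.1‖ with hz | hz
      · rw [sderiv_stCutoff_eq_zero' hz, stCutoff_eq_zero hz.le]
        simp; positivity
      · have hρ2 : ρ ≤ 2 := by
          have := norm_sub_le x z.1
          linarith
        rw [abs_mul, mul_assoc, mul_comm]
        refine mul_le_mul_of_nonneg_right ?_ (abs_nonneg _)
        have t0 := abs_add_le (sderiv j stCutoff z * n)
          (stCutoff z * sderiv j (fun z => regDist e x z ^ (-1 / 2 : ℝ)) z)
        rw [abs_mul, abs_mul, abs_of_nonneg hn0, abs_of_nonneg (stCutoff_mem z).1] at t0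
        have t1 : |sderiv j stCutoff z| * n * ρ ^ 2 ≤ 2 * K := by
          have : |sderiv j stCutoff z| * n * ρ ^ 2 = |sderiv j stCutoff z| * ((n * ρ) * ρ) := by ring
          rw [this]
          have h5 : n * ρ * ρ ≤ 2 := by nlinarith [mul_nonneg hn0 hρ0]
          have := mul_le_mul (hK1 j z) h5 (by positivity) hK.le
          linarith
        have t2 : stCutoff z * |sderiv j (fun z => regDist e x z ^ (-1 / 2 : ℝ)) z| * ρ ^ 2
            ≤ 1 := by
          have h6 := mul_le_mul (stCutoff_mem z).2 (hnj j) (abs_nonneg _) zero_le_one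
          have := mul_le_mul_of_nonneg_right h6 (sq_nonneg ρ)
          linarith
        have := mul_le_mul_of_nonneg_right t0 (sq_nonneg ρ)
        rw [add_mul] at this
        exact this.trans (add_le_add t1 t2)
    rw [Finset.sum_mul]
    refine (Finset.sum_le_sum fun j _ => h3 j).trans ?_
    simp
    have := abs_nonneg (a z.2)
    have : 0 ≤ K * |a z.2| := by positivity
    linarith

theorem ae_fst_ne (x : E3) : ∀ᵐ z : SpT, z.1 ≠ x := by
  have h : (volume : Measure SpT) ({x} ×ˢ univ) = 0 := by
    rw [Measure.volume_eq_prod, Measure.prod_prod]; simp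
  refine measure_mono_null (fun z hz => ?_) h
  simpa using hz

theorem exists_regularized_pressure_bound : ∃ K : ℝ, 0 < K ∧ ∀ (J : Set ℝ) (p w : SpT → ℝ),
    IntegrableOn p (Metric.ball 0 1 ×ˢ J) → (∀ z, 0 ≤ w z) → Measurable w →
    (∀ ψ, IsTestOn (Metric.ball 0 1 ×ˢ J) ψ → ‖∫ z in Metric.ball 0 1 ×ˢ J, p z * sLap ψ z‖ₑ ≤
      ∫⁻ z in Metric.ball 0 1 ×ˢ J, ENNReal.ofReal (w z * ∑ j, |sderiv j ψ z|)) →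
    ∀ e : ℝ, 0 < e → ∀ x : E3, ‖x‖ < 1 / 2 → ∀ a : ℝ → ℝ, ContDiff ℝ (⊤ : ℕ∞) a →
    HasCompactSupport a → tsupport a ⊆ J →
    ‖∫ z in Metric.ball 0 1 ×ˢ J,
        p z * (3 * e * regDist e x z ^ (-5 / 2 : ℝ) * (a z.2 * stCutoff z))‖ₑ ≤
      ∫⁻ z in Metric.ball 0 1 ×ˢ J, ‖a z.2‖ₑ * (ENNReal.ofReal K *
        (‖p z‖ₑ + ENNReal.ofReal (w z) * ENNReal.ofReal (‖x - z.1‖ ^ (-2 : ℤ)))) := by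
  obtain ⟨K, hK, hb⟩ := newtonTest_bounds
  refine ⟨K, hK, fun J p w hp hw0 hw star e he x hx a ha hc hJ => ?_⟩
  set Q : Set SpT := Metric.ball 0 1 ×ˢ J with hQ
  set ψ := newtonTest e x a with hψ
  have htest : IsTestOn Q ψ := isTestOn_newtonTest he x ha hc hJ
  obtain ⟨Ca, hCa⟩ := ha.continuous.bounded_above_of_compact_support hc
  set k : SpT → ℝ := fun z => 3 * e * regDist e x z ^ (-5 / 2 : ℝ) * (a z.2 * stCutoff z) with hk
  have hkc : Continuous k := by
    have h1 := (contDiff_regDist_rpow he x (-5 / 2)).continuous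
    have h2 := contDiff_stCutoff.continuous
    have h3 := ha.continuous
    simp only [hk]
    fun_prop
  have hLc : Continuous (sLap ψ) := by
    have : ∀ j, Continuous (sderiv j (sderiv j ψ)) := fun j => ((htest.sderiv j).sderiv j).1.continuous
    unfold sLap; fun_prop
  have hm : ∀ z, ‖sLap ψ z + k z‖ ≤ K * Ca := fun z =>
    (hb e he x hx a ha z).1.trans (mul_le_mul_of_nonneg_left (hCa _) hK.le)
  have hLb : ∃ C, ∀ z, ‖sLap ψ z‖ ≤ C := by
    have : ∀ j, ∃ C, ∀ z, ‖sderiv j (sderiv j ψ) z‖ ≤ C :=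
      fun j => ((htest.sderiv j).sderiv j).exists_bound
    choose C hC using this
    exact ⟨∑ j, C j, fun z => (norm_sum_le _ _).trans (Finset.sum_le_sum fun j _ => hC j z)⟩
  obtain ⟨C, hC⟩ := hLb
  have i1 : IntegrableOn (fun z => p z * sLap ψ z) Q :=
    Integrable.mul_bdd hp hLc.aestronglyMeasurable (Eventually.of_forall hC)
  have i2 : IntegrableOn (fun z => p z * (sLap ψ z + k z)) Q :=
    Integrable.mul_bdd hp (hLc.add hkc).aestronglyMeasurable (Eventually.of_forall hm)
  have e1 : ∫ z in Q, p z * k z = (∫ z in Q, p z * (sLap ψ z + k z)) - ∫ z in Q, p z * sLap ψ z := by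
    rw [← integral_sub i2 i1]
    exact integral_congr_ae (Eventually.of_forall fun z => by ring)
  have b1 : ‖∫ z in Q, p z * (sLap ψ z + k z)‖ₑ ≤
      ∫⁻ z in Q, ‖a z.2‖ₑ * (ENNReal.ofReal K * ‖p z‖ₑ) := by
    refine (enorm_integral_le_lintegral_enorm _).trans (lintegral_mono fun z => ?_)
    simp only [enorm_mul]
    have : ‖sLap ψ z + k z‖ₑ ≤ ENNReal.ofReal K * ‖a z.2‖ₑ := by
      rw [Real.enorm_eq_ofReal_abs, Real.enorm_eq_ofReal_abs, ← ENNReal.ofReal_mul hK.le]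
      exact ENNReal.ofReal_le_ofReal (hb e he x hx a ha z).1
    calc ‖p z‖ₑ * ‖sLap ψ z + k z‖ₑ ≤ ‖p z‖ₑ * (ENNReal.ofReal K * ‖a z.2‖ₑ) := by gcongr
      _ = _ := by ring
  have b2 : ∫⁻ z in Q, ENNReal.ofReal (w z * ∑ j, |sderiv j ψ z|) ≤
      ∫⁻ z in Q, ‖a z.2‖ₑ * (ENNReal.ofReal K *
        (ENNReal.ofReal (w z) * ENNReal.ofReal (‖x - z.1‖ ^ (-2 : ℤ)))) := by
    refine lintegral_mono_ae (ae_restrict_of_ae ?_)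
    filter_upwards [ae_fst_ne x] with z hz
    have hpos : 0 < ‖x - z.1‖ := norm_pos_iff.2 (sub_ne_zero.2 hz.symm)
    have h2 := (hb e he x hx a ha z).2
    rw [Real.enorm_eq_ofReal_abs, ← ENNReal.ofReal_mul (hw0 z), ← ENNReal.ofReal_mul hK.le,
      ← ENNReal.ofReal_mul (abs_nonneg _)]
    refine ENNReal.ofReal_le_ofReal ?_
    have h3 : ∑ j, |sderiv j ψ z| ≤ K * |a z.2| * ‖x - z.1‖ ^ (-2 : ℤ) := by
      rw [zpow_neg, ← div_eq_mul_inv, le_div_iff₀ (by positivity)]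
      exact_mod_cast h2
    calc w z * ∑ j, |sderiv j ψ z| ≤ w z * (K * |a z.2| * ‖x - z.1‖ ^ (-2 : ℤ)) :=
          mul_le_mul_of_nonneg_left h3 (hw0 z)
      _ = _ := by ring
  rw [e1]
  refine (enorm_sub_le.trans (add_le_add b1 ((star ψ htest).trans b2))).trans ?_
  rw [← lintegral_add_right]
  · refine lintegral_mono fun z => le_of_eq ?_
    ring
  · have h1 : Measurable fun z : SpT => ‖a z.2‖ₑ :=
      (ha.continuous.measurable.comp measurable_snd).enorm
    have h2 : Measurable fun z : SpT => ‖x - z.1‖ ^ (-2 : ℤ) := by fun_prop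
    exact h1.mul ((hw.ennreal_ofReal.mul h2.ennreal_ofReal).const_mul _)

/-- The profile of the approximate identity generated by the regularised Newton kernel. -/
def newtonProfile (v : E3) : ℝ := 3 * (1 + ‖v‖ ^ 2) ^ (-5 / 2 : ℝ)

theorem newtonProfile_pos (v : E3) : 0 < newtonProfile v := by
  unfold newtonProfile; positivity

theorem continuous_newtonProfile : Continuous newtonProfile := by
  unfold newtonProfile
  refine continuous_const.mul (Continuous.rpow_const (by fun_prop) fun v => Or.inl ?_)
  positivity

theorem newtonProfile_le (v : E3) : newtonProfile v ≤ 3 := by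
  have h : (1 + ‖v‖ ^ 2) ^ (-5 / 2 : ℝ) ≤ 1 :=
    Real.rpow_le_one_of_one_le_of_nonpos (by nlinarith [sq_nonneg ‖v‖]) (by norm_num)
  unfold newtonProfile; linarith

theorem integrable_newtonProfile : Integrable newtonProfile := by
  have h := integrable_rpow_neg_one_add_norm_sq (E := E3) (μ := volume) (r := 5) (by simp; norm_num)
  exact h.const_mul 3

theorem integral_newtonProfile_pos : 0 < ∫ v, newtonProfile v := by
  rw [integral_pos_iff_support_of_nonneg (fun v => (newtonProfile_pos v).le)
    integrable_newtonProfile]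
  have : Function.support newtonProfile = univ :=
    eq_univ_of_forall fun v => (newtonProfile_pos v).ne'
  rw [this]
  simp

theorem tendsto_newtonProfile :
    Tendsto (fun v : E3 => ‖v‖ ^ (Module.finrank ℝ E3) * newtonProfile v)
      (Bornology.cobounded E3) (𝓝 0) := by
  have h1 : Tendsto (fun v : E3 => 3 * ‖v‖⁻¹) (Bornology.cobounded E3) (𝓝 0) := by
    have := (tendsto_inv_atTop_zero.comp (tendsto_norm_cobounded_atTop (E := E3))).const_mul (3 : ℝ)
    simpa using this
  refine squeeze_zero' (Eventually.of_forall fun v => ?_) ?_ h1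
  · have := (newtonProfile_pos v).le
    positivity
  · filter_upwards [(tendsto_norm_cobounded_atTop (E := E3)).eventually_ge_atTop 1] with v hv
    have h2 : (1 + ‖v‖ ^ 2) ^ (-5 / 2 : ℝ) ≤ (‖v‖ ^ 2) ^ (-2 : ℝ) := by
      calc (1 + ‖v‖ ^ 2) ^ (-5 / 2 : ℝ) ≤ (1 + ‖v‖ ^ 2) ^ (-2 : ℝ) :=
            Real.rpow_le_rpow_of_exponent_le (by nlinarith) (by norm_num)
        _ ≤ _ := Real.rpow_le_rpow_of_nonpos (by positivity) (by linarith) (by norm_num)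
    have h3 : (‖v‖ ^ 2) ^ (-2 : ℝ) = (‖v‖ ^ 4)⁻¹ := by
      rw [Real.rpow_neg (by positivity)]
      norm_cast
      rw [← pow_mul]
    rw [h3] at h2
    unfold newtonProfile
    rw [finrank_euclideanSpace, Fintype.card_fin]
    calc ‖v‖ ^ 3 * (3 * (1 + ‖v‖ ^ 2) ^ (-5 / 2 : ℝ)) ≤ ‖v‖ ^ 3 * (3 * (‖v‖ ^ 4)⁻¹) := by gcongr
      _ = 3 * ‖v‖⁻¹ := by field_simp

theorem regDist_eq_newtonProfile {c : ℝ} (hc : 0 < c) (x : E3) (z : SpT) :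
    3 * (c ^ 2)⁻¹ * regDist (c ^ 2)⁻¹ x z ^ (-5 / 2 : ℝ) =
      c ^ 3 * newtonProfile (c • (z.1 - x)) := by
  have h1 : regDist (c ^ 2)⁻¹ x z = (c ^ 2)⁻¹ * (1 + ‖c • (z.1 - x)‖ ^ 2) := by
    unfold regDist
    rw [norm_smul, Real.norm_of_nonneg hc.le, norm_sub_rev]
    field_simp
    ring
  have h2 : ((c ^ 2)⁻¹ : ℝ) ^ (-5 / 2 : ℝ) = c ^ 5 := by
    rw [Real.inv_rpow (by positivity), ← Real.rpow_neg (by positivity), ← Real.rpow_natCast,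
      ← Real.rpow_mul hc.le, ← Real.rpow_natCast]
    norm_num
  rw [h1, Real.mul_rpow (by positivity) (by positivity), h2]
  unfold newtonProfile
  field_simp

theorem tendsto_integral_newtonProfile {f : E3 → ℝ} (hf : Continuous f) (hi : Integrable f)
    (x₀ : E3) : Tendsto (fun c : ℝ => ∫ x, c ^ 3 * newtonProfile (c • (x₀ - x)) * f x) atTop
      (𝓝 ((∫ v, newtonProfile v) * f x₀)) := by
  set κ := ∫ v, newtonProfile v with hκ
  have hκ0 := integral_newtonProfile_pos
  have h := tendsto_integral_comp_smul_smul_of_integrable' (μ := (volume : Measure E3))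
    (φ := fun v => κ⁻¹ * newtonProfile v) (g := f) (x₀ := x₀)
    (fun v => mul_nonneg (inv_nonneg.2 hκ0.le) (newtonProfile_pos v).le)
    (by rw [integral_const_mul]; exact inv_mul_cancel₀ hκ0.ne')
    (by
      have := tendsto_newtonProfile.const_mul κ⁻¹
      rw [mul_zero] at this
      refine this.congr fun v => by ring) hi hf.continuousAt
  refine (h.const_mul κ).congr fun c => ?_
  rw [← integral_const_mul, finrank_euclideanSpace, Fintype.card_fin]
  refine integral_congr_ae (Eventually.of_forall fun x => ?_)
  simp only [smul_eq_mul]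
  have : κ * κ⁻¹ = 1 := mul_inv_cancel₀ hκ0.ne'
  linear_combination (c ^ 3 * newtonProfile (c • (x₀ - x)) * f x) * this

theorem integrable_scaled_newtonProfile {c : ℝ} (hc : 0 < c) (x₀ : E3) :
    Integrable (fun x => c ^ 3 * newtonProfile (c • (x₀ - x))) :=
  ((integrable_newtonProfile.comp_smul hc.ne').comp_sub_left x₀).const_mul _

theorem integral_scaled_newtonProfile {c : ℝ} (hc : 0 < c) (x₀ : E3) :
    ∫ x, c ^ 3 * newtonProfile (c • (x₀ - x)) = ∫ v, newtonProfile v := by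
  rw [integral_const_mul, integral_sub_left_eq_self (fun x => newtonProfile (c • x)) volume x₀,
    Measure.integral_comp_smul, finrank_euclideanSpace, Fintype.card_fin, smul_eq_mul,
    abs_of_pos (by positivity), ← mul_assoc, mul_inv_cancel₀ (by positivity), one_mul]

theorem norm_integral_newtonProfile_le {c : ℝ} (hc : 0 < c) {f : E3 → ℝ} {C : ℝ}
    (hf : ∀ x, ‖f x‖ ≤ C) (x₀ : E3) :
    ‖∫ x, c ^ 3 * newtonProfile (c • (x₀ - x)) * f x‖ ≤ (∫ v, newtonProfile v) * C := by
  rw [← integral_scaled_newtonProfile hc x₀, ← integral_mul_const]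
  refine norm_integral_le_of_norm_le ((integrable_scaled_newtonProfile hc x₀).mul_const C)
    (Eventually.of_forall fun x => ?_)
  have h0 : 0 ≤ c ^ 3 * newtonProfile (c • (x₀ - x)) :=
    mul_nonneg (by positivity) (newtonProfile_pos _).le
  rw [norm_mul, Real.norm_of_nonneg h0]
  exact mul_le_mul_of_nonneg_left (hf x) h0

theorem IsTestOn.slice {P : Set E3} {J : Set ℝ} {g : SpT → ℝ} (h : IsTestOn (P ×ˢ J) g) (x : E3) :
    ContDiff ℝ (⊤ : ℕ∞) (fun s => g (x, s)) ∧ HasCompactSupport (fun s => g (x, s)) ∧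
      tsupport (fun s => g (x, s)) ⊆ J := by
  have hsub : tsupport (fun s => g (x, s)) ⊆ (fun s => (x, s)) ⁻¹' tsupport g :=
    closure_minimal (fun s hs => subset_closure hs)
      ((isClosed_tsupport g).preimage (by fun_prop))
  refine ⟨h.1.comp (contDiff_const.prodMk contDiff_id), ?_, fun s hs => (h.2.2 (hsub hs)).2⟩
  exact (h.2.1.isCompact.image continuous_snd).of_isClosed_subset (isClosed_tsupport _)
    fun s hs => ⟨_, hsub hs, rfl⟩

/-- The pointwise majorant of the pressure: an average of `|p|` plus a Riesz potential of `w`. -/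
def newtonMajorant (p w : SpT → ℝ) (z : SpT) : ℝ≥0∞ :=
  ∫⁻ y in Metric.ball (0 : E3) 1, (‖p (y, z.2)‖ₑ +
    ENNReal.ofReal (w (y, z.2)) * ENNReal.ofReal (‖z.1 - y‖ ^ (-2 : ℤ)))

theorem measurable_newtonMajorant_integrand {p w : SpT → ℝ} (hp : Measurable p)
    (hw : Measurable w) : Measurable fun q : SpT × E3 => ‖p (q.2, q.1.2)‖ₑ +
      ENNReal.ofReal (w (q.2, q.1.2)) * ENNReal.ofReal (‖q.1.1 - q.2‖ ^ (-2 : ℤ)) := by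
  have h0 : Measurable fun q : SpT × E3 => ((q.2, q.1.2) : SpT) := by fun_prop
  have h1 := (hp.comp h0).enorm
  have h2 := (hw.comp h0).ennreal_ofReal
  have h3 : Measurable fun q : SpT × E3 => ‖q.1.1 - q.2‖ ^ (-2 : ℤ) := by fun_prop
  exact h1.add (h2.mul h3.ennreal_ofReal)

theorem measurable_newtonMajorant {p w : SpT → ℝ} (hp : Measurable p) (hw : Measurable w) :
    Measurable (newtonMajorant p w) :=
  (measurable_newtonMajorant_integrand hp hw).lintegral_prod_right'

theorem lintegral_newtonMajorant {J : Set ℝ} {p w g : SpT → ℝ}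
    (hp : Measurable p) (hw : Measurable w) (hg : Measurable g) {P : Set SpT}
    (hP : MeasurableSet P) (hPJ : P ⊆ univ ×ˢ J) (hg0 : ∀ z ∉ P, g z = 0) (K : ℝ) :
    ∫⁻ x, ∫⁻ z in Metric.ball 0 1 ×ˢ J, ‖g (x, z.2)‖ₑ * (ENNReal.ofReal K *
        (‖p z‖ₑ + ENNReal.ofReal (w z) * ENNReal.ofReal (‖x - z.1‖ ^ (-2 : ℤ)))) =
      ∫⁻ z in P, ‖g z‖ₑ * (ENNReal.ofReal K * newtonMajorant p w z) := by
  have h1 : ∀ x : E3, ∫⁻ z in Metric.ball 0 1 ×ˢ J, ‖g (x, z.2)‖ₑ * (ENNReal.ofReal K *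
        (‖p z‖ₑ + ENNReal.ofReal (w z) * ENNReal.ofReal (‖x - z.1‖ ^ (-2 : ℤ)))) =
      ∫⁻ s in J, ‖g (x, s)‖ₑ * (ENNReal.ofReal K * newtonMajorant p w (x, s)) := by
    intro x
    have hgx : Measurable fun z : SpT => ‖g (x, z.2)‖ₑ :=
      (hg.comp (by fun_prop : Measurable fun z : SpT => ((x, z.2) : SpT))).enorm
    have h3 : Measurable fun z : SpT => ‖x - z.1‖ ^ (-2 : ℤ) := by fun_prop
    rw [Measure.volume_eq_prod, ← Measure.prod_restrict, lintegral_prod_symm]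
    · refine lintegral_congr fun s => ?_
      simp only
      have h4 : Measurable fun y : E3 => ‖p (y, s)‖ₑ +
          ENNReal.ofReal (w (y, s)) * ENNReal.ofReal (‖x - y‖ ^ (-2 : ℤ)) :=
        (measurable_newtonMajorant_integrand hp hw).comp
          (by fun_prop : Measurable fun y : E3 => (((x, s), y) : SpT × E3))
      rw [lintegral_const_mul _ (h4.const_mul _), lintegral_const_mul _ h4]
      rfl
    · exact (hgx.mul ((hp.enorm.add
        (hw.ennreal_ofReal.mul h3.ennreal_ofReal)).const_mul _)).aemeasurable
  simp_rw [h1]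
  have hm : Measurable fun z => ‖g z‖ₑ * (ENNReal.ofReal K * newtonMajorant p w z) :=
    hg.enorm.mul ((measurable_newtonMajorant hp hw).const_mul _)
  have h2 : ∫⁻ x, ∫⁻ s in J, ‖g (x, s)‖ₑ * (ENNReal.ofReal K * newtonMajorant p w (x, s)) =
      ∫⁻ z in univ ×ˢ J, ‖g z‖ₑ * (ENNReal.ofReal K * newtonMajorant p w z) := by
    rw [Measure.volume_eq_prod, ← Measure.prod_restrict, Measure.restrict_univ,
      lintegral_prod _ hm.aemeasurable]
  rw [h2]
  have h3 : (fun z => ‖g z‖ₑ * (ENNReal.ofReal K * newtonMajorant p w z)) =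
      P.indicator fun z => ‖g z‖ₑ * (ENNReal.ofReal K * newtonMajorant p w z) := by
    funext z
    by_cases hz : z ∈ P
    · rw [indicator_of_mem hz]
    · rw [indicator_of_notMem hz, hg0 z hz]; simp
  rw [h3, setLIntegral_indicator hP, setLIntegral_indicator hP, inter_self,
    inter_eq_self_of_subset_left hPJ]

theorem exists_tested_pressure_bound : ∃ K : ℝ, 0 < K ∧ ∀ (J : Set ℝ) (p w : SpT → ℝ), IsOpen J →
    Measurable p → IntegrableOn p (Metric.ball 0 1 ×ˢ J) → (∀ z, 0 ≤ w z) → Measurable w →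
    (∀ ψ, IsTestOn (Metric.ball 0 1 ×ˢ J) ψ → ‖∫ z in Metric.ball 0 1 ×ˢ J, p z * sLap ψ z‖ₑ ≤
      ∫⁻ z in Metric.ball 0 1 ×ˢ J, ENNReal.ofReal (w z * ∑ j, |sderiv j ψ z|)) →
    ∀ g, IsTestOn (Metric.ball 0 (1 / 2) ×ˢ J) g →
    ‖∫ z in Metric.ball 0 (1 / 2) ×ˢ J, p z * g z‖ₑ ≤
      ∫⁻ z in Metric.ball 0 (1 / 2) ×ˢ J, ‖g z‖ₑ * (ENNReal.ofReal K * newtonMajorant p w z) := by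
  obtain ⟨K, hK, hb⟩ := exists_regularized_pressure_bound
  set κ := ∫ v, newtonProfile v with hκ
  have hκ0 : 0 < κ := integral_newtonProfile_pos
  refine ⟨κ⁻¹ * K, by positivity, fun J p w hJ hpm hp hw0 hw star g hg => ?_⟩
  set Q : Set SpT := Metric.ball 0 1 ×ˢ J with hQ
  set P : Set SpT := Metric.ball 0 (1 / 2) ×ˢ J with hP
  have hQm : MeasurableSet Q := measurableSet_ball.prod hJ.measurableSet
  have hPm : MeasurableSet P := measurableSet_ball.prod hJ.measurableSet
  have hPQ : P ⊆ Q := prod_mono (Metric.ball_subset_ball (by norm_num)) le_rfl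
  obtain ⟨Cg, hCg⟩ := hg.exists_bound
  have hCg0 : 0 ≤ Cg := (norm_nonneg _).trans (hCg 0)
  have hg0 : ∀ x : E3, 1 / 2 ≤ ‖x‖ → ∀ s, g (x, s) = 0 := fun x hx s =>
    hg.eq_zero fun h => by
      have := mem_ball_zero_iff.1 h.1
      simp only at this
      linarith
  set N : ℝ → E3 → SpT → ℝ := fun c x z =>
    p z * (c ^ 3 * newtonProfile (c • (z.1 - x)) * (g (x, z.2) * stCutoff z)) with hN
  set G : ℝ → SpT → ℝ := fun c z => ∫ x, c ^ 3 * newtonProfile (c • (z.1 - x)) * g (x, z.2) with hG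
  have hgs : ∀ z : SpT, Continuous (fun x : E3 => g (x, z.2)) := fun z =>
    hg.1.continuous.comp (by fun_prop)
  have hgc : ∀ z : SpT, Integrable (fun x : E3 => g (x, z.2)) := fun z => by
    refine (hgs z).integrable_of_hasCompactSupport ?_
    refine HasCompactSupport.of_support_subset_isCompact (isCompact_closedBall 0 (1 / 2))
      fun x hx => ?_
    rw [mem_closedBall_zero_iff]
    by_contra h
    exact hx (hg0 x (not_le.1 h).le _)
  have step : ∀ c : ℝ, 0 < c → ‖∫ z in Q, p z * stCutoff z * G c z‖ₑ ≤
      ∫⁻ z in P, ‖g z‖ₑ * (ENNReal.ofReal K * newtonMajorant p w z) := by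
    intro c hc
    have hswap : Integrable (Function.uncurry (N c)) (volume.prod (volume.restrict Q)) := by
      have hd : Integrable (fun q : E3 × SpT =>
          (Metric.ball (0 : E3) (1 / 2)).indicator (fun _ => c ^ 3 * 3 * Cg) q.1 * p q.2)
          (volume.prod (volume.restrict Q)) := by
        refine Integrable.mul_prod ?_ hp
        rw [integrable_indicator_iff measurableSet_ball]
        exact integrableOn_const (by finiteness)
      refine hd.mono ?_ (Eventually.of_forall fun q => ?_)
      · have m1 := continuous_newtonProfile
        have m2 := hg.1.continuous
        have m3 := contDiff_stCutoff.continuous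
        have m4 : Continuous fun q : E3 × SpT =>
          c ^ 3 * newtonProfile (c • (q.2.1 - q.1)) * (g (q.1, q.2.2) * stCutoff q.2) := by fun_prop
        exact ((hpm.comp measurable_snd).mul m4.measurable).aestronglyMeasurable
      · simp only [Function.uncurry, hN]
        rcases lt_or_ge ‖q.1‖ (1 / 2) with h | h
        · rw [indicator_of_mem (mem_ball_zero_iff.2 h), norm_mul, norm_mul _ (p q.2), mul_comm]
          refine mul_le_mul_of_nonneg_right ?_ (norm_nonneg _)
          rw [norm_mul, norm_mul, norm_mul (g _)]
          have a1 : ‖newtonProfile (c • (q.2.1 - q.1))‖ ≤ 3 := by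
            rw [Real.norm_of_nonneg (newtonProfile_pos _).le]; exact newtonProfile_le _
          have a2 : ‖stCutoff q.2‖ ≤ 1 := by
            rw [Real.norm_of_nonneg (stCutoff_mem _).1]; exact (stCutoff_mem _).2
          calc ‖c ^ 3‖ * ‖newtonProfile (c • (q.2.1 - q.1))‖ * (‖g (q.1, q.2.2)‖ * ‖stCutoff q.2‖)
              ≤ ‖c ^ 3‖ * 3 * (Cg * 1) := by
                gcongr
                exact hCg _
            _ = _ := by rw [norm_mul, norm_mul, mul_one, Real.norm_of_nonneg hCg0]; norm_num
        · rw [hg0 _ h, zero_mul, mul_zero, mul_zero, norm_zero]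
          exact norm_nonneg _
    have e1 : ∫ z in Q, p z * stCutoff z * G c z = ∫ x, ∫ z in Q, N c x z := by
      rw [integral_integral_swap hswap]
      refine integral_congr_ae (Eventually.of_forall fun z => ?_)
      simp only [hG, hN]
      rw [← integral_const_mul]
      refine integral_congr_ae (Eventually.of_forall fun x => ?_)
      simp only
      ring
    rw [e1, ← lintegral_newtonMajorant hpm hw hg.1.continuous.measurable hPm
      (prod_mono (subset_univ _) le_rfl) (fun z hz => hg.eq_zero hz)]
    refine (enorm_integral_le_lintegral_enorm _).trans (lintegral_mono fun x => ?_)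
    rcases lt_or_ge ‖x‖ (1 / 2) with h | h
    · obtain ⟨s1, s2, s3⟩ := hg.slice x
      have := hb J p w hp hw0 hw star (c ^ 2)⁻¹ (by positivity) x h _ s1 s2 s3
      refine le_trans (le_of_eq ?_) this
      congr 1
      refine integral_congr_ae (Eventually.of_forall fun z => ?_)
      simp only [hN]
      rw [regDist_eq_newtonProfile hc]
    · have : ∀ z, N c x z = 0 := fun z => by simp only [hN]; rw [hg0 x h]; ring
      simp [this]
  have hlim : Tendsto (fun c : ℝ => ∫ z in Q, p z * stCutoff z * G c z) atTop
      (𝓝 (∫ z in Q, p z * stCutoff z * (κ * g z))) := by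
    refine tendsto_integral_filter_of_dominated_convergence (fun z => ‖p z‖ * (κ * Cg)) ?_ ?_ ?_ ?_
    · refine Eventually.of_forall fun c => ?_
      have m1 := continuous_newtonProfile
      have m2 := hg.1.continuous
      have m4 : Continuous fun q : SpT × E3 =>
        c ^ 3 * newtonProfile (c • (q.1.1 - q.2)) * g (q.2, q.1.2) := by fun_prop
      have m5 : StronglyMeasurable (G c) := m4.stronglyMeasurable.integral_prod_right'
      exact ((hpm.mul contDiff_stCutoff.continuous.measurable).mul
        m5.measurable).aestronglyMeasurable
    · filter_upwards [eventually_gt_atTop 0] with c hc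
      refine Eventually.of_forall fun z => ?_
      rw [norm_mul, norm_mul, Real.norm_of_nonneg (stCutoff_mem z).1]
      have := norm_integral_newtonProfile_le hc (fun x => hCg (x, z.2)) z.1
      have h2 := (stCutoff_mem z).2
      have h3 := (stCutoff_mem z).1
      calc ‖p z‖ * stCutoff z * ‖G c z‖ ≤ ‖p z‖ * 1 * (κ * Cg) := by gcongr
        _ = _ := by ring
    · exact hp.norm.mul_const _
    · exact Eventually.of_forall fun z =>
        (tendsto_integral_newtonProfile (hgs z) (hgc z) z.1).const_mul _
  have h1 : ‖∫ z in Q, p z * stCutoff z * (κ * g z)‖ₑ ≤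
      ∫⁻ z in P, ‖g z‖ₑ * (ENNReal.ofReal K * newtonMajorant p w z) :=
    le_of_tendsto hlim.enorm (by
      filter_upwards [eventually_gt_atTop 0] with c hc using step c hc)
  have h2 : ∫ z in Q, p z * stCutoff z * (κ * g z) = κ * ∫ z in P, p z * g z := by
    rw [← integral_const_mul, setIntegral_eq_of_subset_of_forall_sdiff_eq_zero hQm hPQ]
    · refine setIntegral_congr_fun hPm fun z hz => ?_
      have : stCutoff z = 1 := stCutoff_eq_one (by
        have := mem_ball_zero_iff.1 hz.1
        linarith)
      simp only [this]
      ring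
    · intro z hz
      rw [hg.eq_zero hz.2]; ring
  rw [h2, enorm_mul, Real.enorm_of_nonneg hκ0.le] at h1
  have h3 : ‖∫ z in P, p z * g z‖ₑ = ENNReal.ofReal κ⁻¹ *
      (ENNReal.ofReal κ * ‖∫ z in P, p z * g z‖ₑ) := by
    rw [← mul_assoc, ← ENNReal.ofReal_mul (by positivity), inv_mul_cancel₀ hκ0.ne']
    simp
  rw [h3, ENNReal.ofReal_mul (by positivity)]
  refine (mul_le_mul_right h1 _).trans (le_of_eq ?_)
  have hm : Measurable fun z => ‖g z‖ₑ * (ENNReal.ofReal K * newtonMajorant p w z) :=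
    hg.1.continuous.measurable.enorm.mul ((measurable_newtonMajorant hpm hw).const_mul _)
  rw [← lintegral_const_mul _ hm]
  refine lintegral_congr fun z => ?_
  ring

theorem ae_enorm_le_of_forall_test {P : Set SpT} (hP : IsOpen P) {f : SpT → ℝ} {M : SpT → ℝ≥0∞}
    (hf : IntegrableOn f P) (hM : Measurable M) (hMi : ∫⁻ z in P, M z ≠ ∞)
    (h : ∀ g, IsTestOn P g → ‖∫ z in P, f z * g z‖ₑ ≤ ∫⁻ z in P, ‖g z‖ₑ * M z) :
    ∀ᵐ z ∂volume.restrict P, ‖f z‖ₑ ≤ M z := by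
  have hPm := hP.measurableSet
  have hMfin : ∀ᵐ z ∂volume.restrict P, M z < ∞ := ae_lt_top hM hMi
  have hmi : IntegrableOn (fun z => (M z).toReal) P := integrable_toReal_of_lintegral_ne_top
    hM.aemeasurable hMi
  have hF : LocallyIntegrable (P.indicator f) volume :=
    ((integrable_indicator_iff hPm).2 hf).locallyIntegrable
  have hm : LocallyIntegrable (P.indicator fun z => (M z).toReal) volume :=
    ((integrable_indicator_iff hPm).2 hmi).locallyIntegrable
  let φ : ℕ → ContDiffBump (0 : SpT) := fun i =>
    { rIn := 1 / ((i : ℝ) + 1), rOut := 2 * (1 / ((i : ℝ) + 1)), rIn_pos := by positivity,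
      rIn_lt_rOut := by
        have : 0 < 1 / ((i : ℝ) + 1) := by positivity
        linarith }
  have hφ : Tendsto (fun i => (φ i).rOut) atTop (𝓝 0) := by
    have := (tendsto_one_div_add_atTop_nhds_zero_nat (𝕜 := ℝ)).const_mul 2
    simpa [φ] using this
  have a1 := ContDiffBump.ae_convolution_tendsto_right_of_locallyIntegrable (K := 2) hφ
    (Eventually.of_forall fun i => le_rfl) hF
  have a2 := ContDiffBump.ae_convolution_tendsto_right_of_locallyIntegrable (K := 2) hφ
    (Eventually.of_forall fun i => le_rfl) hm
  rw [ae_restrict_iff' hPm]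
  filter_upwards [a1, a2] with z₀ c1 c2 hz₀
  have hle : ‖P.indicator f z₀‖ ≤ P.indicator (fun z => (M z).toReal) z₀ := by
    refine le_of_tendsto_of_tendsto c1.norm c2 ?_
    obtain ⟨ε, hε, hball⟩ := Metric.nhds_basis_closedBall.mem_iff.1 (hP.mem_nhds hz₀)
    filter_upwards [hφ.eventually_lt_const hε] with i hi
    set g : SpT → ℝ := fun z => (φ i).normed volume (z₀ - z) with hg
    have hg0 : ∀ z, 0 ≤ g z := fun z => (φ i).nonneg_normed _
    have hgc : ContDiff ℝ (⊤ : ℕ∞) g := (φ i).contDiff_normed.comp (contDiff_const.sub contDiff_id)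
    have hsub : Function.support g ⊆ Metric.closedBall z₀ (φ i).rOut := by
      intro z hz
      have h1 : z₀ - z ∈ Function.support ((φ i).normed volume) := hz
      rw [ContDiffBump.support_normed_eq, mem_ball_zero_iff] at h1
      rw [mem_closedBall_iff_norm, norm_sub_rev]
      exact h1.le
    have hgs : HasCompactSupport g :=
      HasCompactSupport.of_support_subset_isCompact (isCompact_closedBall _ _) hsub
    have htest : IsTestOn P g := ⟨hgc, hgs,
      (closure_minimal hsub Metric.isClosed_closedBall).trans
        ((Metric.closedBall_subset_closedBall hi.le).trans hball)⟩
    have conv : ∀ k : SpT → ℝ,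
        ((φ i).normed volume ⋆[ContinuousLinearMap.lsmul ℝ ℝ, volume] P.indicator k) z₀ =
        ∫ z in P, k z * g z := by
      intro k
      rw [convolution_eq_swap, ← integral_indicator hPm]
      refine integral_congr_ae (Eventually.of_forall fun z => ?_)
      by_cases hz : z ∈ P
      · simp [indicator_of_mem hz, hg, mul_comm]
      · simp [indicator_of_notMem hz]
    rw [conv, conv]
    obtain ⟨C, hC⟩ := htest.exists_bound
    have hi2 : IntegrableOn (fun z => (M z).toReal * g z) P :=
      Integrable.mul_bdd hmi hgc.continuous.aestronglyMeasurable (Eventually.of_forall hC)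
    have h3 : ∫⁻ z in P, ‖g z‖ₑ * M z = ENNReal.ofReal (∫ z in P, (M z).toReal * g z) := by
      rw [ofReal_integral_eq_lintegral_ofReal hi2
        (Eventually.of_forall fun z => mul_nonneg ENNReal.toReal_nonneg (hg0 z))]
      refine lintegral_congr_ae ?_
      filter_upwards [hMfin] with z hz
      rw [ENNReal.ofReal_mul ENNReal.toReal_nonneg, ENNReal.ofReal_toReal hz.ne, mul_comm,
        Real.enorm_of_nonneg (hg0 z)]
    have h4 := h g htest
    rw [h3, Real.enorm_eq_ofReal_abs] at h4
    refine (ENNReal.ofReal_le_ofReal_iff ?_).1 h4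
    exact integral_nonneg fun z => mul_nonneg ENNReal.toReal_nonneg (hg0 z)
  rw [indicator_of_mem hz₀, indicator_of_mem hz₀] at hle
  rw [← ofReal_norm]
  exact (ENNReal.ofReal_le_ofReal hle).trans ENNReal.ofReal_toReal_le

theorem lintegral_norm_rpow_ball_lt_top {a : ℝ} (ha : -3 < a) (r : ℝ) :
    ∫⁻ x in Metric.ball (0 : E3) r, ENNReal.ofReal (‖x‖ ^ a) < ∞ := by
  rcases le_or_gt r 0 with hr | hr
  · rw [Metric.ball_eq_empty.2 hr]; simp
  have h : IntegrableOn (fun x : E3 => ‖x‖ ^ a) (Metric.ball 0 r) := by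
    rw [integrableOn_fun_norm_addHaar (μ := (volume : Measure E3)) (f := fun t : ℝ => t ^ a)]
    have h1 : IntegrableOn (fun y : ℝ => y ^ (2 + a)) (Ioo 0 r) :=
      (intervalIntegral.integrableOn_Ioo_rpow_iff hr).2 (by linarith)
    refine h1.congr_fun (fun y hy => ?_) measurableSet_Ioo
    simp only [finrank_euclideanSpace, Fintype.card_fin, smul_eq_mul]
    rw [Real.rpow_add hy.1]
    norm_num
  exact (hasFiniteIntegral_iff_ofReal (Eventually.of_forall fun x => by positivity)).1 h.2

theorem lintegral_ball_sub_left_le {k : E3 → ℝ≥0∞} {x : E3} (hx : ‖x‖ < 1) :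
    ∫⁻ y in Metric.ball (0 : E3) 1, k (x - y) ≤ ∫⁻ y in Metric.ball (0 : E3) 2, k y := by
  rw [← lintegral_indicator measurableSet_ball, ← lintegral_indicator measurableSet_ball,
    ← lintegral_sub_left_eq_self _ x]
  refine lintegral_mono fun y => ?_
  by_cases hy : x - y ∈ Metric.ball (0 : E3) 1
  · have : y ∈ Metric.ball (0 : E3) 2 := by
      rw [mem_ball_zero_iff] at hy ⊢
      have := norm_sub_le_norm_sub_add_norm_sub x (x - y) 0
      have h2 := norm_le_norm_add_norm_sub' y x
      rw [norm_sub_rev y x] at h2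
      linarith
    simp [indicator_of_mem this, indicator_of_mem hy]
  · simp [indicator_of_notMem hy]

theorem lintegral_ball_sub_right_le {k : E3 → ℝ≥0∞} {y : E3} (hy : ‖y‖ < 1) :
    ∫⁻ x in Metric.ball (0 : E3) 1, k (x - y) ≤ ∫⁻ x in Metric.ball (0 : E3) 2, k x := by
  rw [← lintegral_indicator measurableSet_ball, ← lintegral_indicator measurableSet_ball,
    ← lintegral_add_right_eq_self _ y]
  refine lintegral_mono fun x => ?_
  by_cases hx : x + y ∈ Metric.ball (0 : E3) 1
  · have : x ∈ Metric.ball (0 : E3) 2 := by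
      rw [mem_ball_zero_iff] at hx ⊢
      have h2 := norm_sub_le (x + y) y
      rw [add_sub_cancel_right] at h2
      linarith
    simp [indicator_of_mem this, indicator_of_mem hx]
  · simp [indicator_of_notMem hx]

theorem mul_eq_prod_rpow (a b c w : ℝ≥0∞) :
    a * (w ^ (3 / 4 : ℝ) * (b * c)) = (a ^ 3 * w) ^ (1 / 6 : ℝ) * ((a ^ 2 * c ^ 2) ^ (1 / 4 : ℝ) *
      ((c ^ 2 * w) ^ (1 / 4 : ℝ) * (b ^ 3 * w) ^ (1 / 3 : ℝ))) := by
  have ha : a ^ (1 / 2 : ℝ) * a ^ (1 / 2 : ℝ) = a := by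
    rw [← ENNReal.rpow_add_of_nonneg _ _ (by norm_num) (by norm_num)]; norm_num
  have hc : c ^ (1 / 2 : ℝ) * c ^ (1 / 2 : ℝ) = c := by
    rw [← ENNReal.rpow_add_of_nonneg _ _ (by norm_num) (by norm_num)]; norm_num
  have hw : w ^ (1 / 6 : ℝ) * (w ^ (1 / 4 : ℝ) * w ^ (1 / 3 : ℝ)) = w ^ (3 / 4 : ℝ) := by
    rw [← ENNReal.rpow_add_of_nonneg _ _ (by norm_num) (by norm_num),
      ← ENNReal.rpow_add_of_nonneg _ _ (by norm_num) (by norm_num)]; norm_num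
  simp only [ENNReal.mul_rpow_of_nonneg _ _ (by norm_num : (0 : ℝ) ≤ 1 / 6),
    ENNReal.mul_rpow_of_nonneg _ _ (by norm_num : (0 : ℝ) ≤ 1 / 4),
    ENNReal.mul_rpow_of_nonneg _ _ (by norm_num : (0 : ℝ) ≤ 1 / 3),
    ← ENNReal.rpow_natCast, ← ENNReal.rpow_mul]
  norm_num only
  rw [← hw]
  nth_rewrite 1 [← ha]
  nth_rewrite 1 [← hc]
  rw [ENNReal.rpow_one]
  ring

theorem lintegral_riesz_le {U V : E3 → ℝ≥0∞} (hU : Measurable U) (hV : Measurable V)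
    {κ : E3 → ℝ≥0∞} (hκ : Measurable κ) :
    ∫⁻ x in Metric.ball (0 : E3) 1, U x * ∫⁻ y in Metric.ball (0 : E3) 1,
      κ (x - y) ^ (3 / 4 : ℝ) * (U y * V y) ≤
    (∫⁻ y in Metric.ball (0 : E3) 2, κ y) ^ (3 / 4 : ℝ) *
      ((∫⁻ x in Metric.ball (0 : E3) 1, U x ^ 2) ^ (1 / 4 : ℝ) *
      ((∫⁻ x in Metric.ball (0 : E3) 1, U x ^ 3) ^ (1 / 2 : ℝ) *
      (∫⁻ x in Metric.ball (0 : E3) 1, V x ^ 2) ^ (1 / 2 : ℝ))) := by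
  set μ : Measure E3 := volume.restrict (Metric.ball 0 1) with hμ
  set W := ∫⁻ y in Metric.ball (0 : E3) 2, κ y with hW
  have hk : Measurable fun q : E3 × E3 => κ (q.1 - q.2) := hκ.comp (by fun_prop)
  have hU1 : Measurable fun q : E3 × E3 => U q.1 := hU.comp measurable_fst
  have hU2 : Measurable fun q : E3 × E3 => U q.2 := hU.comp measurable_snd
  have hV2 : Measurable fun q : E3 × E3 => V q.2 := hV.comp measurable_snd
  have e1 : ∫⁻ x, U x * ∫⁻ y, κ (x - y) ^ (3 / 4 : ℝ) * (U y * V y) ∂μ ∂μ =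
      ∫⁻ q, U q.1 * (κ (q.1 - q.2) ^ (3 / 4 : ℝ) * (U q.2 * V q.2)) ∂(μ.prod μ) := by
    rw [lintegral_prod _ (by fun_prop)]
    refine lintegral_congr fun x => ?_
    simp only
    rw [lintegral_const_mul]
    exact ((hκ.comp (by fun_prop : Measurable fun y => x - y)).pow_const _).mul (hU.mul hV)
  rw [e1]
  have hball : ∀ᵐ x ∂μ, ‖x‖ < 1 := by
    filter_upwards [ae_restrict_mem measurableSet_ball] with x hx using mem_ball_zero_iff.1 hx
  have i1 : ∫⁻ q, U q.1 ^ 3 * κ (q.1 - q.2) ∂(μ.prod μ) ≤ (∫⁻ x, U x ^ 3 ∂μ) * W := by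
    rw [lintegral_prod _ (by fun_prop), ← lintegral_mul_const _
      (hU.pow_const _)]
    refine lintegral_mono_ae ?_
    filter_upwards [hball] with x hx
    have h4 : Measurable fun y => κ (x - y) := hκ.comp (by fun_prop)
    rw [lintegral_const_mul _ h4]
    exact mul_le_mul_right (lintegral_ball_sub_left_le hx) _
  have i2 : ∀ {g : E3 → ℝ≥0∞}, Measurable g →
      ∫⁻ q, g q.2 * κ (q.1 - q.2) ∂(μ.prod μ) ≤ (∫⁻ x, g x ∂μ) * W := by
    intro g hg
    rw [lintegral_prod_symm _ (by fun_prop),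
      ← lintegral_mul_const _ hg]
    refine lintegral_mono_ae ?_
    filter_upwards [hball] with y hy
    have h4 : Measurable fun x => κ (x - y) := hκ.comp (by fun_prop)
    rw [lintegral_const_mul _ h4]
    exact mul_le_mul_right (lintegral_ball_sub_right_le hy) _
  have i3 : ∫⁻ q, U q.1 ^ 2 * V q.2 ^ 2 ∂(μ.prod μ) =
      (∫⁻ x, U x ^ 2 ∂μ) * ∫⁻ x, V x ^ 2 ∂μ :=
    lintegral_prod_mul (hU.pow_const _).aemeasurable (hV.pow_const _).aemeasurable
  let f : Fin 4 → E3 × E3 → ℝ≥0∞ := ![fun q => U q.1 ^ 3 * κ (q.1 - q.2),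
    fun q => U q.1 ^ 2 * V q.2 ^ 2, fun q => V q.2 ^ 2 * κ (q.1 - q.2),
    fun q => U q.2 ^ 3 * κ (q.1 - q.2)]
  let p : Fin 4 → ℝ := ![1 / 6, 1 / 4, 1 / 4, 1 / 3]
  have hf : ∀ i ∈ Finset.univ, AEMeasurable (f i) (μ.prod μ) := by
    intro i _
    fin_cases i
    · exact ((hU1.pow_const _).mul hk).aemeasurable
    · exact ((hU1.pow_const _).mul (hV2.pow_const _)).aemeasurable
    · exact ((hV2.pow_const _).mul hk).aemeasurable
    · exact ((hU2.pow_const _).mul hk).aemeasurable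
  have H := ENNReal.lintegral_prod_norm_pow_le Finset.univ hf (p := p)
    (by simp [p, Fin.sum_univ_four]; norm_num) (by
      intro i _; fin_cases i <;> simp [p])
  simp only [Fin.prod_univ_four] at H
  have e2 : ∀ q : E3 × E3, U q.1 * (κ (q.1 - q.2) ^ (3 / 4 : ℝ) * (U q.2 * V q.2)) =
      f 0 q ^ p 0 * f 1 q ^ p 1 * f 2 q ^ p 2 * f 3 q ^ p 3 := by
    intro q
    rw [mul_eq_prod_rpow]
    simp only [f, p, Matrix.cons_val_zero, Matrix.cons_val_one, Matrix.cons_val, mul_assoc]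
  simp_rw [e2]
  refine H.trans ?_
  simp only [f, p, Matrix.cons_val_zero, Matrix.cons_val_one, Matrix.cons_val]
  rw [i3]
  set a := ∫⁻ x, U x ^ 3 ∂μ
  set b := ∫⁻ x, U x ^ 2 ∂μ
  set c := ∫⁻ x, V x ^ 2 ∂μ
  have h1 := i2 (hV.pow_const 2)
  have h2 := i2 (hU.pow_const 3)
  calc _ ≤ (a * W) ^ (1 / 6 : ℝ) * (b * c) ^ (1 / 4 : ℝ) * (c * W) ^ (1 / 4 : ℝ) *
        (a * W) ^ (1 / 3 : ℝ) := by gcongr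
    _ = _ := by
      simp only [ENNReal.mul_rpow_of_nonneg _ _ (by norm_num : (0 : ℝ) ≤ 1 / 6),
        ENNReal.mul_rpow_of_nonneg _ _ (by norm_num : (0 : ℝ) ≤ 1 / 4),
        ENNReal.mul_rpow_of_nonneg _ _ (by norm_num : (0 : ℝ) ≤ 1 / 3)]
      have ha : a ^ (1 / 6 : ℝ) * a ^ (1 / 3 : ℝ) = a ^ (1 / 2 : ℝ) := by
        rw [← ENNReal.rpow_add_of_nonneg _ _ (by norm_num) (by norm_num)]; norm_num
      have hc : c ^ (1 / 4 : ℝ) * c ^ (1 / 4 : ℝ) = c ^ (1 / 2 : ℝ) := by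
        rw [← ENNReal.rpow_add_of_nonneg _ _ (by norm_num) (by norm_num)]; norm_num
      have hw : W ^ (1 / 6 : ℝ) * (W ^ (1 / 4 : ℝ) * W ^ (1 / 3 : ℝ)) = W ^ (3 / 4 : ℝ) := by
        rw [← ENNReal.rpow_add_of_nonneg _ _ (by norm_num) (by norm_num),
          ← ENNReal.rpow_add_of_nonneg _ _ (by norm_num) (by norm_num)]; norm_num
      rw [← ha, ← hc, ← hw]
      ring

theorem volume_restrict_ball_prod (r : ℝ) (J : Set ℝ) :
    (volume : Measure SpT).restrict (Metric.ball 0 r ×ˢ J) =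
      ((volume : Measure E3).restrict (Metric.ball 0 r)).prod (volume.restrict J) := by
  rw [Measure.volume_eq_prod, ← Measure.prod_restrict]

theorem lintegral_le_rpow_mul_measure_univ {α : Type*} [MeasurableSpace α] {μ : Measure α}
    {p q : ℝ} (hpq : p.HolderConjugate q) {f : α → ℝ≥0∞} (hf : Measurable f) :
    ∫⁻ x, f x ∂μ ≤ (∫⁻ x, f x ^ p ∂μ) ^ (1 / p) * μ univ ^ (1 / q) := by
  have h := ENNReal.lintegral_mul_le_Lp_mul_Lq μ hpq hf.aemeasurable
    (measurable_const (a := (1 : ℝ≥0∞))).aemeasurable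
  simpa using h

theorem lintegral_riesz_space_ne_top {w : SpT → ℝ≥0∞} (hw : Measurable w) {κ : E3 → ℝ≥0∞}
    (hκ : Measurable κ) (hκi : ∫⁻ x in Metric.ball (0 : E3) 2, κ x ≠ ∞) {J : Set ℝ}
    (hwi : ∫⁻ z in Metric.ball (0 : E3) 1 ×ˢ J, w z ≠ ∞) :
    ∫⁻ z in Metric.ball (0 : E3) 1 ×ˢ J,
      ∫⁻ y in Metric.ball (0 : E3) 1, w (y, z.2) * κ (z.1 - y) ≠ ∞ := by
  have hm : Measurable fun q : (E3 × ℝ) × E3 => w (q.2, q.1.2) * κ (q.1.1 - q.2) :=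
    (hw.comp (by fun_prop : Measurable fun q : (E3 × ℝ) × E3 => (q.2, q.1.2))).mul
      (hκ.comp (by fun_prop : Measurable fun q : (E3 × ℝ) × E3 => q.1.1 - q.2))
  have hm' := hm.lintegral_prod_right' (ν := volume.restrict (Metric.ball (0 : E3) 1))
  rw [volume_restrict_ball_prod] at hwi ⊢
  rw [lintegral_prod_symm _ hw.aemeasurable] at hwi
  rw [lintegral_prod_symm _ hm'.aemeasurable]
  refine ne_of_lt (lt_of_le_of_lt (b := (∫⁻ s in J, ∫⁻ y in Metric.ball (0 : E3) 1, w (y, s)) *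
    ∫⁻ x in Metric.ball (0 : E3) 2, κ x) ?_
    (ENNReal.mul_lt_top (lt_top_iff_ne_top.2 hwi) (lt_top_iff_ne_top.2 hκi)))
  rw [← lintegral_mul_const _ hw.lintegral_prod_left']
  refine lintegral_mono fun s => ?_
  have hs : Measurable fun y : E3 => w (y, s) := hw.comp (by fun_prop)
  rw [← lintegral_mul_const _ hs]
  simp only
  rw [lintegral_lintegral_swap]
  · refine setLIntegral_mono' measurableSet_ball fun y hy => ?_
    have h4 : Measurable fun x : E3 => κ (x - y) := hκ.comp (by fun_prop)
    rw [lintegral_const_mul _ h4]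
    exact mul_le_mul_right (lintegral_ball_sub_right_le (mem_ball_zero_iff.1 hy)) _
  · exact (hm.comp (by fun_prop : Measurable fun q : E3 × E3 => ((q.1, s), q.2))).aemeasurable

theorem lintegral_riesz_spacetime_le {U V : SpT → ℝ≥0∞} (hU : Measurable U) (hV : Measurable V)
    {κ : E3 → ℝ≥0∞} (hκ : Measurable κ) (J : Set ℝ) {A : ℝ≥0∞}
    (hA : ∀ᵐ s ∂volume.restrict J, ∫⁻ x in Metric.ball (0 : E3) 1, U (x, s) ^ 2 ≤ A) :
    ∫⁻ z in Metric.ball (0 : E3) 1 ×ˢ J, U z * ∫⁻ y in Metric.ball (0 : E3) 1,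
      κ (z.1 - y) ^ (3 / 4 : ℝ) * (U (y, z.2) * V (y, z.2)) ≤
    (∫⁻ y in Metric.ball (0 : E3) 2, κ y) ^ (3 / 4 : ℝ) * (A ^ (1 / 4 : ℝ) *
      ((∫⁻ z in Metric.ball (0 : E3) 1 ×ˢ J, U z ^ 3) ^ (1 / 2 : ℝ) *
      (∫⁻ z in Metric.ball (0 : E3) 1 ×ˢ J, V z ^ 2) ^ (1 / 2 : ℝ))) := by
  have hm : Measurable fun q : (E3 × ℝ) × E3 =>
      κ (q.1.1 - q.2) ^ (3 / 4 : ℝ) * (U (q.2, q.1.2) * V (q.2, q.1.2)) := by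
    have h1 : Measurable fun q : (E3 × ℝ) × E3 => κ (q.1.1 - q.2) := hκ.comp (by fun_prop)
    have h2 : Measurable fun q : (E3 × ℝ) × E3 => (q.2, q.1.2) := by fun_prop
    exact (h1.pow_const _).mul ((hU.comp h2).mul (hV.comp h2))
  have hm' : Measurable fun z : SpT => U z * ∫⁻ y in Metric.ball (0 : E3) 1,
      κ (z.1 - y) ^ (3 / 4 : ℝ) * (U (y, z.2) * V (y, z.2)) :=
    hU.mul (hm.lintegral_prod_right' (ν := volume.restrict (Metric.ball (0 : E3) 1)))
  have hU3 : Measurable fun z => U z ^ 3 := hU.pow_const _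
  have hV2 : Measurable fun z => V z ^ 2 := hV.pow_const _
  rw [volume_restrict_ball_prod, lintegral_prod_symm _ hm'.aemeasurable,
    lintegral_prod_symm _ hU3.aemeasurable, lintegral_prod_symm _ hV2.aemeasurable]
  have hH := ENNReal.lintegral_mul_le_Lp_mul_Lq (volume.restrict J) Real.HolderConjugate.two_two
    (hU3.lintegral_prod_left' (μ := volume.restrict (Metric.ball (0 : E3) 1))
      |>.pow_const (1 / 2 : ℝ)).aemeasurable
    (hV2.lintegral_prod_left' (μ := volume.restrict (Metric.ball (0 : E3) 1))
      |>.pow_const (1 / 2 : ℝ)).aemeasurable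
  simp only [Pi.mul_apply, ← ENNReal.rpow_mul] at hH
  norm_num only [ENNReal.rpow_one] at hH
  refine le_trans ?_ (mul_le_mul_right (mul_le_mul_right hH _) _)
  rw [← lintegral_const_mul _ (by
      exact ((hU3.lintegral_prod_left').pow_const _).mul ((hV2.lintegral_prod_left').pow_const _)),
    ← lintegral_const_mul _ (by
      exact (((hU3.lintegral_prod_left').pow_const _).mul
        ((hV2.lintegral_prod_left').pow_const _)).const_mul _)]
  refine lintegral_mono_ae ?_
  filter_upwards [hA] with s hs
  refine (lintegral_riesz_le (hU.comp (by fun_prop : Measurable fun y : E3 => (y, s)))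
    (hV.comp (by fun_prop : Measurable fun y : E3 => (y, s))) hκ).trans ?_
  simp only [Function.comp_apply]
  gcongr

theorem lintegral_mul_mean_le {U P : SpT → ℝ≥0∞} (hU : Measurable U) (hP : Measurable P)
    {J I : Set ℝ} (hIJ : I ⊆ J) {A δ : ℝ≥0∞} (hI : volume I ≤ δ ^ 2) {r : ℝ} (hr1 : r ≤ 1)
    (hr : volume (Metric.ball (0 : E3) r) ≤ δ ^ 3 * volume (Metric.ball (0 : E3) 1))
    (hA : ∀ᵐ s ∂volume.restrict J, ∫⁻ x in Metric.ball (0 : E3) 1, U (x, s) ^ 2 ≤ A) :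
    ∫⁻ z in Metric.ball (0 : E3) r ×ˢ I, U z * ∫⁻ y in Metric.ball (0 : E3) 1, P (y, z.2) ≤
    volume (Metric.ball (0 : E3) 1) ^ (5 / 6 : ℝ) * (δ ^ (13 / 6 : ℝ) * (A ^ (1 / 2 : ℝ) *
      (∫⁻ z in Metric.ball (0 : E3) 1 ×ˢ J, P z ^ (3 / 2 : ℝ)) ^ (2 / 3 : ℝ))) := by
  set v := volume (Metric.ball (0 : E3) 1) with hv
  set D := ∫⁻ z in Metric.ball (0 : E3) 1 ×ˢ J, P z ^ (3 / 2 : ℝ) with hD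
  have hPm : Measurable fun s => ∫⁻ y in Metric.ball (0 : E3) 1, P (y, s) :=
    hP.lintegral_prod_left'
  have hm : Measurable fun z : SpT => U z * ∫⁻ y in Metric.ball (0 : E3) 1, P (y, z.2) :=
    hU.mul (hPm.comp measurable_snd)
  have h1 : ∫⁻ s in I, ∫⁻ y in Metric.ball (0 : E3) 1, P (y, s) ≤
      D ^ (2 / 3 : ℝ) * (v * δ ^ 2) ^ (1 / 3 : ℝ) := by
    rw [← lintegral_prod_symm _ hP.aemeasurable, ← volume_restrict_ball_prod]
    refine (lintegral_le_rpow_mul_measure_univ (p := 3 / 2) (q := 3) (by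
      rw [Real.holderConjugate_iff]; norm_num) hP).trans ?_
    norm_num only
    have h2 : ∫⁻ z in Metric.ball (0 : E3) 1 ×ˢ I, P z ^ (3 / 2 : ℝ) ≤ D :=
      lintegral_mono_set (prod_mono_right hIJ)
    have h3 : (volume : Measure SpT).restrict (Metric.ball 0 1 ×ˢ I) univ ≤ v * δ ^ 2 := by
      rw [Measure.restrict_apply_univ, Measure.volume_eq_prod, Measure.prod_prod]
      gcongr
    gcongr
  rw [volume_restrict_ball_prod, lintegral_prod_symm _ hm.aemeasurable]
  calc _ ≤ ∫⁻ s in I, (A ^ (1 / 2 : ℝ) * (δ ^ 3 * v) ^ (1 / 2 : ℝ)) *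
        ∫⁻ y in Metric.ball (0 : E3) 1, P (y, s) := by
        refine lintegral_mono_ae ?_
        filter_upwards [ae_restrict_of_ae_restrict_of_subset hIJ hA] with s hs
        have hUs : Measurable fun y : E3 => U (y, s) := hU.comp (by fun_prop)
        rw [lintegral_mul_const _ hUs]
        gcongr
        refine (lintegral_le_rpow_mul_measure_univ (p := 2) (q := 2)
          Real.HolderConjugate.two_two hUs).trans ?_
        rw [Measure.restrict_apply_univ]
        gcongr
        refine le_trans ?_ hs
        simp only [ENNReal.rpow_two]
        exact lintegral_mono_set (Metric.ball_subset_ball hr1)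
    _ = (A ^ (1 / 2 : ℝ) * (δ ^ 3 * v) ^ (1 / 2 : ℝ)) *
        ∫⁻ s in I, ∫⁻ y in Metric.ball (0 : E3) 1, P (y, s) := lintegral_const_mul _ hPm
    _ ≤ (A ^ (1 / 2 : ℝ) * (δ ^ 3 * v) ^ (1 / 2 : ℝ)) *
        (D ^ (2 / 3 : ℝ) * (v * δ ^ 2) ^ (1 / 3 : ℝ)) := by gcongr
    _ = _ := by
        rw [ENNReal.mul_rpow_of_nonneg _ _ (by norm_num : (0 : ℝ) ≤ 1 / 2),
          ENNReal.mul_rpow_of_nonneg _ _ (by norm_num : (0 : ℝ) ≤ 1 / 3),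
          ← ENNReal.rpow_natCast δ 3, ← ENNReal.rpow_natCast δ 2, ← ENNReal.rpow_mul,
          ← ENNReal.rpow_mul]
        have hd : δ ^ (3 / 2 : ℝ) * δ ^ (2 / 3 : ℝ) = δ ^ (13 / 6 : ℝ) := by
          rw [← ENNReal.rpow_add_of_nonneg _ _ (by norm_num) (by norm_num)]; norm_num
        have hw : v ^ (1 / 2 : ℝ) * v ^ (1 / 3 : ℝ) = v ^ (5 / 6 : ℝ) := by
          rw [← ENNReal.rpow_add_of_nonneg _ _ (by norm_num) (by norm_num)]; norm_num
        rw [← hd, ← hw]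
        norm_num only
        ring

theorem ofReal_norm_zpow_neg_two (x : E3) :
    ENNReal.ofReal (‖x‖ ^ (-2 : ℤ)) = ENNReal.ofReal (‖x‖ ^ (-8 / 3 : ℝ)) ^ (3 / 4 : ℝ) := by
  rw [ENNReal.ofReal_rpow_of_nonneg (by positivity) (by norm_num), ← Real.rpow_mul (norm_nonneg x),
    ← Real.rpow_intCast]
  norm_num

theorem ofReal_rpow_three_halves (a : ℝ) :
    ENNReal.ofReal (|a| ^ (3 / 2 : ℝ)) = ‖a‖ₑ ^ (3 / 2 : ℝ) := by
  rw [← ENNReal.ofReal_rpow_of_nonneg (abs_nonneg a) (by norm_num), Real.enorm_eq_ofReal_abs]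

theorem newtonMajorant_mul_eq {p U V : SpT → ℝ} (hp : Measurable p) (hU : Measurable U)
    (hV : Measurable V) (hU0 : ∀ z, 0 ≤ U z) (z : SpT) :
    newtonMajorant p (fun z => 24 * (U z * V z)) z =
      (∫⁻ y in Metric.ball (0 : E3) 1, ‖p (y, z.2)‖ₑ) +
      24 * ∫⁻ y in Metric.ball (0 : E3) 1, ENNReal.ofReal (‖z.1 - y‖ ^ (-8 / 3 : ℝ)) ^ (3 / 4 : ℝ) *
        (ENNReal.ofReal (U (y, z.2)) * ENNReal.ofReal (V (y, z.2))) := by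
  have hp' : Measurable fun y : E3 => ‖p (y, z.2)‖ₑ :=
    (hp.comp (by fun_prop : Measurable fun y : E3 => (y, z.2))).enorm
  have hU' : Measurable fun y : E3 => ENNReal.ofReal (U (y, z.2)) :=
    (hU.comp (by fun_prop : Measurable fun y : E3 => (y, z.2))).ennreal_ofReal
  have hV' : Measurable fun y : E3 => ENNReal.ofReal (V (y, z.2)) :=
    (hV.comp (by fun_prop : Measurable fun y : E3 => (y, z.2))).ennreal_ofReal
  unfold newtonMajorant
  rw [lintegral_add_left hp', ← lintegral_const_mul _ (by fun_prop)]
  congr 1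
  refine lintegral_congr fun y => ?_
  rw [ofReal_norm_zpow_neg_two, ENNReal.ofReal_mul (by norm_num), ENNReal.ofReal_mul (hU0 _),
    ENNReal.ofReal_ofNat]
  ring

theorem exists_unit_cylinder_estimate : ∃ K : ℝ≥0∞, K ≠ ∞ ∧ ∀ (J : Set ℝ) (p U V : SpT → ℝ),
    IsOpen J → volume J ≠ ∞ → Measurable p → Measurable U → Measurable V →
    (∀ z, 0 ≤ U z) → (∀ z, 0 ≤ V z) →
    (∀ ψ, IsTestOn (Metric.ball 0 1 ×ˢ J) ψ →
      ‖∫ z in Metric.ball 0 1 ×ˢ J, p z * sLap ψ z‖ₑ ≤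
        ∫⁻ z in Metric.ball 0 1 ×ˢ J,
          ENNReal.ofReal (24 * (U z * V z) * ∑ j, |sderiv j ψ z|)) →
    ∀ A : ℝ≥0∞, A ≠ ∞ →
    (∀ᵐ s ∂volume.restrict J, ∫⁻ x in Metric.ball 0 1, ENNReal.ofReal (U (x, s) ^ 2) ≤ A) →
    ∫⁻ z in Metric.ball 0 1 ×ˢ J, ENNReal.ofReal (V z ^ 2) ≠ ∞ →
    ∫⁻ z in Metric.ball 0 1 ×ˢ J, ENNReal.ofReal (|p z| ^ (3 / 2 : ℝ)) ≠ ∞ →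
    ∀ (γ : ℝ) (I : Set ℝ), 0 < γ → γ ≤ 1 / 2 → I ⊆ J → volume I ≤ ENNReal.ofReal γ ^ 2 →
    ∫⁻ z in Metric.ball 0 γ ×ˢ I, ENNReal.ofReal (U z * |p z|) ≤
      K * (ENNReal.ofReal γ ^ (13 / 6 : ℝ) * (A ^ (1 / 2 : ℝ) *
        (∫⁻ z in Metric.ball 0 1 ×ˢ J, ENNReal.ofReal (|p z| ^ (3 / 2 : ℝ))) ^ (2 / 3 : ℝ)) +
      A ^ (1 / 4 : ℝ) * ((∫⁻ z in Metric.ball 0 1 ×ˢ J, ENNReal.ofReal (U z ^ 3)) ^ (1 / 2 : ℝ) *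
        (∫⁻ z in Metric.ball 0 1 ×ˢ J, ENNReal.ofReal (V z ^ 2)) ^ (1 / 2 : ℝ))) := by
  obtain ⟨K, hK, H⟩ := exists_tested_pressure_bound
  set κ : E3 → ℝ≥0∞ := fun x => ENNReal.ofReal (‖x‖ ^ (-8 / 3 : ℝ)) with hκdef
  have hκ : Measurable κ := by fun_prop
  have hκi : ∫⁻ x in Metric.ball (0 : E3) 2, κ x ≠ ∞ :=
    (lintegral_norm_rpow_ball_lt_top (by norm_num) 2).ne
  have hκi' : ∫⁻ x in Metric.ball (0 : E3) 2, κ x ^ (3 / 4 : ℝ) ≠ ∞ := by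
    have h := (lintegral_norm_rpow_ball_lt_top (a := (-2 : ℤ)) (by norm_num) 2).ne
    simpa only [Real.rpow_intCast, ofReal_norm_zpow_neg_two] using h
  set v := volume (Metric.ball (0 : E3) 1) with hv
  have hvt : v ≠ ∞ := measure_ball_lt_top.ne
  refine ⟨ENNReal.ofReal K * (v ^ (5 / 6 : ℝ) + 24 *
    (∫⁻ x in Metric.ball (0 : E3) 2, κ x) ^ (3 / 4 : ℝ)), ?_, ?_⟩
  · refine ENNReal.mul_ne_top ENNReal.ofReal_ne_top (ENNReal.add_ne_top.2 ⟨?_, ?_⟩)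
    · exact ENNReal.rpow_ne_top_of_nonneg (by norm_num) hvt
    · exact ENNReal.mul_ne_top (by norm_num) (ENNReal.rpow_ne_top_of_nonneg (by norm_num) hκi)
  intro J p U V hJ hJv hp hU hV hU0 hV0 hstar A hAt hA hVt hDt γ I hγ hγ2 hIJ hI
  set w : SpT → ℝ := fun z => 24 * (U z * V z) with hw
  have hwm : Measurable w := (hU.mul hV).const_mul _
  have hw0 : ∀ z, 0 ≤ w z := fun z => mul_nonneg (by norm_num) (mul_nonneg (hU0 z) (hV0 z))
  set U' : SpT → ℝ≥0∞ := fun z => ENNReal.ofReal (U z) with hU'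
  set V' : SpT → ℝ≥0∞ := fun z => ENNReal.ofReal (V z) with hV'
  set P' : SpT → ℝ≥0∞ := fun z => ‖p z‖ₑ with hP'
  have mU' : Measurable U' := hU.ennreal_ofReal
  have mV' : Measurable V' := hV.ennreal_ofReal
  have mP' : Measurable P' := hp.enorm
  have eU2 : ∀ z, ENNReal.ofReal (U z ^ 2) = U' z ^ 2 := fun z => ENNReal.ofReal_pow (hU0 z) 2
  have eU3 : ∀ z, ENNReal.ofReal (U z ^ 3) = U' z ^ 3 := fun z => ENNReal.ofReal_pow (hU0 z) 3
  have eV2 : ∀ z, ENNReal.ofReal (V z ^ 2) = V' z ^ 2 := fun z => ENNReal.ofReal_pow (hV0 z) 2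
  simp only [eU2, eU3, eV2, ofReal_rpow_three_halves] at hA hVt hDt ⊢
  have hQm : volume (Metric.ball (0 : E3) 1 ×ˢ J) ≠ ∞ := by
    rw [Measure.volume_eq_prod, Measure.prod_prod]
    exact ENNReal.mul_ne_top hvt hJv
  have hpi : ∫⁻ z in Metric.ball 0 1 ×ˢ J, P' z ≠ ∞ := by
    refine ne_top_of_le_ne_top ?_ (lintegral_le_rpow_mul_measure_univ (p := 3 / 2) (q := 3) (by
      rw [Real.holderConjugate_iff]; norm_num) mP')
    refine ENNReal.mul_ne_top (ENNReal.rpow_ne_top_of_nonneg (by norm_num) hDt)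
      (ENNReal.rpow_ne_top_of_nonneg (by norm_num) ?_)
    rwa [Measure.restrict_apply_univ]
  have hpI : IntegrableOn p (Metric.ball 0 1 ×ˢ J) := ⟨hp.aestronglyMeasurable, hpi.lt_top⟩
  have hUi : ∫⁻ z in Metric.ball 0 1 ×ˢ J, U' z ^ 2 ≠ ∞ := by
    rw [volume_restrict_ball_prod, lintegral_prod_symm _ (mU'.pow_const _).aemeasurable]
    refine ne_top_of_le_ne_top ?_ (lintegral_mono_ae hA)
    rw [lintegral_const, Measure.restrict_apply_univ]
    exact ENNReal.mul_ne_top hAt hJv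
  have hUVi : ∫⁻ z in Metric.ball 0 1 ×ˢ J, U' z * V' z ≠ ∞ := by
    have h := ENNReal.lintegral_mul_le_Lp_mul_Lq (volume.restrict (Metric.ball 0 1 ×ˢ J))
      Real.HolderConjugate.two_two mU'.aemeasurable mV'.aemeasurable
    simp only [Pi.mul_apply, ENNReal.rpow_two] at h
    exact ne_top_of_le_ne_top (ENNReal.mul_ne_top
      (ENNReal.rpow_ne_top_of_nonneg (by norm_num) hUi)
      (ENNReal.rpow_ne_top_of_nonneg (by norm_num) hVt)) h
  have hmaj := newtonMajorant_mul_eq hp hU hV hU0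
  have hm1 : Measurable fun z : SpT => ∫⁻ y in Metric.ball (0 : E3) 1, P' (y, z.2) :=
    mP'.lintegral_prod_left'.comp measurable_snd
  have hmR : Measurable fun q : SpT × E3 =>
      κ (q.1.1 - q.2) ^ (3 / 4 : ℝ) * (U' (q.2, q.1.2) * V' (q.2, q.1.2)) := by
    have h2 : Measurable fun q : SpT × E3 => ((q.2, q.1.2) : SpT) := by fun_prop
    exact ((hκ.comp (by fun_prop : Measurable fun q : SpT × E3 => q.1.1 - q.2)).pow_const _).mul
      ((mU'.comp h2).mul (mV'.comp h2))
  have hm2 : Measurable fun z : SpT => ∫⁻ y in Metric.ball (0 : E3) 1,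
      κ (z.1 - y) ^ (3 / 4 : ℝ) * (U' (y, z.2) * V' (y, z.2)) := hmR.lintegral_prod_right'
  have hsub : Metric.ball (0 : E3) (1 / 2) ×ˢ J ⊆ Metric.ball 0 1 ×ˢ J :=
    prod_mono_left (Metric.ball_subset_ball (by norm_num))
  have hNi : ∫⁻ z in Metric.ball (0 : E3) 1 ×ˢ J, newtonMajorant p w z ≠ ∞ := by
    simp only [hw, hmaj]
    rw [lintegral_add_left hm1, lintegral_const_mul _ hm2]
    refine ENNReal.add_ne_top.2 ⟨?_, ENNReal.mul_ne_top (by norm_num) ?_⟩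
    · rw [volume_restrict_ball_prod, lintegral_prod_symm _ hm1.aemeasurable]
      rw [volume_restrict_ball_prod, lintegral_prod_symm _ mP'.aemeasurable] at hpi
      simp only [lintegral_const, Measure.restrict_apply_univ]
      rw [lintegral_mul_const _ mP'.lintegral_prod_left']
      exact ENNReal.mul_ne_top hpi hvt
    · have h := lintegral_riesz_space_ne_top (mU'.mul mV') (hκ.pow_const (3 / 4 : ℝ)) hκi' hUVi
      simpa only [Pi.mul_apply, mul_comm (κ _ ^ (3 / 4 : ℝ))] using h
  have hae := ae_enorm_le_of_forall_test (P := Metric.ball (0 : E3) (1 / 2) ×ˢ J)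
    (Metric.isOpen_ball.prod hJ) (hpI.mono_set hsub)
    ((measurable_newtonMajorant hp hwm).const_mul (ENNReal.ofReal K)) (by
      rw [lintegral_const_mul _ (measurable_newtonMajorant hp hwm)]
      exact ENNReal.mul_ne_top ENNReal.ofReal_ne_top
        (ne_top_of_le_ne_top hNi (lintegral_mono_set hsub)))
    (H J p w hJ hp hpI hw0 hwm hstar)
  have hγ1 : γ ≤ 1 := by linarith
  have hvγ : volume (Metric.ball (0 : E3) γ) ≤ ENNReal.ofReal γ ^ 3 * v := by
    rw [Measure.addHaar_ball_of_pos _ _ hγ, finrank_euclideanSpace, Fintype.card_fin,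
      ENNReal.ofReal_pow hγ.le]
  set D := ∫⁻ z in Metric.ball (0 : E3) 1 ×ˢ J, P' z ^ (3 / 2 : ℝ) with hD
  calc ∫⁻ z in Metric.ball 0 γ ×ˢ I, ENNReal.ofReal (U z * |p z|)
      ≤ ∫⁻ z in Metric.ball 0 γ ×ˢ I, ENNReal.ofReal K *
        (U' z * (∫⁻ y in Metric.ball (0 : E3) 1, P' (y, z.2)) +
        24 * (U' z * ∫⁻ y in Metric.ball (0 : E3) 1,
          κ (z.1 - y) ^ (3 / 4 : ℝ) * (U' (y, z.2) * V' (y, z.2)))) := by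
        refine lintegral_mono_ae ?_
        filter_upwards [ae_restrict_of_ae_restrict_of_subset
          (Set.prod_mono (Metric.ball_subset_ball hγ2) hIJ) hae] with z hz
        rw [ENNReal.ofReal_mul (hU0 z), ← Real.enorm_eq_ofReal_abs]
        refine (mul_le_mul_right hz _).trans (le_of_eq ?_)
        simp only [hw, hmaj]
        ring
    _ = ENNReal.ofReal K * ((∫⁻ z in Metric.ball 0 γ ×ˢ I,
          U' z * ∫⁻ y in Metric.ball (0 : E3) 1, P' (y, z.2)) +
        24 * ∫⁻ z in Metric.ball 0 γ ×ˢ I, U' z * ∫⁻ y in Metric.ball (0 : E3) 1,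
          κ (z.1 - y) ^ (3 / 4 : ℝ) * (U' (y, z.2) * V' (y, z.2))) := by
        rw [lintegral_const_mul, lintegral_add_left, lintegral_const_mul]
        · exact mU'.mul hm2
        · exact mU'.mul hm1
        · exact (mU'.mul hm1).add ((mU'.mul hm2).const_mul _)
    _ ≤ ENNReal.ofReal K * (v ^ (5 / 6 : ℝ) * (ENNReal.ofReal γ ^ (13 / 6 : ℝ) *
          (A ^ (1 / 2 : ℝ) * D ^ (2 / 3 : ℝ))) +
        24 * ((∫⁻ x in Metric.ball (0 : E3) 2, κ x) ^ (3 / 4 : ℝ) * (A ^ (1 / 4 : ℝ) *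
          ((∫⁻ z in Metric.ball (0 : E3) 1 ×ˢ J, U' z ^ 3) ^ (1 / 2 : ℝ) *
          (∫⁻ z in Metric.ball (0 : E3) 1 ×ˢ J, V' z ^ 2) ^ (1 / 2 : ℝ))))) := by
        gcongr
        · exact lintegral_mul_mean_le mU' mP' hIJ hI hγ1 hvγ hA
        · exact (lintegral_mono_set (Set.prod_mono (Metric.ball_subset_ball hγ1) hIJ)).trans
            (lintegral_riesz_spacetime_le mU' mV' hκ J hA)
    _ ≤ _ := by
        rw [mul_assoc (ENNReal.ofReal K)]
        refine mul_le_mul_right ?_ _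
        rw [add_mul, mul_add, mul_add, mul_assoc 24, mul_assoc 24]
        gcongr
        · exact le_self_add
        · exact le_add_self

/-- The parabolic rescaling `(y, s) ↦ (x₀ + ρ y, t₀ + ρ² s)`. -/
def parScale (z₀ : SpT) {ρ : ℝ} (hρ : 0 < ρ) : SpT ≃ₜ SpT where
  toFun z := (z₀.1 + ρ • z.1, z₀.2 + ρ ^ 2 * z.2)
  invFun z := (ρ⁻¹ • (z.1 - z₀.1), (ρ ^ 2)⁻¹ * (z.2 - z₀.2))
  left_inv z := by
    ext1
    · simp [smul_smul, hρ.ne']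
    · simp [hρ.ne']
  right_inv z := by
    ext1
    · simp [smul_smul, hρ.ne']
    · simp [hρ.ne']
  continuous_toFun := by fun_prop
  continuous_invFun := by fun_prop

theorem parScale_apply (z₀ : SpT) {ρ : ℝ} (hρ : 0 < ρ) (z : SpT) :
    parScale z₀ hρ z = (z₀.1 + ρ • z.1, z₀.2 + ρ ^ 2 * z.2) := rfl

theorem map_space_scale (x₀ : E3) {ρ : ℝ} (hρ : 0 < ρ) :
    (volume : Measure E3).map (fun x => x₀ + ρ • x) = ENNReal.ofReal ((ρ ^ 3)⁻¹) • volume := by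
  have h : (fun x : E3 => x₀ + ρ • x) = (fun x => x₀ + x) ∘ fun x => ρ • x := rfl
  rw [h, ← Measure.map_map (by fun_prop) (by fun_prop), Measure.map_addHaar_smul _ hρ.ne',
    Measure.map_smul, map_add_left_eq_self, finrank_euclideanSpace, Fintype.card_fin,
    abs_of_pos (by positivity)]

theorem map_time_scale (t₀ : ℝ) {ρ : ℝ} (hρ : 0 < ρ) :
    (volume : Measure ℝ).map (fun s => t₀ + ρ ^ 2 * s) = ENNReal.ofReal ((ρ ^ 2)⁻¹) • volume := by
  have h : (fun s : ℝ => t₀ + ρ ^ 2 * s) = (fun s => t₀ + s) ∘ fun s => ρ ^ 2 * s := rfl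
  rw [h, ← Measure.map_map (by fun_prop) (by fun_prop),
    Real.map_volume_mul_left (by positivity), Measure.map_smul, map_add_left_eq_self,
    abs_of_pos (by positivity)]

theorem map_parScale (z₀ : SpT) {ρ : ℝ} (hρ : 0 < ρ) :
    (volume : Measure SpT).map (parScale z₀ hρ) = ENNReal.ofReal ((ρ ^ 5)⁻¹) • volume := by
  have h : ⇑(parScale z₀ hρ) = Prod.map (fun x => z₀.1 + ρ • x) (fun s => z₀.2 + ρ ^ 2 * s) := rfl
  rw [h, Measure.volume_eq_prod, ← Measure.map_prod_map _ _ (by fun_prop) (by fun_prop),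
    map_space_scale _ hρ, map_time_scale _ hρ, Measure.prod_smul_left, Measure.prod_smul_right,
    smul_smul, ← ENNReal.ofReal_mul (by positivity)]
  congr 2
  rw [← mul_inv, ← pow_add]

theorem preimage_parScale_Qstar (z₀ : SpT) {ρ : ℝ} (hρ : 0 < ρ) (r : ℝ) :
    parScale z₀ hρ ⁻¹' Qstar z₀ (r * ρ) = Metric.ball 0 r ×ˢ Istar 0 r := by
  have hρ2 : 0 < ρ ^ 2 := by positivity
  ext z
  simp only [Qstar, ball3, Istar, mem_preimage, mem_prod, parScale_apply, Metric.mem_ball,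
    dist_eq_norm, add_sub_cancel_left, sub_zero, norm_smul, Real.norm_eq_abs, abs_of_pos hρ, mem_Ioo]
  refine and_congr ?_ (and_congr ?_ ?_)
  · rw [mul_comm r, mul_lt_mul_iff_right₀ hρ]
  · have h : z₀.2 - 7 / 8 * (r * ρ) ^ 2 = z₀.2 + ρ ^ 2 * (0 - 7 / 8 * r ^ 2) := by ring
    rw [h, add_lt_add_iff_left, mul_lt_mul_iff_right₀ hρ2]
  · have h : z₀.2 + 1 / 8 * (r * ρ) ^ 2 = z₀.2 + ρ ^ 2 * (0 + 1 / 8 * r ^ 2) := by ring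
    rw [h, add_lt_add_iff_left, mul_lt_mul_iff_right₀ hρ2]

theorem lintegral_parScale (z₀ : SpT) {ρ : ℝ} (hρ : 0 < ρ) (r : ℝ) (f : SpT → ℝ≥0∞) :
    ∫⁻ z in Metric.ball 0 r ×ˢ Istar 0 r, f (parScale z₀ hρ z) =
      ENNReal.ofReal ((ρ ^ 5)⁻¹) * ∫⁻ z in Qstar z₀ (r * ρ), f z := by
  have he := (parScale z₀ hρ).measurableEmbedding
  rw [← preimage_parScale_Qstar z₀ hρ, ← he.lintegral_map, ← he.restrict_map, map_parScale,
    Measure.restrict_smul, lintegral_smul_measure, smul_eq_mul]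

theorem integral_parScale (z₀ : SpT) {ρ : ℝ} (hρ : 0 < ρ) (r : ℝ) (f : SpT → ℝ) :
    ∫ z in Metric.ball 0 r ×ˢ Istar 0 r, f (parScale z₀ hρ z) =
      (ρ ^ 5)⁻¹ * ∫ z in Qstar z₀ (r * ρ), f z := by
  have he := (parScale z₀ hρ).measurableEmbedding
  rw [← preimage_parScale_Qstar z₀ hρ, ← he.setIntegral_map, map_parScale,
    Measure.restrict_smul, integral_smul_measure, ENNReal.toReal_ofReal (by positivity),
    smul_eq_mul]

theorem lintegral_space_scale (x₀ : E3) {ρ : ℝ} (hρ : 0 < ρ) {f : E3 → ℝ≥0∞} :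
    ∫⁻ x in Metric.ball 0 1, f (x₀ + ρ • x) =
      ENNReal.ofReal ((ρ ^ 3)⁻¹) * ∫⁻ x in Metric.ball x₀ ρ, f x := by
  have he : MeasurableEmbedding fun x : E3 => x₀ + ρ • x :=
    ((Homeomorph.smulOfNeZero ρ hρ.ne').trans (Homeomorph.addLeft x₀)).measurableEmbedding
  have hp : (fun x : E3 => x₀ + ρ • x) ⁻¹' Metric.ball x₀ ρ = Metric.ball 0 1 := by
    ext x
    simp only [mem_preimage, Metric.mem_ball, dist_eq_norm, add_sub_cancel_left, sub_zero,
      norm_smul, Real.norm_eq_abs, abs_of_pos hρ]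
    exact mul_lt_iff_lt_one_right hρ
  rw [← hp, ← he.lintegral_map, ← he.restrict_map, map_space_scale x₀ hρ,
    Measure.restrict_smul, lintegral_smul_measure, smul_eq_mul]

theorem ae_time_scale (t₀ : ℝ) {ρ : ℝ} (hρ : 0 < ρ) {P : ℝ → Prop}
    (h : ∀ᵐ t ∂volume.restrict (Istar t₀ ρ), P t) :
    ∀ᵐ s ∂volume.restrict (Istar 0 1), P (t₀ + ρ ^ 2 * s) := by
  have hρ2 : 0 < ρ ^ 2 := by positivity
  have hq : Measure.QuasiMeasurePreserving (fun s : ℝ => t₀ + ρ ^ 2 * s) volume volume :=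
    ⟨by fun_prop, by
      rw [map_time_scale t₀ hρ]
      exact Measure.smul_absolutelyContinuous⟩
  rw [Istar, ae_restrict_iff' measurableSet_Ioo] at h ⊢
  filter_upwards [hq.ae h] with s hs hs'
  refine hs ⟨?_, ?_⟩
  · nlinarith [hs'.1]
  · nlinarith [hs'.2]

theorem sderiv_comp_parScale (z₀ : SpT) {ρ : ℝ} (hρ : 0 < ρ) {ψ : SpT → ℝ}
    (hψ : Differentiable ℝ ψ) (j : Fin 3) (z : SpT) :
    sderiv j (fun z => ψ (parScale z₀ hρ z)) z = ρ * sderiv j ψ (parScale z₀ hρ z) := by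
  have hS : HasFDerivAt (parScale z₀ hρ) ((ρ • ContinuousLinearMap.fst ℝ E3 ℝ).prod
      (ρ ^ 2 • ContinuousLinearMap.snd ℝ E3 ℝ)) z :=
    ((hasFDerivAt_fst.const_smul ρ).const_add z₀.1).prodMk
      ((hasFDerivAt_snd.const_smul (ρ ^ 2)).const_add z₀.2)
  have h := ((hψ (parScale z₀ hρ z)).hasFDerivAt.comp z hS).fderiv
  have he : ((ρ • (EuclideanSpace.single j 1 : E3), (0 : ℝ)) : SpT) =
      ρ • ((EuclideanSpace.single j 1 : E3), (0 : ℝ)) := by simp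
  unfold sderiv
  change fderiv ℝ (ψ ∘ parScale z₀ hρ) z _ = _
  rw [h, ContinuousLinearMap.comp_apply]
  simp only [ContinuousLinearMap.prod_apply, _root_.smul_apply,
    ContinuousLinearMap.coe_fst', ContinuousLinearMap.coe_snd', smul_zero]
  rw [he, map_smul, smul_eq_mul]

theorem sLap_comp_parScale (z₀ : SpT) {ρ : ℝ} (hρ : 0 < ρ) {ψ : SpT → ℝ}
    (hψ : ContDiff ℝ (⊤ : ℕ∞) ψ) (z : SpT) :
    sLap (fun z => ψ (parScale z₀ hρ z)) z = ρ ^ 2 * sLap ψ (parScale z₀ hρ z) := by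
  have hd : ∀ j, Differentiable ℝ (sderiv j ψ) := fun j =>
    (contDiff_sderiv hψ j).differentiable (by simp)
  have h1 : ∀ j, sderiv j (fun z => ψ (parScale z₀ hρ z)) =
      fun z => (fun w => ρ * sderiv j ψ w) (parScale z₀ hρ z) := fun j =>
    funext fun z => sderiv_comp_parScale z₀ hρ (hψ.differentiable (by simp)) j z
  unfold sLap
  rw [Finset.mul_sum]
  refine Finset.sum_congr rfl fun j _ => ?_
  rw [h1, sderiv_comp_parScale z₀ hρ ((hd j).const_mul ρ)]
  have h2 : sderiv j (fun w => ρ * sderiv j ψ w) (parScale z₀ hρ z) =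
      ρ * sderiv j (sderiv j ψ) (parScale z₀ hρ z) := by
    rw [sderiv, fderiv_const_mul (hd j _)]
    rfl
  rw [h2]
  ring

theorem IsTestOn.comp_parScale_symm {z₀ : SpT} {ρ : ℝ} (hρ : 0 < ρ) {ψ : SpT → ℝ}
    (h : IsTestOn (Metric.ball 0 1 ×ˢ Istar 0 1) ψ) :
    IsTestOn (Qstar z₀ ρ) (ψ ∘ (parScale z₀ hρ).symm) := by
  refine ⟨h.1.comp ?_, h.2.1.comp_homeomorph _, ?_⟩
  · change ContDiff ℝ _ fun z : SpT => (ρ⁻¹ • (z.1 - z₀.1), (ρ ^ 2)⁻¹ * (z.2 - z₀.2))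
    fun_prop
  · rw [tsupport_comp_eq_preimage]
    refine (preimage_mono h.2.2).trans ?_
    rw [← preimage_parScale_Qstar z₀ hρ 1, one_mul, ← preimage_comp]
    simp

theorem interpolated_bound_le {A B C D δ : ℝ≥0∞} (hδ0 : δ ≠ 0) (hδ1 : δ ≤ 1) :
    δ ^ (-2 : ℝ) * (δ ^ (13 / 6 : ℝ) * (A ^ (1 / 2 : ℝ) * D ^ (2 / 3 : ℝ)) +
      A ^ (1 / 4 : ℝ) * (C ^ (1 / 2 : ℝ) * B ^ (1 / 2 : ℝ))) ≤
    δ ^ (1 / 12 : ℝ) * (A + D ^ (4 / 3 : ℝ) + C ^ (2 / 3 : ℝ)) +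
      δ ^ (-10 : ℝ) * A * (B ^ (1 / 2 : ℝ) + B ^ (2 : ℝ)) := by
  have hδt : δ ≠ ∞ := ne_top_of_le_ne_top ENNReal.one_ne_top hδ1
  have t1 : δ ^ (-2 : ℝ) * (δ ^ (13 / 6 : ℝ) * (A ^ (1 / 2 : ℝ) * D ^ (2 / 3 : ℝ))) ≤
      δ ^ (1 / 12 : ℝ) * (A + D ^ (4 / 3 : ℝ)) := by
    have h1 : δ ^ (-2 : ℝ) * δ ^ (13 / 6 : ℝ) ≤ δ ^ (1 / 12 : ℝ) := by
      rw [← ENNReal.rpow_add _ _ hδ0 hδt]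
      exact ENNReal.rpow_le_rpow_of_exponent_ge hδ1 (by norm_num)
    have hA : (A ^ (1 / 2 : ℝ)) ^ 2 = A := by
      rw [← ENNReal.rpow_natCast, ← ENNReal.rpow_mul]; norm_num
    have hD : (D ^ (2 / 3 : ℝ)) ^ 2 = D ^ (4 / 3 : ℝ) := by
      rw [← ENNReal.rpow_natCast, ← ENNReal.rpow_mul]; norm_num
    have h2 : A ^ (1 / 2 : ℝ) * D ^ (2 / 3 : ℝ) ≤ A + D ^ (4 / 3 : ℝ) := by
      rw [← hD]
      nth_rewrite 2 [← hA]
      rcases le_total (A ^ (1 / 2 : ℝ)) (D ^ (2 / 3 : ℝ)) with h | h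
      · rw [sq (D ^ (2 / 3 : ℝ))]
        exact (mul_le_mul_left h _).trans le_add_self
      · rw [sq (A ^ (1 / 2 : ℝ))]
        exact (mul_le_mul_right h _).trans le_self_add
    rw [← mul_assoc]
    exact mul_le_mul' h1 h2
  have t2 : δ ^ (-2 : ℝ) * (A ^ (1 / 4 : ℝ) * (C ^ (1 / 2 : ℝ) * B ^ (1 / 2 : ℝ))) ≤
      δ ^ (1 / 12 : ℝ) * C ^ (2 / 3 : ℝ) + δ ^ (-10 : ℝ) * A * B ^ (2 : ℝ) := by
    set X := δ ^ (1 / 12 : ℝ) * C ^ (2 / 3 : ℝ) with hX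
    set Y := δ ^ (-33 / 4 : ℝ) * A * B ^ (2 : ℝ) with hY
    have h1 : δ ^ (-2 : ℝ) * (A ^ (1 / 4 : ℝ) * (C ^ (1 / 2 : ℝ) * B ^ (1 / 2 : ℝ))) =
        X ^ (3 / 4 : ℝ) * Y ^ (1 / 4 : ℝ) := by
      have hd : δ ^ (1 / 16 : ℝ) * δ ^ (-33 / 16 : ℝ) = δ ^ (-2 : ℝ) := by
        rw [← ENNReal.rpow_add _ _ hδ0 hδt]; norm_num
      simp only [hX, hY, ENNReal.mul_rpow_of_nonneg _ _ (by norm_num : (0 : ℝ) ≤ 3 / 4),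
        ENNReal.mul_rpow_of_nonneg _ _ (by norm_num : (0 : ℝ) ≤ 1 / 4), ← ENNReal.rpow_mul]
      rw [← hd]
      norm_num only
      ring
    have h2 : X ^ (3 / 4 : ℝ) * Y ^ (1 / 4 : ℝ) ≤ X + Y := by
      have h3 : max X Y ^ (3 / 4 : ℝ) * max X Y ^ (1 / 4 : ℝ) = max X Y := by
        rw [← ENNReal.rpow_add_of_nonneg _ _ (by norm_num) (by norm_num)]; norm_num
      calc X ^ (3 / 4 : ℝ) * Y ^ (1 / 4 : ℝ)
          ≤ max X Y ^ (3 / 4 : ℝ) * max X Y ^ (1 / 4 : ℝ) := by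
            gcongr
            · exact le_max_left _ _
            · exact le_max_right _ _
        _ = max X Y := h3
        _ ≤ X + Y := max_le le_self_add le_add_self
    have h3 : δ ^ (-33 / 4 : ℝ) ≤ δ ^ (-10 : ℝ) :=
      ENNReal.rpow_le_rpow_of_exponent_ge hδ1 (by norm_num)
    rw [h1]
    refine h2.trans ?_
    rw [hY]
    gcongr
  calc _ ≤ δ ^ (1 / 12 : ℝ) * (A + D ^ (4 / 3 : ℝ)) +
      (δ ^ (1 / 12 : ℝ) * C ^ (2 / 3 : ℝ) + δ ^ (-10 : ℝ) * A * B ^ (2 : ℝ)) := by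
        rw [mul_add (δ ^ (-2 : ℝ))]
        exact add_le_add t1 t2
    _ = δ ^ (1 / 12 : ℝ) * (A + D ^ (4 / 3 : ℝ) + C ^ (2 / 3 : ℝ)) +
      δ ^ (-10 : ℝ) * A * B ^ (2 : ℝ) := by ring
    _ ≤ _ := by
        gcongr
        exact le_add_self

theorem lintegral_parScale_of_eq_mul (z₀ : SpT) {ρ : ℝ} (hρ : 0 < ρ) (r : ℝ) {c : ℝ} (hc : 0 ≤ c)
    {f g : SpT → ℝ≥0∞} (h : ∀ z, g z = ENNReal.ofReal c * f (parScale z₀ hρ z)) :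
    ∫⁻ z in Metric.ball 0 r ×ˢ Istar 0 r, g z =
      ENNReal.ofReal (c * (ρ ^ 5)⁻¹) * ∫⁻ z in Qstar z₀ (r * ρ), f z := by
  simp only [h]
  rw [lintegral_const_mul' _ _ ENNReal.ofReal_ne_top, lintegral_parScale, ← mul_assoc,
    ← ENNReal.ofReal_mul hc]

theorem measurable_sizeU {u : SpT → E3} {Dd : SpT → Fin 3 → Fin 3 → ℝ} (hu : Measurable u)
    (hDd : Measurable Dd) : Measurable (sizeU u Dd) := by
  unfold sizeU nsq2
  fun_prop

theorem measurable_sizeV {Du : SpT → Fin 3 → Fin 3 → ℝ} {D2d : SpT → Fin 3 → Fin 3 → Fin 3 → ℝ}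
    (hDu : Measurable Du) (hD2d : Measurable D2d) : Measurable (sizeV Du D2d) := by
  unfold sizeV nsq2 nsq3
  fun_prop

theorem sizeU_nonneg (u : SpT → E3) (Dd : SpT → Fin 3 → Fin 3 → ℝ) (z : SpT) :
    0 ≤ sizeU u Dd z := Real.sqrt_nonneg _

theorem sizeV_nonneg (Du : SpT → Fin 3 → Fin 3 → ℝ) (D2d : SpT → Fin 3 → Fin 3 → Fin 3 → ℝ)
    (z : SpT) : 0 ≤ sizeV Du D2d z := Real.sqrt_nonneg _

theorem sizeU_pow_three_le (u : SpT → E3) (Dd : SpT → Fin 3 → Fin 3 → ℝ) (z : SpT) :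
    sizeU u Dd z ^ 3 ≤ 4 * (‖u z‖ ^ 3 + √(nsq2 (Dd z)) ^ 3) := by
  have h0 := norm_nonneg (u z)
  have h1 := Real.sqrt_nonneg (nsq2 (Dd z))
  have h : sizeU u Dd z ≤ ‖u z‖ + √(nsq2 (Dd z)) := by
    refine Real.sqrt_le_iff.2 ⟨add_nonneg h0 h1, ?_⟩
    nlinarith [Real.sq_sqrt (nsq2_nonneg (Dd z)), mul_nonneg h0 h1]
  refine (pow_le_pow_left₀ (sizeU_nonneg u Dd z) h 3).trans ?_
  nlinarith [mul_nonneg (add_nonneg h0 h1) (sq_nonneg (‖u z‖ - √(nsq2 (Dd z))))]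

theorem volume_Istar_zero {γ : ℝ} (hγ : 0 ≤ γ) : volume (Istar 0 γ) = ENNReal.ofReal γ ^ 2 := by
  rw [Istar, Real.volume_Ioo, ← ENNReal.ofReal_pow hγ]
  congr 1
  ring

theorem tested_pressure_parScale (z₀ : SpT) {ρ : ℝ} (hρ : 0 < ρ) {p U V : SpT → ℝ}
    (h : ∀ ψ, IsTestOn (Qstar z₀ ρ) ψ → ‖∫ z in Qstar z₀ ρ, p z * sLap ψ z‖ₑ ≤
      ∫⁻ z in Qstar z₀ ρ, ENNReal.ofReal (24 * (U z * V z * ∑ j, |sderiv j ψ z|)))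
    {ψ : SpT → ℝ} (hψ : IsTestOn (Metric.ball 0 1 ×ˢ Istar 0 1) ψ) :
    ‖∫ z in Metric.ball 0 1 ×ˢ Istar 0 1, ρ ^ 2 * p (parScale z₀ hρ z) * sLap ψ z‖ₑ ≤
      ∫⁻ z in Metric.ball 0 1 ×ˢ Istar 0 1, ENNReal.ofReal (24 * (ρ * U (parScale z₀ hρ z) *
        (ρ ^ 2 * V (parScale z₀ hρ z))) * ∑ j, |sderiv j ψ z|) := by
  set Ψ := ψ ∘ (parScale z₀ hρ).symm with hΨ
  have hT : IsTestOn (Qstar z₀ ρ) Ψ := hψ.comp_parScale_symm hρ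
  have hψΨ : ψ = fun z => Ψ (parScale z₀ hρ z) := by
    funext z; simp [hΨ]
  have e1 : ∀ z, sLap ψ z = ρ ^ 2 * sLap Ψ (parScale z₀ hρ z) := fun z => by
    rw [hψΨ]; exact sLap_comp_parScale z₀ hρ hT.1 z
  have e2 : ∀ j z, sderiv j ψ z = ρ * sderiv j Ψ (parScale z₀ hρ z) := fun j z => by
    rw [hψΨ]; exact sderiv_comp_parScale z₀ hρ hT.differentiable j z
  have e3 := integral_parScale z₀ hρ 1 fun w => ρ ^ 4 * (p w * sLap Ψ w)
  rw [integral_const_mul (ρ ^ 4) (fun z => p z * sLap Ψ z), one_mul] at e3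
  have e4 : ∫ z in Metric.ball 0 1 ×ˢ Istar 0 1, ρ ^ 2 * p (parScale z₀ hρ z) * sLap ψ z =
      ((ρ ^ 5)⁻¹ * ρ ^ 4) * ∫ z in Qstar z₀ ρ, p z * sLap Ψ z := by
    rw [mul_assoc, ← e3]
    congr 1
    funext z
    rw [e1]
    ring
  have e5 := lintegral_parScale_of_eq_mul z₀ hρ 1 (c := ρ ^ 4) (by positivity)
    (f := fun z => ENNReal.ofReal (24 * (U z * V z * ∑ j, |sderiv j Ψ z|)))
    (g := fun z => ENNReal.ofReal (24 * (ρ * U (parScale z₀ hρ z) *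
        (ρ ^ 2 * V (parScale z₀ hρ z))) * ∑ j, |sderiv j ψ z|)) (fun z => by
      rw [← ENNReal.ofReal_mul (by positivity)]
      simp only [e2, abs_mul, abs_of_pos hρ, ← Finset.mul_sum]
      congr 1
      ring)
  rw [e4, e5, one_mul, enorm_mul, Real.enorm_eq_ofReal (by positivity), mul_comm ((ρ ^ 5)⁻¹)]
  exact mul_le_mul_right (h Ψ hT) _

theorem lintegral_Qstar_sizeU_sq_lt_top {u : SpT → E3} {Dd : SpT → Fin 3 → Fin 3 → ℝ}
    (hu : Measurable u) (hDd : Measurable Dd) {z₀ : SpT} {ρ : ℝ}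
    (hA : AQ u Dd z₀ ρ ≠ ∞) :
    ∫⁻ z in Qstar z₀ ρ, ENNReal.ofReal (sizeU u Dd z ^ 2) < ∞ := by
  have hm : Measurable fun z => ENNReal.ofReal (sizeU u Dd z ^ 2) :=
    ((measurable_sizeU hu hDd).pow_const 2).ennreal_ofReal
  set E := essSup (fun t => ∫⁻ x in ball3 z₀.1 ρ, ENNReal.ofReal (‖u (x, t)‖ ^ 2 + nsq2 (Dd (x, t))))
      (volume.restrict (Istar z₀.2 ρ)) with hE
  have hEt : E ≠ ∞ := by
    intro h
    refine hA ?_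
    rw [AQ, ← hE, h]
    exact ENNReal.mul_top (ENNReal.inv_ne_zero.2 ENNReal.ofReal_ne_top)
  have hs := ENNReal.ae_le_essSup (μ := volume.restrict (Istar z₀.2 ρ)) fun t =>
    ∫⁻ x in ball3 z₀.1 ρ, ENNReal.ofReal (‖u (x, t)‖ ^ 2 + nsq2 (Dd (x, t)))
  have hQ : (volume : Measure SpT).restrict (Qstar z₀ ρ) =
      ((volume : Measure E3).restrict (ball3 z₀.1 ρ)).prod (volume.restrict (Istar z₀.2 ρ)) := by
    rw [Measure.volume_eq_prod, Measure.prod_restrict]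
    rfl
  rw [hQ, lintegral_prod_symm _ hm.aemeasurable]
  simp only [sizeU_sq]
  refine (lintegral_mono_ae hs).trans_lt ?_
  rw [lintegral_const, Measure.restrict_apply_univ]
  exact ENNReal.mul_lt_top hEt.lt_top measure_Ioo_lt_top

theorem ae_lintegral_parScale_sizeU_sq_le (u : SpT → E3) (Dd : SpT → Fin 3 → Fin 3 → ℝ)
    (z₀ : SpT) {ρ : ℝ} (hρ : 0 < ρ) :
    ∀ᵐ s ∂volume.restrict (Istar 0 1), ∫⁻ x in Metric.ball 0 1,
      ENNReal.ofReal ((ρ * sizeU u Dd (parScale z₀ hρ (x, s))) ^ 2) ≤ AQ u Dd z₀ ρ := by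
  have hs := ENNReal.ae_le_essSup (μ := volume.restrict (Istar z₀.2 ρ)) fun t =>
    ∫⁻ x in ball3 z₀.1 ρ, ENNReal.ofReal (‖u (x, t)‖ ^ 2 + nsq2 (Dd (x, t)))
  filter_upwards [ae_time_scale z₀.2 hρ hs] with s hs'
  have h1 : ∫⁻ x in Metric.ball 0 1, ENNReal.ofReal ((ρ * sizeU u Dd (parScale z₀ hρ (x, s))) ^ 2) =
      ENNReal.ofReal ρ⁻¹ * ∫⁻ x in ball3 z₀.1 ρ, ENNReal.ofReal
        (‖u (x, z₀.2 + ρ ^ 2 * s)‖ ^ 2 + nsq2 (Dd (x, z₀.2 + ρ ^ 2 * s))) := by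
    simp only [mul_pow, ENNReal.ofReal_mul (sq_nonneg ρ), sizeU_sq, parScale_apply]
    rw [lintegral_const_mul' _ _ ENNReal.ofReal_ne_top, lintegral_space_scale z₀.1 hρ (f := fun x =>
      ENNReal.ofReal (‖u (x, z₀.2 + ρ ^ 2 * s)‖ ^ 2 + nsq2 (Dd (x, z₀.2 + ρ ^ 2 * s)))),
      ← mul_assoc, ← ENNReal.ofReal_mul (sq_nonneg ρ)]
    congr 2
    field_simp
  rw [h1, AQ, ENNReal.ofReal_inv_of_pos hρ]
  exact mul_le_mul_right hs' _

end

/-- There is a universal constant `c₄ > 0` such that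
`F(γρ) ≤ c₄ (γ^{1/12} (A(ρ) + D(ρ)^{4/3} + C(ρ)^{2/3}) + γ^{-10} A(ρ)(B(ρ)^{1/2} + B(ρ)²))`. -/
theorem stmt14 :
    ∃ c₄ : ℝ, 0 < c₄ ∧
      ∀ (Ω : Set E3), IsOpen Ω → ∀ T : ℝ, 0 < T →
      ∀ (u d : SpT → E3) (p : SpT → ℝ) (Du Dd : SpT → Fin 3 → Fin 3 → ℝ)
        (D2d : SpT → Fin 3 → Fin 3 → Fin 3 → ℝ),
      StdReg Ω T u d p Du Dd D2d →
      PressureEqOn (Ω ×ˢ Ioo 0 T) u p Dd →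
      ∀ (z₀ : SpT) (ρ : ℝ), 0 < ρ → Qstar z₀ ρ ⊆ Ω ×ˢ Ioo 0 T →
      ∀ γ : ℝ, γ ∈ Ioc (0 : ℝ) (1 / 2) →
      FQ u p z₀ (γ * ρ) ≤ ENNReal.ofReal c₄ *
        (ENNReal.ofReal (γ ^ ((1 : ℝ) / 12)) * (AQ u Dd z₀ ρ +
            DQ p z₀ ρ ^ ((4 : ℝ) / 3) + CQ u Dd z₀ ρ ^ ((2 : ℝ) / 3)) +
         ENNReal.ofReal (γ ^ (-10 : ℝ)) * AQ u Dd z₀ ρ *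
           (BQ Du D2d z₀ ρ ^ ((1 : ℝ) / 2) + BQ Du D2d z₀ ρ ^ (2 : ℝ))) := by
  obtain ⟨K, hK, H⟩ := exists_unit_cylinder_estimate
  refine ⟨(4 * K).toReal + 1, by positivity, ?_⟩
  intro Ω hΩ T hT u d p Du Dd D2d hreg hpress z₀ ρ hρ hQ γ hγ
  obtain ⟨hγ0, hγ2⟩ := hγ
  have hc : 4 * K ≤ ENNReal.ofReal ((4 * K).toReal + 1) := by
    rw [ENNReal.le_ofReal_iff_toReal_le (ENNReal.mul_ne_top (by norm_num) hK) (by positivity)]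
    linarith
  rcases eq_or_ne (AQ u Dd z₀ ρ) ∞ with hA | hA
  · have h1 : ENNReal.ofReal (γ ^ ((1 : ℝ) / 12)) ≠ 0 :=
      (ENNReal.ofReal_pos.2 (Real.rpow_pos_of_pos hγ0 _)).ne'
    have h2 : ENNReal.ofReal ((4 * K).toReal + 1) ≠ 0 :=
      (ENNReal.ofReal_pos.2 (by positivity)).ne'
    rw [hA, top_add, top_add, ENNReal.mul_top h1, top_add, ENNReal.mul_top h2]
    exact le_top
  set U := sizeU u Dd with hU
  set V := sizeV Du D2d with hV
  have mU : Measurable U := measurable_sizeU hreg.meas_u hreg.meas_Dd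
  have mV : Measurable V := measurable_sizeV hreg.meas_Du hreg.meas_D2d
  have mS : Measurable (parScale z₀ hρ) := (parScale z₀ hρ).continuous.measurable
  have eB : ∫⁻ z in Metric.ball 0 1 ×ˢ Istar 0 1,
      ENNReal.ofReal ((ρ ^ 2 * V (parScale z₀ hρ z)) ^ 2) = BQ Du D2d z₀ ρ := by
    rw [lintegral_parScale_of_eq_mul z₀ hρ 1 (c := ρ ^ 4) (by positivity)
      (f := fun z => ENNReal.ofReal (nsq2 (Du z) + nsq3 (D2d z))), BQ, one_mul,
      ← ENNReal.ofReal_inv_of_pos hρ]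
    · congr 2
      field_simp
    · intro z
      rw [← ENNReal.ofReal_mul (by positivity), ← sizeV_sq, ← hV]
      congr 1
      ring
  have eD : ∫⁻ z in Metric.ball 0 1 ×ˢ Istar 0 1,
      ENNReal.ofReal (|ρ ^ 2 * p (parScale z₀ hρ z)| ^ (3 / 2 : ℝ)) = DQ p z₀ ρ := by
    rw [lintegral_parScale_of_eq_mul z₀ hρ 1 (c := ρ ^ 3) (by positivity)
      (f := fun z => ENNReal.ofReal (|p z| ^ (3 / 2 : ℝ))), DQ, one_mul,
      ← ENNReal.ofReal_inv_of_pos (by positivity)]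
    · congr 2
      field_simp
    · intro z
      rw [← ENNReal.ofReal_mul (by positivity), abs_mul, Real.mul_rpow (by positivity)
        (by positivity), abs_of_pos (by positivity : 0 < ρ ^ 2), ← Real.rpow_natCast ρ 2,
        ← Real.rpow_mul hρ.le, ← Real.rpow_natCast ρ 3]
      norm_num
  have eC : ∫⁻ z in Metric.ball 0 1 ×ˢ Istar 0 1,
      ENNReal.ofReal ((ρ * U (parScale z₀ hρ z)) ^ 3) ≤ 4 * CQ u Dd z₀ ρ := by
    rw [lintegral_parScale_of_eq_mul z₀ hρ 1 (c := ρ ^ 3) (by positivity)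
      (f := fun z => ENNReal.ofReal (U z ^ 3)) (fun z => by
        rw [← ENNReal.ofReal_mul (by positivity), mul_pow]), CQ, one_mul,
      ← ENNReal.ofReal_inv_of_pos (by positivity), mul_left_comm,
      ← lintegral_const_mul' (4 : ℝ≥0∞) _ (by norm_num)]
    have h1 : ρ ^ 3 * (ρ ^ 5)⁻¹ = (ρ ^ 2)⁻¹ := by field_simp
    rw [h1]
    refine mul_le_mul_right (lintegral_mono fun z => ?_) _
    rw [← ENNReal.ofReal_ofNat 4, ← ENNReal.ofReal_mul (by norm_num)]
    exact ENNReal.ofReal_le_ofReal (sizeU_pow_three_le u Dd z)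
  have hVt : ∫⁻ z in Qstar z₀ ρ, ENNReal.ofReal (V z ^ 2) < ∞ := by
    simp only [hV, sizeV_sq]
    exact (hasFiniteIntegral_iff_ofReal (Eventually.of_forall fun z =>
      add_nonneg (nsq2_nonneg _) (nsq3_nonneg _))).1
        ((hreg.l2_Du.add hreg.l2_D2d).mono_set hQ).2
  have hBt : BQ Du D2d z₀ ρ ≠ ∞ := by
    simp only [hV, sizeV_sq] at hVt
    exact ENNReal.mul_ne_top (ENNReal.inv_ne_top.2 (ENNReal.ofReal_pos.2 hρ).ne') hVt.ne
  have hDt : DQ p z₀ ρ ≠ ∞ := by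
    refine ENNReal.mul_ne_top (ENNReal.inv_ne_top.2 (ENNReal.ofReal_pos.2 (by positivity)).ne') ?_
    exact ((hasFiniteIntegral_iff_ofReal (Eventually.of_forall fun z => by positivity)).1
      (hreg.l32_p.mono_set hQ).2).ne
  have hQo : IsOpen (Qstar z₀ ρ) := Metric.isOpen_ball.prod isOpen_Ioo
  have hstar : ∀ ψ, IsTestOn (Qstar z₀ ρ) ψ → ‖∫ z in Qstar z₀ ρ, p z * sLap ψ z‖ₑ ≤
      ∫⁻ z in Qstar z₀ ρ, ENNReal.ofReal (24 * (U z * V z * ∑ j, |sderiv j ψ z|)) :=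
    fun ψ hψ => pressure_estimate hQo hQ hreg.meas_u hreg.meas_Du hreg.meas_Dd hreg.meas_D2d
      hreg.grad_u hreg.grad_Dd
      (lintegral_Qstar_sizeU_sq_lt_top hreg.meas_u hreg.meas_Dd hA) hVt hpress hψ
  have hI : Istar 0 γ ⊆ Istar 0 1 := by
    refine Ioo_subset_Ioo ?_ ?_ <;> nlinarith
  have key := H (Istar 0 1) (fun z => ρ ^ 2 * p (parScale z₀ hρ z))
    (fun z => ρ * U (parScale z₀ hρ z)) (fun z => ρ ^ 2 * V (parScale z₀ hρ z)) isOpen_Ioo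
    (by rw [volume_Istar_zero zero_le_one]; simp) ((hreg.meas_p.comp mS).const_mul _)
    ((mU.comp mS).const_mul _) ((mV.comp mS).const_mul _)
    (fun z => mul_nonneg hρ.le (sizeU_nonneg _ _ _))
    (fun z => mul_nonneg (sq_nonneg ρ) (sizeV_nonneg _ _ _))
    (fun ψ hψ => tested_pressure_parScale z₀ hρ hstar hψ) (AQ u Dd z₀ ρ) hA
    (ae_lintegral_parScale_sizeU_sq_le u Dd z₀ hρ) (by rwa [eB]) (by rwa [eD]) γ (Istar 0 γ)
    hγ0 hγ2 hI (volume_Istar_zero hγ0.le).le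
  rw [eB, eD, lintegral_parScale_of_eq_mul z₀ hρ γ (c := ρ ^ 3) (by positivity)
      (f := fun z => ENNReal.ofReal (U z * |p z|)) (fun z => by
        rw [← ENNReal.ofReal_mul (by positivity), abs_mul, abs_of_pos (by positivity : 0 < ρ ^ 2)]
        congr 1
        ring)] at key
  set δ := ENNReal.ofReal γ with hδ
  have hδ0 : δ ≠ 0 := (ENNReal.ofReal_pos.2 hγ0).ne'
  have hδ1 : δ ≤ 1 := by
    rw [hδ, ← ENNReal.ofReal_one]
    exact ENNReal.ofReal_le_ofReal (by linarith)
  have hF : FQ u p z₀ (γ * ρ) ≤ δ ^ (-2 : ℝ) * (ENNReal.ofReal (ρ ^ 3 * (ρ ^ 5)⁻¹) *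
      ∫⁻ z in Qstar z₀ (γ * ρ), ENNReal.ofReal (U z * |p z|)) := by
    rw [FQ, ← ENNReal.ofReal_inv_of_pos (by positivity), hδ, ENNReal.ofReal_rpow_of_pos hγ0,
      ← mul_assoc, ← ENNReal.ofReal_mul (by positivity)]
    have h1 : γ ^ (-2 : ℝ) * (ρ ^ 3 * (ρ ^ 5)⁻¹) = ((γ * ρ) ^ 2)⁻¹ := by
      rw [Real.rpow_neg hγ0.le, Real.rpow_two]
      field_simp
    rw [h1]
    refine mul_le_mul_right (lintegral_mono fun z => ENNReal.ofReal_le_ofReal ?_) _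
    exact mul_le_mul_of_nonneg_right (norm_le_sizeU u Dd z) (abs_nonneg _)
  rw [← ENNReal.ofReal_rpow_of_pos hγ0, ← ENNReal.ofReal_rpow_of_pos hγ0, ← hδ]
  have h4 : (4 * CQ u Dd z₀ ρ) ^ (1 / 2 : ℝ) ≤ 4 * CQ u Dd z₀ ρ ^ (1 / 2 : ℝ) := by
    rw [ENNReal.mul_rpow_of_nonneg _ _ (by norm_num)]
    gcongr
    exact (ENNReal.rpow_le_rpow_of_exponent_le (by norm_num) (by norm_num)).trans_eq
      (ENNReal.rpow_one 4)
  calc FQ u p z₀ (γ * ρ) ≤ δ ^ (-2 : ℝ) * (K * (δ ^ (13 / 6 : ℝ) * (AQ u Dd z₀ ρ ^ (1 / 2 : ℝ) *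
        DQ p z₀ ρ ^ (2 / 3 : ℝ)) + AQ u Dd z₀ ρ ^ (1 / 4 : ℝ) *
        ((4 * CQ u Dd z₀ ρ) ^ (1 / 2 : ℝ) * BQ Du D2d z₀ ρ ^ (1 / 2 : ℝ)))) := by
        refine hF.trans (mul_le_mul_right (key.trans ?_) _)
        gcongr
    _ ≤ δ ^ (-2 : ℝ) * (K * (4 * (δ ^ (13 / 6 : ℝ) * (AQ u Dd z₀ ρ ^ (1 / 2 : ℝ) *
        DQ p z₀ ρ ^ (2 / 3 : ℝ))) + AQ u Dd z₀ ρ ^ (1 / 4 : ℝ) *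
        (4 * CQ u Dd z₀ ρ ^ (1 / 2 : ℝ) * BQ Du D2d z₀ ρ ^ (1 / 2 : ℝ)))) := by
        refine mul_le_mul_right (mul_le_mul_right (add_le_add
          (le_mul_of_one_le_left' (by norm_num : (1 : ℝ≥0∞) ≤ 4)) ?_) _) _
        gcongr
    _ = 4 * K * (δ ^ (-2 : ℝ) * (δ ^ (13 / 6 : ℝ) * (AQ u Dd z₀ ρ ^ (1 / 2 : ℝ) *
        DQ p z₀ ρ ^ (2 / 3 : ℝ)) + AQ u Dd z₀ ρ ^ (1 / 4 : ℝ) *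
        (CQ u Dd z₀ ρ ^ (1 / 2 : ℝ) * BQ Du D2d z₀ ρ ^ (1 / 2 : ℝ)))) := by ring
    _ ≤ _ := mul_le_mul' hc (interpolated_bound_le hδ0 hδ1)
end
end

section
/- (Global energy identity for the liquid crystal system) Let T ∈ (0,∞), let u,d : ℝ³×(0,T) → ℝ³ and p : ℝ³×(0,T) → ℝ be C^∞, and suppose there is a compact set K ⊂ ℝ³ such that u(·,t) and d(·,t) are supported in K for every t ∈ (0,T). Suppose on ℝ³×(0,T) the system holds pointwise: ∂_t u_i − Δu_i + Σ_j ∂_j( u_i u_j + Σ_k ∂_i d_k ∂_j d_k ) + ∂_i p = 0 for i=1,2,3; Σ_i ∂_i u_i = 0; and ∂_t d − Δd + (u·∇)d + f(d) = 0, where f(x) := 4(|x|²−1)x. Then for every t ∈ (0,T), the function t ↦ ∫_{ℝ³} ( |u(x,t)|²/2 + |∇d(x,t)|²/2 + |d(x,t)|⁴ − 2|d(x,t)|² ) dx is differentiable, with derivative equal to −∫_{ℝ³} ( |∇u(x,t)|² + |Δd(x,t) − f(d(x,t))|² ) dx. -/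
open MeasureTheory Set Filter
open scoped ENNReal NNReal

noncomputable section

/-- `|∇v|² = Σ_{i,j} (∂_j v_i)²` for a smooth vector field, via classical derivatives. -/
def cNgrad (v : SpT → E3) (z : SpT) : ℝ :=
  ∑ i, ∑ j, (sderiv j (fun w => v w i) z) ^ 2

/-- `|∇²v|² = Σ_{i,j,k} (∂_j ∂_k v_i)²` for a smooth vector field. -/
def cNgrad2 (v : SpT → E3) (z : SpT) : ℝ :=
  ∑ i, ∑ j, ∑ k, (sderiv j (sderiv k (fun w => v w i)) z) ^ 2

/-- Smoothness of a scalar function on the slab `ℝ³ × (0,T)`. -/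
def SmoothOnSlab (T : ℝ) (f : SpT → ℝ) : Prop :=
  ContDiffOn ℝ (⊤ : ℕ∞) f ((univ : Set E3) ×ˢ Ioo 0 T)

/-- On the slab `ℝ³ × (0,T)`, the function `f` is supported in `K × (0,T)`. -/
def VanishesOff (K : Set E3) (T : ℝ) (f : SpT → ℝ) : Prop :=
  ∀ t ∈ Ioo (0 : ℝ) T, ∀ x : E3, x ∉ K → f (x, t) = 0

lemma isOpen_slab (T : ℝ) : IsOpen ((univ : Set E3) ×ˢ Ioo 0 T) :=
  isOpen_univ.prod isOpen_Ioo

namespace SmoothOnSlab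

variable {T : ℝ} {f : SpT → ℝ} {z : SpT}

lemma contDiffAt (hf : SmoothOnSlab T f) (hz : z.2 ∈ Ioo 0 T) :
    ContDiffAt ℝ (⊤ : ℕ∞) f z :=
  ContDiffOn.contDiffAt hf ((isOpen_slab T).mem_nhds ⟨mem_univ _, hz⟩)

lemma differentiableAt (hf : SmoothOnSlab T f) (hz : z.2 ∈ Ioo 0 T) :
    DifferentiableAt ℝ f z :=
  (hf.contDiffAt hz).differentiableAt (by simp)

lemma hasFDerivAt (hf : SmoothOnSlab T f) (hz : z.2 ∈ Ioo 0 T) :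
    HasFDerivAt f (fderiv ℝ f z) z :=
  (hf.differentiableAt hz).hasFDerivAt

lemma fderiv_apply (hf : SmoothOnSlab T f) (v : SpT) :
    SmoothOnSlab T (fun z => fderiv ℝ f z v) :=
  (ContDiffOn.fderiv_of_isOpen hf (isOpen_slab T) (by simp)).clm_apply contDiffOn_const

lemma sderiv (hf : SmoothOnSlab T f) (j : Fin 3) : SmoothOnSlab T (sderiv j f) :=
  hf.fderiv_apply _

lemma tderiv (hf : SmoothOnSlab T f) : SmoothOnSlab T (tderiv f) :=
  hf.fderiv_apply _

lemma fderiv_fderiv_comm (hf : SmoothOnSlab T f) (hz : z.2 ∈ Ioo 0 T) (v w : SpT) :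
    fderiv ℝ (fun y => fderiv ℝ f y v) z w = fderiv ℝ (fun y => fderiv ℝ f y w) z v := by
  have hsymm : IsSymmSndFDerivAt ℝ f z :=
    (hf.contDiffAt hz).isSymmSndFDerivAt (by
      rw [minSmoothness_of_isRCLikeNormedField]
      exact WithTop.coe_le_coe.2 (le_top : (2 : ℕ∞) ≤ ⊤))
  have hd : DifferentiableAt ℝ (fderiv ℝ f) z :=
    ((ContDiffOn.fderiv_of_isOpen (m := (⊤ : ℕ∞)) hf (isOpen_slab T) (by simp)).contDiffAt
      ((isOpen_slab T).mem_nhds ⟨mem_univ _, hz⟩)).differentiableAt (by simp)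
  rw [fderiv_clm_apply hd (differentiableAt_const _),
    fderiv_clm_apply hd (differentiableAt_const _)]
  simpa using hsymm w v

lemma continuous_slice (hf : SmoothOnSlab T f) {t : ℝ} (ht : t ∈ Ioo 0 T) :
    Continuous fun x : E3 => f (x, t) :=
  (ContDiffOn.continuousOn hf).comp_continuous (by fun_prop) fun _ => ⟨mem_univ _, ht⟩

end SmoothOnSlab

section Integration

variable {T t : ℝ} {K : Set E3} {f : SpT → ℝ}

lemma VanishesOff.fderiv_apply (hK : IsCompact K) (hf : VanishesOff K T f) (v : SpT) :
    VanishesOff K T (fun z => fderiv ℝ f z v) := by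
  intro t ht x hx
  have h : f =ᶠ[nhds (x, t)] fun _ => 0 := by
    filter_upwards [(hK.isClosed.isOpen_compl.prod isOpen_Ioo).mem_nhds
      (show (x, t) ∈ Kᶜ ×ˢ Ioo 0 T from ⟨hx, ht⟩)] with y hy
    exact hf y.2 hy.2 y.1 hy.1
  simp [h.fderiv_eq]

lemma integrable_slice (hK : IsCompact K) (hf : SmoothOnSlab T f) (hf0 : VanishesOff K T f)
    (ht : t ∈ Ioo 0 T) : Integrable fun x : E3 => f (x, t) :=
  (hf.continuous_slice ht).integrable_of_hasCompactSupport
    (HasCompactSupport.intro hK fun x hx => hf0 t ht x hx)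

lemma integral_sderiv_eq_zero (hK : IsCompact K) (hf : SmoothOnSlab T f)
    (hf0 : VanishesOff K T f) (ht : t ∈ Ioo 0 T) (j : Fin 3) :
    ∫ x : E3, sderiv j f (x, t) = 0 := by
  have hderiv : ∀ x : E3, HasFDerivAt (fun y : E3 => f (y, t))
      ((fderiv ℝ f (x, t)).comp (ContinuousLinearMap.inl ℝ E3 ℝ)) x := fun x =>
    HasFDerivAt.comp x (hf.hasFDerivAt (z := (x, t)) ht) (hasFDerivAt_prodMk_left x t)
  have heq : ∀ x : E3, sderiv j f (x, t) =
      fderiv ℝ (fun y : E3 => f (y, t)) x (EuclideanSpace.single j 1) := fun x => by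
    rw [(hderiv x).fderiv]; rfl
  have hint := integrable_slice hK (hf.sderiv j) (hf0.fderiv_apply hK _) ht
  simp only [heq] at hint ⊢
  have := integral_mul_fderiv_eq_neg_fderiv_mul_of_integrable (μ := (volume : Measure E3))
    (f := fun _ => (1 : ℝ)) (g := fun y : E3 => f (y, t)) (v := EuclideanSpace.single j 1)
    (by simp) (by simpa using hint) (by simpa using integrable_slice hK hf hf0 ht)
    (fun x _ => differentiableAt_const _) (fun x _ => (hderiv x).differentiableAt)
  simpa using this

lemma hasDerivAt_integral_slice (hK : IsCompact K) (hf : SmoothOnSlab T f)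
    (hf0 : VanishesOff K T f) (ht : t ∈ Ioo 0 T) :
    HasDerivAt (fun s => ∫ x : E3, f (x, s)) (∫ x : E3, tderiv f (x, t)) t := by
  obtain ⟨a, b, htab, hab, hsub⟩ : ∃ a b, t ∈ Ioo a b ∧ Icc a b ∈ nhds t ∧
      Icc a b ⊆ Ioo 0 T := by
    refine ⟨t / 2, (t + T) / 2, ⟨by linarith [ht.1], by linarith [ht.2]⟩,
      Icc_mem_nhds (by linarith [ht.1]) (by linarith [ht.2]), fun s hs => ⟨?_, ?_⟩⟩
    · linarith [ht.1, hs.1]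
    · linarith [ht.2, hs.2]
  obtain ⟨C, hC⟩ := (hK.prod (isCompact_Icc (a := a) (b := b))).exists_bound_of_continuousOn
    ((ContDiffOn.continuousOn hf.tderiv).mono (prod_mono (subset_univ _) hsub))
  refine (hasDerivAt_integral_of_dominated_loc_of_deriv_le
    (F := fun s (x : E3) => f (x, s)) (F' := fun s x => tderiv f (x, s))
    (bound := K.indicator fun _ => C) hab ?_ (integrable_slice hK hf hf0 ht) ?_ ?_ ?_ ?_).2
  · filter_upwards [hab] with s hs
    exact (hf.continuous_slice (hsub hs)).aestronglyMeasurable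
  · exact (hf.tderiv.continuous_slice ht).aestronglyMeasurable
  · refine ae_of_all _ fun x s hs => ?_
    by_cases hx : x ∈ K
    · simpa [hx] using hC (x, s) ⟨hx, hs⟩
    · simp only [hx, not_false_eq_true, indicator_of_notMem, norm_le_zero_iff]
      exact hf0.fderiv_apply hK _ s (hsub hs) x hx
  · exact (integrable_indicator_iff hK.measurableSet).2
      (integrableOn_const hK.measure_lt_top.ne)
  · refine ae_of_all _ fun x s hs => ?_
    have hline : HasDerivAt (fun r : ℝ => ((x, r) : SpT)) ((0 : E3), (1 : ℝ)) s :=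
      (hasDerivAt_const s x).prodMk (hasDerivAt_id s)
    exact (hf.hasFDerivAt (z := (x, s)) (hsub hs)).comp_hasDerivAt s hline

end Integration

/-- The energy density `|u|²/2 + |∇d|²/2 + |d|⁴ - 2|d|²` in terms of the components. -/
def energyDensity (u d : Fin 3 → SpT → ℝ) (z : SpT) : ℝ :=
  (∑ i, u i z ^ 2) / 2 + (∑ i, ∑ j, sderiv j (d i) z ^ 2) / 2 +
    (∑ i, d i z ^ 2) ^ 2 - 2 * ∑ i, d i z ^ 2

/-- The flux whose divergence appears in the pointwise energy balance. -/
def energyFlux (u d : Fin 3 → SpT → ℝ) (p : SpT → ℝ) (j : Fin 3) (z : SpT) : ℝ :=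
  (∑ i, (u i z * sderiv j (u i) z + sderiv j (d i) z * tderiv (d i) z)) -
    u j z * (energyDensity u d z + p z)

section PointwiseBalance

variable {T : ℝ} {K : Set E3} {u d : Fin 3 → SpT → ℝ} {p : SpT → ℝ} {z : SpT}

lemma SmoothOnSlab.energyDensity (hu : ∀ i, SmoothOnSlab T (u i))
    (hd : ∀ i, SmoothOnSlab T (d i)) : SmoothOnSlab T (energyDensity u d) :=
  ((((ContDiffOn.sum fun i _ => (hu i).pow 2).div_const 2).add
    ((ContDiffOn.sum fun i _ => ContDiffOn.sum fun j _ =>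
      ((hd i).sderiv j).pow 2).div_const 2)).add
    ((ContDiffOn.sum fun i _ => (hd i).pow 2).pow 2)).sub
    (contDiffOn_const.mul (ContDiffOn.sum fun i _ => (hd i).pow 2))

lemma SmoothOnSlab.energyFlux (hu : ∀ i, SmoothOnSlab T (u i))
    (hd : ∀ i, SmoothOnSlab T (d i)) (hp : SmoothOnSlab T p) (j : Fin 3) :
    SmoothOnSlab T (energyFlux u d p j) :=
  (ContDiffOn.sum fun i _ =>
    (ContDiffOn.mul (hu i) ((hu i).sderiv j)).add
      (ContDiffOn.mul ((hd i).sderiv j) (hd i).tderiv)).sub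
    (ContDiffOn.mul (hu j) (ContDiffOn.add (SmoothOnSlab.energyDensity hu hd) hp))

lemma VanishesOff.energyDensity (hK : IsCompact K) (hu : ∀ i, VanishesOff K T (u i))
    (hd : ∀ i, VanishesOff K T (d i)) : VanishesOff K T (energyDensity u d) := by
  intro t ht x hx
  have hs : ∀ i j, sderiv j (d i) (x, t) = 0 := fun i j =>
    (hd i).fderiv_apply hK _ t ht x hx
  simp [_root_.energyDensity, hu _ t ht x hx, hd _ t ht x hx, hs]

lemma VanishesOff.energyFlux (hK : IsCompact K) (hu : ∀ i, VanishesOff K T (u i))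
    (hd : ∀ i, VanishesOff K T (d i)) (j : Fin 3) : VanishesOff K T (energyFlux u d p j) := by
  intro t ht x hx
  have hs : ∀ i, sderiv j (d i) (x, t) = 0 := fun i =>
    (hd i).fderiv_apply hK _ t ht x hx
  simp [_root_.energyFlux, hu _ t ht x hx, hs]

lemma fderiv_energyDensity (hu : ∀ i, SmoothOnSlab T (u i)) (hd : ∀ i, SmoothOnSlab T (d i))
    (hz : z.2 ∈ Ioo 0 T) (v : SpT) :
    fderiv ℝ (energyDensity u d) z v = (∑ i, u i z * fderiv ℝ (u i) z v) +
      (∑ i, ∑ j, sderiv j (d i) z * fderiv ℝ (sderiv j (d i)) z v) +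
      4 * ((∑ i, d i z ^ 2) - 1) * ∑ i, d i z * fderiv ℝ (d i) z v := by
  have hsq := HasFDerivAt.fun_sum (u := Finset.univ) fun i _ =>
    ((hd i).hasFDerivAt hz).pow 2
  have h := (((HasFDerivAt.fun_sum (u := Finset.univ) fun i _ =>
      ((hu i).hasFDerivAt hz).pow 2).mul_const (2 : ℝ)⁻¹).add
    ((HasFDerivAt.fun_sum (u := Finset.univ) fun i _ =>
      HasFDerivAt.fun_sum (u := Finset.univ) fun j _ =>
        (((hd i).sderiv j).hasFDerivAt hz).pow 2).mul_const (2 : ℝ)⁻¹)).add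
    (hsq.pow 2) |>.sub (hsq.const_mul 2)
  have he : fderiv ℝ (energyDensity u d) z = _ := HasFDerivAt.fderiv h
  rw [he]
  simp only [Fin.sum_univ_three, add_apply, sub_apply, smul_apply, smul_eq_mul,
    nsmul_eq_mul, Nat.cast_ofNat]
  ring

lemma sderiv_energyFlux (hu : ∀ i, SmoothOnSlab T (u i)) (hd : ∀ i, SmoothOnSlab T (d i))
    (hp : SmoothOnSlab T p) (hz : z.2 ∈ Ioo 0 T) (j : Fin 3) :
    sderiv j (energyFlux u d p j) z =
      (∑ i, (sderiv j (u i) z ^ 2 + u i z * sderiv j (sderiv j (u i)) z +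
        sderiv j (sderiv j (d i)) z * tderiv (d i) z +
        sderiv j (d i) z * tderiv (sderiv j (d i)) z)) -
      sderiv j (u j) z * (energyDensity u d z + p z) -
      u j z * (sderiv j (energyDensity u d) z + sderiv j p z) := by
  have hcomm : ∀ i, tderiv (sderiv j (d i)) z = sderiv j (tderiv (d i)) z := fun i =>
    (hd i).fderiv_fderiv_comm hz _ _
  have h := (HasFDerivAt.fun_sum (u := Finset.univ) fun i _ =>
      (((hu i).hasFDerivAt hz).mul (((hu i).sderiv j).hasFDerivAt hz)).add
        ((((hd i).sderiv j).hasFDerivAt hz).mul ((hd i).tderiv.hasFDerivAt hz))).sub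
    (((hu j).hasFDerivAt hz).mul
      (((SmoothOnSlab.energyDensity hu hd).hasFDerivAt hz).add (hp.hasFDerivAt hz)))
  have he : fderiv ℝ (energyFlux u d p j) z = _ := HasFDerivAt.fderiv h
  simp only [hcomm]
  rw [sderiv, he]
  simp only [Fin.sum_univ_three, add_apply, sub_apply, smul_apply, smul_eq_mul,
    Pi.add_apply, sderiv]
  ring

lemma sderiv_stress (hu : ∀ i, SmoothOnSlab T (u i)) (hd : ∀ i, SmoothOnSlab T (d i))
    (hz : z.2 ∈ Ioo 0 T) (i j : Fin 3) :
    sderiv j (fun w => u i w * u j w + ∑ k, sderiv i (d k) w * sderiv j (d k) w) z =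
      sderiv j (u i) z * u j z + u i z * sderiv j (u j) z +
      ∑ k, (sderiv j (sderiv i (d k)) z * sderiv j (d k) z +
        sderiv i (d k) z * sderiv j (sderiv j (d k)) z) := by
  have h := (((hu i).hasFDerivAt hz).mul ((hu j).hasFDerivAt hz)).add
    (HasFDerivAt.fun_sum (u := Finset.univ) fun k _ =>
      (((hd k).sderiv i).hasFDerivAt hz).mul (((hd k).sderiv j).hasFDerivAt hz))
  have he : fderiv ℝ (fun w => u i w * u j w + ∑ k, sderiv i (d k) w * sderiv j (d k) w) z = _ :=
    HasFDerivAt.fderiv h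
  rw [sderiv, he]
  simp only [Fin.sum_univ_three, add_apply, smul_apply, smul_eq_mul, sderiv]
  ring

/-- The algebraic identity behind the energy balance: `Du i j = ∂_j u_i`, `Lu i j = ∂_j² u_i`,
`Hd k i j = ∂_j ∂_i d_k`, `Dtd i j = ∂_t ∂_j d_i`, and `E` is arbitrary. -/
lemma energy_algebra (u ut d dt Dp : Fin 3 → ℝ) (Du Lu Dd Dtd : Fin 3 → Fin 3 → ℝ)
    (Hd : Fin 3 → Fin 3 → Fin 3 → ℝ) (E : ℝ) (hsymm : ∀ k i j, Hd k i j = Hd k j i)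
    (hmom : ∀ i, ut i - (∑ j, Lu i j) +
      (∑ j, (Du i j * u j + u i * Du j j +
        ∑ k, (Hd k i j * Dd k j + Dd k i * Hd k j j))) + Dp i = 0)
    (hdiv : ∑ i, Du i i = 0)
    (hdeq : ∀ i, dt i - (∑ j, Hd i j j) + (∑ j, u j * Dd i j) +
      4 * ((∑ k, d k ^ 2) - 1) * d i = 0) :
    (∑ i, u i * ut i) + (∑ i, ∑ j, Dd i j * Dtd i j) +
        4 * ((∑ k, d k ^ 2) - 1) * (∑ i, d i * dt i) =
      -((∑ i, ∑ j, Du i j ^ 2) +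
        ∑ i, ((∑ j, Hd i j j) - 4 * ((∑ k, d k ^ 2) - 1) * d i) ^ 2) +
      ∑ j, ((∑ i, (Du i j ^ 2 + u i * Lu i j + Hd i j j * dt i + Dd i j * Dtd i j)) -
        Du j j * E -
        u j * ((∑ i, u i * Du i j) + (∑ i, ∑ k, Dd i k * Hd i k j) +
          4 * ((∑ k, d k ^ 2) - 1) * (∑ i, d i * Dd i j) + Dp j)) := by
  obtain ⟨s, hs⟩ : ∃ s, s = 4 * ((∑ k, d k ^ 2) - 1) := ⟨_, rfl⟩
  simp only [← hs] at hdeq ⊢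
  have h10 := fun k => hsymm k 1 0
  have h20 := fun k => hsymm k 2 0
  have h21 := fun k => hsymm k 2 1
  have m0 := hmom 0
  have m1 := hmom 1
  have m2 := hmom 2
  have d0 := hdeq 0
  have d1 := hdeq 1
  have d2 := hdeq 2
  simp only [Fin.sum_univ_three, h10, h20, h21] at m0 m1 m2 d0 d1 d2 hdiv ⊢
  linear_combination u 0 * m0 + u 1 * m1 + u 2 * m2 +
    (s * d 0 - (Hd 0 0 0 + Hd 0 1 1 + Hd 0 2 2)) * d0 +
    (s * d 1 - (Hd 1 0 0 + Hd 1 1 1 + Hd 1 2 2)) * d1 +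
    (s * d 2 - (Hd 2 0 0 + Hd 2 1 1 + Hd 2 2 2)) * d2 +
    (E - (u 0 ^ 2 + u 1 ^ 2 + u 2 ^ 2)) * hdiv

lemma tderiv_energyDensity (hu : ∀ i, SmoothOnSlab T (u i)) (hd : ∀ i, SmoothOnSlab T (d i))
    (hp : SmoothOnSlab T p) (hz : z.2 ∈ Ioo 0 T)
    (hmom : ∀ i, tderiv (u i) z - (∑ j, sderiv j (sderiv j (u i)) z) +
      (∑ j, sderiv j (fun w => u i w * u j w + ∑ k, sderiv i (d k) w * sderiv j (d k) w) z) +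
      sderiv i p z = 0)
    (hdiv : ∑ i, sderiv i (u i) z = 0)
    (hdeq : ∀ i, tderiv (d i) z - (∑ j, sderiv j (sderiv j (d i)) z) +
      (∑ j, u j z * sderiv j (d i) z) + 4 * ((∑ k, d k z ^ 2) - 1) * d i z = 0) :
    tderiv (energyDensity u d) z =
      -((∑ i, ∑ j, sderiv j (u i) z ^ 2) +
        ∑ i, ((∑ j, sderiv j (sderiv j (d i)) z) - 4 * ((∑ k, d k z ^ 2) - 1) * d i z) ^ 2) +
      ∑ j, sderiv j (energyFlux u d p j) z := by
  simp only [sderiv_stress hu hd hz] at hmom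
  have hE : ∀ j, sderiv j (energyDensity u d) z = _ := fun j =>
    fderiv_energyDensity hu hd hz _
  simp only [sderiv_energyFlux hu hd hp hz, hE]
  exact (fderiv_energyDensity hu hd hz _).trans <|
    energy_algebra (fun i => u i z) (fun i => tderiv (u i) z) (fun i => d i z)
      (fun i => tderiv (d i) z) (fun i => sderiv i p z) (fun i j => sderiv j (u i) z)
      (fun i j => sderiv j (sderiv j (u i)) z) (fun i j => sderiv j (d i) z)
      (fun i j => tderiv (sderiv j (d i)) z) (fun k i j => sderiv j (sderiv i (d k)) z)
      (energyDensity u d z + p z) (fun k i j => (hd k).fderiv_fderiv_comm hz _ _)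
      hmom hdiv hdeq

end PointwiseBalance

/-- Global energy identity for smooth, compactly supported solutions of the
liquid crystal system on `ℝ³ × (0,T)`. -/
theorem stmt17 (T : ℝ) (hT : 0 < T)
    (u d : SpT → E3) (p : SpT → ℝ)
    (hu : ContDiffOn ℝ (⊤ : ℕ∞) u ((univ : Set E3) ×ˢ Ioo 0 T))
    (hd : ContDiffOn ℝ (⊤ : ℕ∞) d ((univ : Set E3) ×ˢ Ioo 0 T))
    (hp : ContDiffOn ℝ (⊤ : ℕ∞) p ((univ : Set E3) ×ˢ Ioo 0 T))
    (hsupp : ∃ K : Set E3, IsCompact K ∧ ∀ t ∈ Ioo (0 : ℝ) T, ∀ x : E3, x ∉ K →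
      u (x, t) = 0 ∧ d (x, t) = 0)
    (hmom : ∀ z : SpT, z.2 ∈ Ioo (0 : ℝ) T → ∀ i : Fin 3,
      tderiv (fun w => u w i) z - (∑ j, sderiv j (sderiv j (fun w => u w i)) z) +
        (∑ j, sderiv j (fun w => u w i * u w j +
          ∑ k, sderiv i (fun w' => d w' k) w * sderiv j (fun w' => d w' k) w) z) +
        sderiv i p z = 0)
    (hdiv : ∀ z : SpT, z.2 ∈ Ioo (0 : ℝ) T → ∑ i, sderiv i (fun w => u w i) z = 0)
    (hdeq : ∀ z : SpT, z.2 ∈ Ioo (0 : ℝ) T → ∀ i : Fin 3,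
      tderiv (fun w => d w i) z - (∑ j, sderiv j (sderiv j (fun w => d w i)) z) +
        (∑ j, u z j * sderiv j (fun w => d w i) z) +
        4 * (‖d z‖ ^ 2 - 1) * d z i = 0) :
    ∀ t ∈ Ioo (0 : ℝ) T,
      HasDerivAt (fun s => ∫ x, (‖u (x, s)‖ ^ 2 / 2 + cNgrad d (x, s) / 2 +
          ‖d (x, s)‖ ^ 4 - 2 * ‖d (x, s)‖ ^ 2))
        (-∫ x, (cNgrad u (x, t) +
          ∑ i, ((∑ j, sderiv j (sderiv j (fun w => d w i)) (x, t)) -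
            4 * (‖d (x, t)‖ ^ 2 - 1) * d (x, t) i) ^ 2)) t := by
  obtain ⟨K, hK, hsupp⟩ := hsupp
  have hu' : ∀ i, SmoothOnSlab T fun w => u w i := contDiffOn_euclidean.1 hu
  have hd' : ∀ i, SmoothOnSlab T fun w => d w i := contDiffOn_euclidean.1 hd
  have hu0 : ∀ i, VanishesOff K T fun w => u w i := fun i t ht x hx => by
    simp [(hsupp t ht x hx).1]
  have hd0 : ∀ i, VanishesOff K T fun w => d w i := fun i t ht x hx => by
    simp [(hsupp t ht x hx).2]
  have hbalance := fun (t : ℝ) (ht : t ∈ Ioo 0 T) (x : E3) =>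
    tderiv_energyDensity (z := (x, t)) hu' hd' hp ht (hmom _ ht) (hdiv _ ht)
      (by simpa only [EuclideanSpace.real_norm_sq_eq] using hdeq (x, t) ht)
  intro t ht
  have hdens := SmoothOnSlab.energyDensity hu' hd'
  have hdens0 := VanishesOff.energyDensity hK hu0 hd0
  have hflux := SmoothOnSlab.energyFlux hu' hd' hp
  have hflux0 := VanishesOff.energyFlux (p := p) hK hu0 hd0
  have hflux_int := fun j =>
    integrable_slice hK ((hflux j).sderiv j) ((hflux0 j).fderiv_apply hK _) ht
  convert hasDerivAt_integral_slice hK hdens hdens0 ht using 1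
  · funext s
    refine integral_congr_ae (ae_of_all _ fun x => ?_)
    simp only [energyDensity, cNgrad, show ‖d (x, s)‖ ^ 4 = (‖d (x, s)‖ ^ 2) ^ 2 by ring,
      EuclideanSpace.real_norm_sq_eq]
  · have hzero : ∫ x, ∑ j, sderiv j (energyFlux (fun i w => u w i) (fun i w => d w i) p j)
        (x, t) = 0 := by
      rw [integral_finsetSum _ fun j _ => hflux_int j]
      exact Finset.sum_eq_zero fun j _ => integral_sderiv_eq_zero hK (hflux j) (hflux0 j) ht j
    rw [← integral_neg, ← sub_zero (∫ x, tderiv _ (x, t)), ← hzero, ← integral_sub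
      (integrable_slice hK hdens.tderiv (hdens0.fderiv_apply hK _) ht)
      (integrable_finsetSum _ fun j _ => hflux_int j)]
    refine integral_congr_ae (ae_of_all _ fun x => ?_)
    simp only [hbalance t ht x, add_sub_cancel_right, cNgrad, EuclideanSpace.real_norm_sq_eq]
end
end
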